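/- For all integers k, Δ ≥ 2 and every real γ > 0 there exists n_0 such that every k-graph H on n ≥ n_0 vertices with minimum codegree δ_{k−1}(H) ≥ (1/2 + γ)n contains every tight k-tree T on n vertices with maximum 1-degree Δ_1(T) ≤ Δ. -/

import Mathlib

open Finset

attribute [local instance] Classical.propDecidable

variable {α : Type*}

/-- The degree of a vertex `v` in a hypergraph `T`: the number of edges containing `v`. -/
def vdeg [DecidableEq α] (T : Finset (Finset α)) (v : α) : ℕ :=
  (T.filter fun e => v ∈ e).card

/-- The vertex set of a hypergraph: the union of its edges. -/
def hverts [DecidableEq α] (T : Finset (Finset α)) : Finset α := T.sup id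

/-- The maximum 1-degree of a hypergraph. -/
def hmaxDeg [DecidableEq α] (T : Finset (Finset α)) : ℕ := (hverts T).sup (vdeg T)

/-- `es` is a valid ordering of the edges of a tight `k`-tree: every edge is a `k`-set, and
every edge except the first contains a vertex `v` not in any previous edge with the rest of
the edge contained in some previous edge. -/
def ValidOrdering [DecidableEq α] (k : ℕ) (es : List (Finset α)) : Prop :=
  (∀ e ∈ es, e.card = k) ∧
  ∀ i, 0 < i → i < es.length →
    ∃ v ∈ es.getD i ∅,
      (∀ j, j < i → v ∉ es.getD j ∅) ∧
      ∃ j, j < i ∧ (es.getD i ∅) \ {v} ⊆ es.getD j ∅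

/-- `T` is a tight `k`-tree: its edges admit a valid ordering. -/
def IsTightTree [DecidableEq α] (k : ℕ) (T : Finset (Finset α)) : Prop :=
  ∃ es : List (Finset α), es ≠ [] ∧ es.Nodup ∧ es.toFinset = T ∧ ValidOrdering k es

/-- `f` belongs to the shadow of the `k`-graph `H`. -/
def InShadow [DecidableEq α] (k : ℕ) (H : Finset (Finset α)) (f : Finset α) : Prop :=
  f.card = k - 1 ∧ ∃ e ∈ H, f ⊆ e

/-- `H` contains (a copy of) `T`. -/
def Contains {β : Type*} [DecidableEq α] [DecidableEq β]
    (H : Finset (Finset α)) (T : Finset (Finset β)) : Prop :=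
  ∃ φ : β → α, Function.Injective φ ∧ ∀ e ∈ T, e.image φ ∈ H

namespace STC

section Heat
variable {k : ℕ} {V : Type*}

/-- total weight of the extensions of `e` at coordinate `i` inside `U` -/
noncomputable def Zs (U : Finset V) (w : (Fin k → V) → ℝ) (e : Fin k → V) (i : Fin k) : ℝ :=
  ∑ v ∈ U, w (Function.update e i v)

/-- heat-bath transition probabilities -/
noncomputable def qs (U : Finset V) (w : (Fin k → V) → ℝ) (e : Fin k → V) (i : Fin k) (v : V) : ℝ :=
  if Zs U w e i = 0 then 1 / (U.card : ℝ) else w (Function.update e i v) / Zs U w e i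

/-- heat-bath operator -/
noncomputable def Qs (U : Finset V) (w : (Fin k → V) → ℝ) (i : Fin k) (h : (Fin k → V) → ℝ)
    (e : Fin k → V) : ℝ :=
  ∑ v ∈ U, qs U w e i v * h (Function.update e i v)

/-- injectivity away from coordinate `i` -/
def InjOff (e : Fin k → V) (i : Fin k) : Prop := Set.InjOn e {i}ᶜ

structure HB (E : (Fin k → V) → Prop) (U : Finset V) (w : (Fin k → V) → ℝ) (K g : ℝ) : Prop where
  hE : ∀ e, E e → Function.Injective e
  w0 : ∀ e, ¬ E e → w e = 0
  w1 : ∀ e, E e → 1 ≤ w e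
  wK : ∀ e, w e ≤ K
  K1 : 1 ≤ K
  g0 : 0 < g
  U0 : 0 < U.card
  cod : ∀ e i, InjOff e i → (1/2 + g) * (U.card : ℝ) ≤ ((U.filter fun v => E (Function.update e i v)).card : ℝ)

variable {E : (Fin k → V) → Prop} {U : Finset V} {w : (Fin k → V) → ℝ} {K g : ℝ}

lemma InjOff_of_inj {e : Fin k → V} (h : Function.Injective e) (i : Fin k) : InjOff e i := h.injOn

lemma InjOff_update {e : Fin k → V} {i : Fin k} (h : InjOff e i) (v : V) : InjOff (Function.update e i v) i := by
  intro a ha b hb hab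
  have ha' : a ≠ i := ha
  have hb' : b ≠ i := hb
  rw [Function.update_of_ne ha', Function.update_of_ne hb'] at hab
  exact h ha hb hab

namespace HB

lemma w_nonneg (H : HB E U w K g) (e : Fin k → V) : 0 ≤ w e := by
  by_cases h : E e
  · exact le_trans zero_le_one (H.w1 e h)
  · rw [H.w0 e h]

lemma Z_nonneg (H : HB E U w K g) (e : Fin k → V) (i : Fin k) : 0 ≤ Zs U w e i :=
  Finset.sum_nonneg fun v _ => H.w_nonneg _

lemma Upos (H : HB E U w K g) : (0 : ℝ) < U.card := by exact_mod_cast H.U0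

lemma Z_le (H : HB E U w K g) (e : Fin k → V) (i : Fin k) : Zs U w e i ≤ K * U.card := by
  unfold Zs
  calc ∑ v ∈ U, w (Function.update e i v) ≤ ∑ v ∈ U, K := Finset.sum_le_sum fun v _ => H.wK _
    _ = K * U.card := by rw [Finset.sum_const, nsmul_eq_mul, mul_comm]

lemma Z_ge (H : HB E U w K g) {e : Fin k → V} {i : Fin k} (he : InjOff e i) :
    (1/2) * (U.card : ℝ) ≤ Zs U w e i := by
  have h1 := H.cod e i he
  have h2 : ((U.filter fun v => E (Function.update e i v)).card : ℝ) ≤ Zs U w e i := by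
    unfold Zs
    calc ((U.filter fun v => E (Function.update e i v)).card : ℝ)
        = ∑ v ∈ U.filter (fun v => E (Function.update e i v)), (1 : ℝ) := by simp
      _ ≤ ∑ v ∈ U.filter (fun v => E (Function.update e i v)), w (Function.update e i v) :=
          Finset.sum_le_sum fun v hv => H.w1 _ (Finset.mem_filter.1 hv).2
      _ ≤ ∑ v ∈ U, w (Function.update e i v) :=
          Finset.sum_le_sum_of_subset_of_nonneg (Finset.filter_subset _ _)
            fun v _ _ => H.w_nonneg _
  have := H.Upos
  have := H.g0
  nlinarith

lemma Z_pos (H : HB E U w K g) {e : Fin k → V} {i : Fin k} (he : InjOff e i) : 0 < Zs U w e i := by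
  have := H.Z_ge he
  have := H.Upos
  linarith

lemma q_eq (H : HB E U w K g) {e : Fin k → V} {i : Fin k} (he : InjOff e i) (v : V) :
    qs U w e i v = w (Function.update e i v) / Zs U w e i := by
  unfold qs
  rw [if_neg (H.Z_pos he).ne']

lemma q_nonneg (H : HB E U w K g) (e : Fin k → V) (i : Fin k) (v : V) : 0 ≤ qs U w e i v := by
  unfold qs
  split_ifs
  · positivity
  · exact div_nonneg (H.w_nonneg _) (H.Z_nonneg _ _)

lemma q_sum (H : HB E U w K g) (e : Fin k → V) (i : Fin k) : ∑ v ∈ U, qs U w e i v = 1 := by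
  have := H.Upos
  unfold qs
  split_ifs with h
  · rw [Finset.sum_const, nsmul_eq_mul]; field_simp
  · rw [← Finset.sum_div]
    exact div_self h

lemma q_le (H : HB E U w K g) {e : Fin k → V} {i : Fin k} (he : InjOff e i) (v : V) :
    qs U w e i v ≤ 2 * K / U.card := by
  rw [H.q_eq he, div_le_div_iff₀ (H.Z_pos he) H.Upos]
  have h1 := H.Z_ge he
  have h2 := H.wK (Function.update e i v)
  have := H.Upos
  have := H.K1
  nlinarith

lemma q_E (H : HB E U w K g) {e : Fin k → V} {i : Fin k} (he : InjOff e i) {v : V}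
    (hq : qs U w e i v ≠ 0) : E (Function.update e i v) := by
  by_contra h
  rw [H.q_eq he, H.w0 _ h, zero_div] at hq
  exact hq rfl

lemma q_ge (H : HB E U w K g) {e : Fin k → V} {i : Fin k} (he : InjOff e i) {v : V}
    (hv : E (Function.update e i v)) : 1 / (K * U.card) ≤ qs U w e i v := by
  rw [H.q_eq he]
  exact div_le_div₀ (H.w_nonneg _) (H.w1 _ hv) (H.Z_pos he) (H.Z_le _ _)

lemma overlap (H : HB E U w K g) {e e' : Fin k → V} {i : Fin k} (he : InjOff e i) (he' : InjOff e' i) :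
    2 * g / K ≤ ∑ v ∈ U, min (qs U w e i v) (qs U w e' i v) := by
  set A := U.filter fun v => E (Function.update e i v)
  set B := U.filter fun v => E (Function.update e' i v)
  have hA := H.cod e i he
  have hB := H.cod e' i he'
  have hAB : (A.card : ℝ) + B.card ≤ U.card + (A ∩ B).card := by
    have h1 := Finset.card_union_add_card_inter A B
    have h2 : (A ∪ B).card ≤ U.card := Finset.card_le_card
      (Finset.union_subset (Finset.filter_subset _ _) (Finset.filter_subset _ _))
    exact_mod_cast (by omega : A.card + B.card ≤ U.card + (A ∩ B).card)
  have h2 : 2 * g * U.card ≤ ((A ∩ B).card : ℝ) := by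
    have : (1/2 + g) * (U.card : ℝ) ≤ A.card := hA
    have : (1/2 + g) * (U.card : ℝ) ≤ B.card := hB
    linarith
  have hU := H.Upos
  have hK := H.K1
  calc 2 * g / K = (2 * g * U.card) * (1 / (K * U.card)) := by field_simp
    _ ≤ ((A ∩ B).card : ℝ) * (1 / (K * U.card)) :=
        mul_le_mul_of_nonneg_right h2 (by positivity)
    _ = ∑ v ∈ A ∩ B, (1 / (K * U.card)) := by rw [Finset.sum_const, nsmul_eq_mul]
    _ ≤ ∑ v ∈ A ∩ B, min (qs U w e i v) (qs U w e' i v) := by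
        refine Finset.sum_le_sum fun v hv => ?_
        rw [Finset.mem_inter] at hv
        exact le_min (H.q_ge he (Finset.mem_filter.1 hv.1).2)
          (H.q_ge he' (Finset.mem_filter.1 hv.2).2)
    _ ≤ _ := Finset.sum_le_sum_of_subset_of_nonneg
          (fun v hv => (Finset.mem_filter.1 (Finset.mem_inter.1 hv).1).1)
          fun v _ _ => le_min (H.q_nonneg _ _ _) (H.q_nonneg _ _ _)

lemma p_le_one (H : HB E U w K g) {e : Fin k → V} {i : Fin k} (he : InjOff e i) : 2 * g / K ≤ 1 := by
  refine (H.overlap he he).trans ?_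
  rw [← H.q_sum e i]
  exact Finset.sum_le_sum fun v _ => min_le_left _ _

lemma Q_nonneg (H : HB E U w K g) {h : (Fin k → V) → ℝ} (hh : ∀ e, 0 ≤ h e) (i : Fin k)
    (e : Fin k → V) : 0 ≤ Qs U w i h e :=
  Finset.sum_nonneg fun v _ => mul_nonneg (H.q_nonneg _ _ _) (hh _)

/-- range is preserved by the heat bath operator -/
lemma Q_range (H : HB E U w K g) {h : (Fin k → V) → ℝ} {lo hi : ℝ}
    (hh : ∀ e, E e → lo ≤ h e ∧ h e ≤ hi) (i : Fin k) (e : Fin k → V) (he : E e) :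
    lo ≤ Qs U w i h e ∧ Qs U w i h e ≤ hi := by
  have hi' := InjOff_of_inj (H.hE e he) i
  have key : ∀ v ∈ U, qs U w e i v * lo ≤ qs U w e i v * h (Function.update e i v) ∧
      qs U w e i v * h (Function.update e i v) ≤ qs U w e i v * hi := by
    intro v _
    by_cases hq : qs U w e i v = 0
    · simp [hq]
    · have := hh _ (H.q_E hi' hq)
      exact ⟨mul_le_mul_of_nonneg_left this.1 (H.q_nonneg _ _ _),
        mul_le_mul_of_nonneg_left this.2 (H.q_nonneg _ _ _)⟩
  constructor
  · calc lo = ∑ v ∈ U, qs U w e i v * lo := by rw [← Finset.sum_mul, H.q_sum, one_mul]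
      _ ≤ _ := Finset.sum_le_sum fun v hv => (key v hv).1
  · calc Qs U w i h e ≤ ∑ v ∈ U, qs U w e i v * hi := Finset.sum_le_sum fun v hv => (key v hv).2
      _ = hi := by rw [← Finset.sum_mul, H.q_sum, one_mul]

/-- one coupling step -/
lemma couple (H : HB E U w K g) {h : (Fin k → V) → ℝ} {lo B B' : ℝ} (C : Finset (Fin k))
    (hh : ∀ e, E e → lo ≤ h e ∧ h e ≤ lo + B) (i : Fin k) (hB : B' ≤ B)
    (hC : ∀ e e', E e → E e' → (∀ j ∈ insert i C, e j = e' j) → h e - h e' ≤ B')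
    (e e' : Fin k → V) (he : E e) (he' : E e') (hag : ∀ j ∈ C, e j = e' j) :
    Qs U w i h e - Qs U w i h e' ≤ (2 * g / K) * B' + (1 - 2 * g / K) * B := by
  have hi := InjOff_of_inj (H.hE e he) i
  have hi' := InjOff_of_inj (H.hE e' he') i
  set m : V → ℝ := fun v => min (qs U w e i v) (qs U w e' i v) with hm
  set s := ∑ v ∈ U, m v with hs
  have hsp : 2 * g / K ≤ s := H.overlap hi hi'
  have e1 : ∑ v ∈ U, m v * (h (Function.update e i v) - h (Function.update e' i v)) ≤ s * B' := by
    rw [hs, Finset.sum_mul]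
    refine Finset.sum_le_sum fun v hv => ?_
    have m0 : 0 ≤ m v := le_min (H.q_nonneg _ _ _) (H.q_nonneg _ _ _)
    by_cases hq : m v = 0
    · simp [hq]
    · have mpos : 0 < m v := lt_of_le_of_ne m0 (Ne.symm hq)
      refine mul_le_mul_of_nonneg_left ?_ m0
      refine hC _ _ (H.q_E hi (lt_of_lt_of_le mpos (min_le_left _ _)).ne')
        (H.q_E hi' (lt_of_lt_of_le mpos (min_le_right _ _)).ne') ?_
      intro j hj
      by_cases hji : j = i
      · subst hji; simp
      · rw [Function.update_of_ne hji, Function.update_of_ne hji]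
        exact hag j ((Finset.mem_insert.1 hj).resolve_left hji)
  have e2 : ∑ v ∈ U, (qs U w e i v - m v) * h (Function.update e i v) ≤ (1 - s) * (lo + B) := by
    rw [hs, ← H.q_sum e i, ← Finset.sum_sub_distrib, Finset.sum_mul]
    refine Finset.sum_le_sum fun v hv => ?_
    have m0 : 0 ≤ qs U w e i v - m v := sub_nonneg.2 (min_le_left _ _)
    by_cases hq : qs U w e i v = 0
    · have : m v = 0 := le_antisymm (hq ▸ min_le_left _ _)
        (le_min (H.q_nonneg _ _ _) (H.q_nonneg _ _ _))
      simp [hq, this]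
    · exact mul_le_mul_of_nonneg_left (hh _ (H.q_E hi hq)).2 m0
  have e3 : (1 - s) * lo ≤ ∑ v ∈ U, (qs U w e' i v - m v) * h (Function.update e' i v) := by
    rw [hs, ← H.q_sum e' i, ← Finset.sum_sub_distrib, Finset.sum_mul]
    refine Finset.sum_le_sum fun v hv => ?_
    have m0 : 0 ≤ qs U w e' i v - m v := sub_nonneg.2 (min_le_right _ _)
    by_cases hq : qs U w e' i v = 0
    · have : m v = 0 := le_antisymm (hq ▸ min_le_right _ _)
        (le_min (H.q_nonneg _ _ _) (H.q_nonneg _ _ _))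
      simp [hq, this]
    · exact mul_le_mul_of_nonneg_left (hh _ (H.q_E hi' hq)).1 m0
  have e4 : Qs U w i h e - Qs U w i h e' =
      ∑ v ∈ U, m v * (h (Function.update e i v) - h (Function.update e' i v)) +
      ∑ v ∈ U, (qs U w e i v - m v) * h (Function.update e i v) -
      ∑ v ∈ U, (qs U w e' i v - m v) * h (Function.update e' i v) := by
    unfold Qs
    rw [← Finset.sum_add_distrib, ← Finset.sum_sub_distrib, ← Finset.sum_sub_distrib]
    refine Finset.sum_congr rfl fun v _ => ?_
    ring
  rw [e4]
  nlinarith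

/-- apply the operators of a word -/
noncomputable def _root_.STC.QW (U : Finset V) (w : (Fin k → V) → ℝ) (W : List (Fin k))
    (h : (Fin k → V) → ℝ) : (Fin k → V) → ℝ :=
  W.foldr (fun i h => Qs U w i h) h

lemma QW_range (H : HB E U w K g) {h : (Fin k → V) → ℝ} {lo hi : ℝ}
    (hh : ∀ e, E e → lo ≤ h e ∧ h e ≤ hi) (W : List (Fin k)) :
    ∀ e, E e → lo ≤ QW U w W h e ∧ QW U w W h e ≤ hi := by
  induction W with
  | nil => exact hh
  | cons i W ih => exact fun e he => H.Q_range ih i e he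

lemma couple_word (H : HB E U w K g) {h : (Fin k → V) → ℝ} {lo B : ℝ} (hB : 0 ≤ B)
    (hh : ∀ e, E e → lo ≤ h e ∧ h e ≤ lo + B) (W : List (Fin k)) :
    ∀ C : Finset (Fin k), (∀ i, i ∈ C ∨ i ∈ W) →
    ∀ e e', E e → E e' → (∀ j ∈ C, e j = e' j) →
      QW U w W h e - QW U w W h e' ≤ (1 - (2 * g / K) ^ W.length) * B := by
  induction W with
  | nil =>
    intro C hC e e' he he' hag
    have : e = e' := funext fun i => hag i (by simpa using hC i)
    simp [this]
  | cons i W ih =>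
    intro C hC e e' he he' hag
    have hp0 : 0 ≤ 2 * g / K := div_nonneg (by linarith [H.g0]) (by linarith [H.K1])
    have h1 := H.couple (B' := (1 - (2 * g / K) ^ W.length) * B) C (H.QW_range hh W) i
      (by nlinarith [mul_nonneg (pow_nonneg hp0 W.length) hB])
      (ih (insert i C) (fun j => by
        rcases hC j with h | h
        · exact Or.inl (Finset.mem_insert_of_mem h)
        · rcases List.mem_cons.1 h with h | h
          · exact Or.inl (h ▸ Finset.mem_insert_self _ _)
          · exact Or.inr h)) e e' he he' hag
    have h2 : QW U w (i :: W) h = Qs U w i (QW U w W h) := rfl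
    rw [h2, List.length_cons, pow_succ]
    linarith

lemma exists_range [Finite V] {h : (Fin k → V) → ℝ} {B : ℝ} (hB : 0 ≤ B)
    (hh : ∀ e e', E e → E e' → h e - h e' ≤ B) :
    ∃ lo, ∀ e, E e → lo ≤ h e ∧ h e ≤ lo + B := by
  by_cases hne : ∃ e, E e
  · haveI : Nonempty {e // E e} := ⟨⟨hne.choose, hne.choose_spec⟩⟩
    obtain ⟨x, hx⟩ := Finite.exists_min (fun e : {e // E e} => h e.1)
    refine ⟨h x.1, fun e he => ⟨hx ⟨e, he⟩, ?_⟩⟩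
    have := hh e x.1 he x.2
    linarith
  · exact ⟨0, fun e he => (hne ⟨e, he⟩).elim⟩

/-- mixing over many blocks -/
lemma mixing [Finite V] (H : HB E U w K g) {h : (Fin k → V) → ℝ}
    (hh : ∀ e, E e → 0 ≤ h e ∧ h e ≤ 1) (L : ℕ) (Ws : List (List (Fin k)))
    (hp : 2 * g / K ≤ 1)
    (hWs : ∀ W ∈ Ws, W.length = L ∧ ∀ i, i ∈ W) :
    ∃ lo, ∀ e, E e → lo ≤ QW U w Ws.flatten h e ∧
      QW U w Ws.flatten h e ≤ lo + (1 - (2 * g / K) ^ L) ^ Ws.length := by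
  have hp0 : 0 ≤ 2 * g / K := div_nonneg (by linarith [H.g0]) (by linarith [H.K1])
  have hb : 0 ≤ 1 - (2 * g / K) ^ L := sub_nonneg.2 (pow_le_one₀ hp0 hp)
  induction Ws with
  | nil => exact ⟨0, by simpa [QW] using hh⟩
  | cons W Ws ih =>
    obtain ⟨lo, hlo⟩ := ih fun W' hW' => hWs W' (List.mem_cons_of_mem _ hW')
    obtain ⟨hl, hc⟩ := hWs W List.mem_cons_self
    have heq : QW U w (W :: Ws).flatten h = QW U w W (QW U w Ws.flatten h) := by
      simp [QW, List.foldr_append]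
    rw [heq, List.length_cons, pow_succ]
    refine exists_range (by positivity) fun e e' he he' => ?_
    have := H.couple_word (pow_nonneg hb Ws.length) hlo W ∅ (fun i => Or.inr (hc i)) e e' he he'
      (by simp)
    rw [hl] at this
    linarith

/-- stationarity -/
lemma stat (H : HB E U w K g) (i : Fin k) (h : (Fin k → V) → ℝ) :
    ∑ e ∈ Fintype.piFinset (fun _ : Fin k => U), w e * Qs U w i h e =
    ∑ e ∈ Fintype.piFinset (fun _ : Fin k => U), w e * h e := by
  set P := Fintype.piFinset (fun _ : Fin k => U) with hP
  have hZ : ∀ e v, Zs U w (Function.update e i v) i = Zs U w e i := by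
    intro e v; simp [Zs]
  have hmem : ∀ e ∈ P, ∀ v ∈ U, Function.update e i v ∈ P := by
    intro e he v hv
    rw [hP, Fintype.mem_piFinset] at he ⊢
    intro a
    by_cases ha : a = i
    · subst ha; simpa
    · rw [Function.update_of_ne ha]; exact he a
  have s1 : ∑ e ∈ P, w e * Qs U w i h e =
      ∑ x ∈ P ×ˢ U, w x.1 * (w (Function.update x.1 i x.2) / Zs U w x.1 i *
        h (Function.update x.1 i x.2)) := by
    rw [Finset.sum_product]
    refine Finset.sum_congr rfl fun e _ => ?_
    dsimp only
    rw [← Finset.mul_sum]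
    by_cases he : E e
    · unfold Qs
      congr 1
      refine Finset.sum_congr rfl fun v _ => ?_
      rw [H.q_eq (InjOff_of_inj (H.hE e he) i)]
    · rw [H.w0 e he]; simp
  have s2 : ∑ x ∈ P ×ˢ U, w x.1 * (w (Function.update x.1 i x.2) / Zs U w x.1 i *
        h (Function.update x.1 i x.2)) =
      ∑ x ∈ P ×ˢ U, w (Function.update x.1 i x.2) * (w x.1 / Zs U w x.1 i * h x.1) := by
    refine Finset.sum_nbij' (fun x => (Function.update x.1 i x.2, x.1 i))
      (fun x => (Function.update x.1 i x.2, x.1 i)) ?_ ?_ ?_ ?_ ?_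
    · rintro ⟨e, v⟩ hx
      rw [Finset.mem_product] at hx ⊢
      exact ⟨hmem _ hx.1 _ hx.2, Fintype.mem_piFinset.1 hx.1 i⟩
    · rintro ⟨e, v⟩ hx
      rw [Finset.mem_product] at hx ⊢
      exact ⟨hmem _ hx.1 _ hx.2, Fintype.mem_piFinset.1 hx.1 i⟩
    · rintro ⟨e, v⟩ hx; simp
    · rintro ⟨e, v⟩ hx; simp
    · rintro ⟨e, v⟩ hx; simp [hZ]
  rw [s1, s2, Finset.sum_product]
  refine Finset.sum_congr rfl fun e he => ?_
  dsimp only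
  rw [← Finset.sum_mul]
  change Zs U w e i * _ = _
  by_cases hE : E e
  · have := (H.Z_pos (InjOff_of_inj (H.hE e hE) i)).ne'
    field_simp
  · rw [H.w0 e hE]; simp

lemma statW (H : HB E U w K g) (W : List (Fin k)) (h : (Fin k → V) → ℝ) :
    ∑ e ∈ Fintype.piFinset (fun _ : Fin k => U), w e * QW U w W h e =
    ∑ e ∈ Fintype.piFinset (fun _ : Fin k => U), w e * h e := by
  induction W with
  | nil => rfl
  | cons i W ih => rw [← ih]; exact H.stat i _

/-- after mixing, the value is at most the stationary mean plus error -/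
lemma mixed_le [Finite V] (H : HB E U w K g) {h : (Fin k → V) → ℝ}
    (hh : ∀ e, E e → 0 ≤ h e ∧ h e ≤ 1) (L : ℕ) (Ws : List (List (Fin k)))
    (hp : 2 * g / K ≤ 1)
    (hWs : ∀ W ∈ Ws, W.length = L ∧ ∀ i, i ∈ W) {mean : ℝ}
    (hpos : 0 < ∑ e ∈ Fintype.piFinset (fun _ : Fin k => U), w e)
    (hmean : ∑ e ∈ Fintype.piFinset (fun _ : Fin k => U), w e * h e ≤
      mean * ∑ e ∈ Fintype.piFinset (fun _ : Fin k => U), w e) (e : Fin k → V) (he : E e) :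
    QW U w Ws.flatten h e ≤ mean + (1 - (2 * g / K) ^ L) ^ Ws.length := by
  obtain ⟨lo, hlo⟩ := H.mixing hh L Ws hp hWs
  have h1 : lo * ∑ e ∈ Fintype.piFinset (fun _ : Fin k => U), w e ≤
      mean * ∑ e ∈ Fintype.piFinset (fun _ : Fin k => U), w e := by
    refine le_trans ?_ hmean
    rw [← H.statW Ws.flatten h, Finset.mul_sum]
    refine Finset.sum_le_sum fun e _ => ?_
    by_cases hE : E e
    · rw [mul_comm]
      exact mul_le_mul_of_nonneg_left (hlo e hE).1 (H.w_nonneg e)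
    · rw [H.w0 e hE]; simp
  have h2 : lo ≤ mean := le_of_mul_le_mul_right h1 hpos
  linarith [(hlo e he).2]

end HB
end Heat
end STC

namespace STC
section Cheap

lemma threshold {V : Type} (U : Finset V) (f : V → ℝ) (s : ℝ) (hs : 0 < s) (hsu : s ≤ U.card) :
    ∃ a, (∃ v ∈ U, f v = a) ∧ s ≤ ((U.filter fun v => f v ≤ a).card : ℝ) ∧
      ((U.filter fun v => f v < a).card : ℝ) < s := by
  have hUne : U.Nonempty := by
    rw [← Finset.card_pos]
    have : (0:ℝ) < U.card := lt_of_lt_of_le hs hsu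
    exact_mod_cast this
  set G := U.filter fun v => s ≤ ((U.filter fun x => f x ≤ f v).card : ℝ) with hG
  have hGne : G.Nonempty := by
    obtain ⟨x, hx, hmax⟩ := Finset.exists_max_image U f hUne
    refine ⟨x, Finset.mem_filter.2 ⟨hx, ?_⟩⟩
    rw [Finset.filter_true_of_mem hmax]
    exact hsu
  obtain ⟨x, hx, hmin⟩ := Finset.exists_min_image G f hGne
  rw [hG, Finset.mem_filter] at hx
  refine ⟨f x, ⟨x, hx.1, rfl⟩, hx.2, ?_⟩
  by_contra hcon
  push Not at hcon
  set L := U.filter fun v => f v < f x with hL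
  have hLne : L.Nonempty := by
    rw [← Finset.card_pos]
    have : (0:ℝ) < L.card := lt_of_lt_of_le hs hcon
    exact_mod_cast this
  obtain ⟨y, hy, hymax⟩ := Finset.exists_max_image L f hLne
  have hy' := Finset.mem_filter.1 hy
  have : y ∈ G := by
    refine Finset.mem_filter.2 ⟨hy'.1, hcon.trans ?_⟩
    have : L ⊆ U.filter fun z => f z ≤ f y := fun z hz =>
      Finset.mem_filter.2 ⟨(Finset.mem_filter.1 hz).1, hymax z hz⟩
    exact_mod_cast Finset.card_le_card this
  have := hmin y this
  linarith [hy'.2]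

lemma cheap_count {m : ℕ} (hm : 1 ≤ m) {V : Type} {E : (Fin (m+1) → V) → Prop} {U : Finset V} {f : V → ℝ}
    {g θ : ℝ} (hg : 0 < g) (hg1 : g ≤ 1/2) (hθ : 0 < θ) (hθ1 : θ ≤ 1/8)
    (hf : ∀ v, 0 ≤ f v ∧ f v ≤ 1)
    (cod : ∀ e i, InjOff e i → (1/2 + g) * (U.card : ℝ) ≤
      ((U.filter fun v => E (Function.update e i v)).card : ℝ))
    (hu : 2 * (m+1 : ℝ) ≤ θ * U.card) :
    (θ/2)^m * (g/2) * (U.card : ℝ)^(m+1) ≤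
    (((Fintype.piFinset (fun _ : Fin (m+1) => U)).filter fun e => E e ∧
      ∑ i, f (e i) ≤ (m+1) * ((∑ v ∈ U, f v) / U.card + θ)).card : ℝ) := by
  have hU : (0:ℝ) < U.card := by
    by_contra h
    have : (0:ℝ) ≤ m := by positivity
    nlinarith
  obtain ⟨a, -, ha1, ha2⟩ := threshold U f (θ * U.card) (by positivity) (by nlinarith)
  obtain ⟨b, -, hb1, hb2⟩ := threshold U f ((1/2 - g/2) * U.card) (by nlinarith) (by nlinarith)
  set A := U.filter fun v => f v ≤ a with hA
  have hab : a ≤ b := by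
    by_contra h
    push Not at h
    have : (U.filter fun v => f v ≤ b).card ≤ (U.filter fun v => f v < a).card :=
      Finset.card_le_card fun v hv => by
        rw [Finset.mem_filter] at hv ⊢
        exact ⟨hv.1, lt_of_le_of_lt hv.2 h⟩
    have : ((U.filter fun v => f v ≤ b).card : ℝ) ≤ (U.filter fun v => f v < a).card := by
      exact_mod_cast this
    nlinarith
  have hAcard : 0 < A.card := by
    have : (0:ℝ) < A.card := lt_of_lt_of_le (by positivity) ha1
    exact_mod_cast this
  have ha01 : a ≤ 1 := by
    by_contra h
    push Not at h
    have : U.filter (fun v => f v < a) = U := Finset.filter_true_of_mem fun v _ =>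
      lt_of_le_of_lt (hf v).2 h
    rw [this] at ha2
    nlinarith
  have ha0 : 0 ≤ a := by
    obtain ⟨x, hx⟩ := Finset.card_pos.1 hAcard
    exact (hf x).1.trans (Finset.mem_filter.1 hx).2
  set avg := (∑ v ∈ U, f v) / U.card with havg
  have hsum : a * U.card + (b - a) * (U.card / 2) - θ * U.card ≤ ∑ v ∈ U, f v := by
    have h1 : ∑ v ∈ U, (a + (b - a) * (if f v < b then 0 else 1) - a * (if f v < a then 1 else 0)) ≤
        ∑ v ∈ U, f v := by
      refine Finset.sum_le_sum fun v _ => ?_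
      have := hf v
      split_ifs <;> linarith
    have h2 : ∑ v ∈ U, (a + (b - a) * (if f v < b then 0 else 1) - a * (if f v < a then 1 else 0)) =
        a * U.card + (b - a) * (U.card - (U.filter fun v => f v < b).card) -
          a * (U.filter fun v => f v < a).card := by
      rw [Finset.sum_sub_distrib, Finset.sum_add_distrib, ← Finset.mul_sum, ← Finset.mul_sum]
      have e1 : ∑ v ∈ U, (if f v < b then (0:ℝ) else 1) = U.card - (U.filter fun v => f v < b).card := by
        have : ∀ v, (if f v < b then (0:ℝ) else 1) = 1 - (if f v < b then (1:ℝ) else 0) := by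
          intro v; split_ifs <;> norm_num
        rw [Finset.sum_congr rfl fun v _ => this v, Finset.sum_sub_distrib, Finset.sum_boole]
        simp
      rw [e1, Finset.sum_boole]
      simp [mul_comm]
    rw [h2] at h1
    have h3 : (b - a) * (U.card / 2) ≤ (b - a) * (U.card - (U.filter fun v => f v < b).card) := by
      refine mul_le_mul_of_nonneg_left ?_ (by linarith)
      nlinarith
    have h4 : a * (U.filter fun v => f v < a).card ≤ 1 * (θ * U.card) := by
      refine mul_le_mul ha01 ha2.le (by positivity) (by norm_num)
    linarith
  have havg2 : (a + b) / 2 - θ ≤ avg := by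
    rw [havg, le_div_iff₀ hU]
    nlinarith
  -- the injection
  set T : (Fin m ↪ A) → Finset V := fun s => U.filter fun v =>
    E (Fin.cons v (fun j => ((s j : A) : V)) : Fin (m+1) → V) ∧ f v ≤ b with hT
  have hTcard : ∀ s, (g/2) * (U.card : ℝ) ≤ (T s).card := by
    intro s
    set e0 : Fin (m+1) → V := Fin.cons ((s ⟨0, hm⟩ : A) : V) (fun j => ((s j : A) : V)) with he0
    have hinj0 : InjOff e0 0 := by
      intro x hx y hy hxy
      obtain ⟨x', rfl⟩ := Fin.exists_succ_eq.2 (show x ≠ 0 from hx)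
      obtain ⟨y', rfl⟩ := Fin.exists_succ_eq.2 (show y ≠ 0 from hy)
      simp only [he0, Fin.cons_succ] at hxy
      rw [s.injective (Subtype.ext hxy)]
    have h1 := cod e0 0 hinj0
    have h2 : ∀ v, Function.update e0 0 v = Fin.cons v (fun j => ((s j : A) : V)) := by
      intro v
      rw [he0, Fin.update_cons_zero]
    simp only [h2] at h1
    set X := U.filter fun v => E (Fin.cons v (fun j => ((s j : A) : V)) : Fin (m+1) → V)
    set Y := U.filter fun v => f v ≤ b
    have hXY : X ∩ Y = T s := by
      ext v; simp only [X, Y, hT, Finset.mem_inter, Finset.mem_filter]; tauto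
    have h3 := Finset.card_union_add_card_inter X Y
    have h4 : (X ∪ Y).card ≤ U.card := Finset.card_le_card
      (Finset.union_subset (Finset.filter_subset _ _) (Finset.filter_subset _ _))
    have h5 : (X.card : ℝ) + Y.card ≤ U.card + (T s).card := by
      rw [hXY] at h3
      exact_mod_cast (by omega : X.card + Y.card ≤ U.card + (T s).card)
    linarith
  have hinj : ((Finset.univ : Finset (Fin m ↪ A)).sigma T).card ≤
      ((Fintype.piFinset (fun _ : Fin (m+1) => U)).filter fun e => E e ∧
      ∑ i, f (e i) ≤ (m+1) * (avg + θ)).card := by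
    refine Finset.card_le_card_of_injOn
      (fun x => (Fin.cons x.2 (fun j => ((x.1 j : A) : V)) : Fin (m+1) → V)) ?_ ?_
    · rintro ⟨s, v⟩ hx
      have hx2 := (Finset.mem_sigma.1 hx).2
      have hx3 := Finset.mem_filter.1 hx2
      have hsA : ∀ j, ((s j : A) : V) ∈ U ∧ f (s j : A) ≤ a := fun j => Finset.mem_filter.1 (s j).2
      refine Finset.mem_coe.2 (Finset.mem_filter.2 ⟨?_, hx3.2.1, ?_⟩)
      · rw [Fintype.mem_piFinset]
        intro i
        refine Fin.cases ?_ (fun j => ?_) i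
        · exact hx3.1
        · exact (hsA j).1
      · rw [Fin.sum_univ_succ]
        simp only [Fin.cons_zero, Fin.cons_succ]
        have : ∑ j : Fin m, f ((s j : A) : V) ≤ m * a := by
          calc ∑ j : Fin m, f ((s j : A) : V) ≤ ∑ j : Fin m, a := Finset.sum_le_sum fun j _ => (hsA j).2
            _ = m * a := by simp
        have h6 := hx3.2.2
        have hm' : (1:ℝ) ≤ m := by exact_mod_cast hm
        dsimp only at h6
        nlinarith
    · rintro ⟨s, v⟩ _ ⟨s', v'⟩ _ h
      obtain ⟨h1, h2⟩ := Fin.cons_inj.1 h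
      have h3 : s = s' := by
        ext j
        exact congrFun h2 j
      dsimp only at h1
      subst h1 h3
      rfl
  have hsig : (Fintype.card (Fin m ↪ A) : ℝ) * ((g/2) * U.card) ≤
      (((Finset.univ : Finset (Fin m ↪ A)).sigma T).card : ℝ) := by
    rw [Finset.card_sigma]
    push_cast
    calc (Fintype.card (Fin m ↪ A) : ℝ) * ((g/2) * U.card) = ∑ s : (Fin m ↪ A), (g/2) * (U.card : ℝ) := by
          rw [Finset.sum_const, nsmul_eq_mul, Finset.card_univ]
      _ ≤ _ := Finset.sum_le_sum fun s _ => hTcard s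
  have hemb : (θ/2 * U.card)^m ≤ (Fintype.card (Fin m ↪ A) : ℝ) := by
    rw [Fintype.card_embedding_eq, Fintype.card_coe, Fintype.card_fin]
    have h1 := Nat.pow_sub_le_descFactorial A.card m
    have h2 : ((A.card + 1 - m : ℕ) : ℝ)^m ≤ (A.card.descFactorial m : ℝ) := by exact_mod_cast h1
    refine le_trans ?_ h2
    refine pow_le_pow_left₀ (by positivity) ?_ m
    have h3 : (A.card : ℝ) + 1 ≤ ((A.card + 1 - m : ℕ) : ℝ) + m := by
      exact_mod_cast (by omega : A.card + 1 ≤ (A.card + 1 - m) + m)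
    linarith
  have hfin : ((((Finset.univ : Finset (Fin m ↪ A)).sigma T).card : ℕ) : ℝ) ≤
      (((Fintype.piFinset (fun _ : Fin (m+1) => U)).filter fun e => E e ∧
      ∑ i, f (e i) ≤ (m+1) * (avg + θ)).card : ℝ) := by exact_mod_cast hinj
  refine le_trans ?_ (hsig.trans hfin)
  calc (θ/2)^m * (g/2) * (U.card : ℝ)^(m+1) = (θ/2 * U.card)^m * ((g/2) * U.card) := by
        rw [mul_pow, pow_succ]; ring
    _ ≤ _ := mul_le_mul_of_nonneg_right hemb (by positivity)

/-- the constant `K` -/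
noncomputable def KK (m : ℕ) (θ g : ℝ) : ℝ := 1 + 1 / (θ * ((θ/2)^m * (g/2)))

lemma exists_weight {m : ℕ} (hm : 1 ≤ m) {V : Type} {E : (Fin (m+1) → V) → Prop} {U : Finset V}
    {f : V → ℝ} {g θ : ℝ} (hg : 0 < g) (hg1 : g ≤ 1/2) (hθ : 0 < θ) (hθ1 : θ ≤ 1/8)
    (hE : ∀ e, E e → Function.Injective e)
    (hsym : ∀ e (σ : Equiv.Perm (Fin (m+1))), E e → E (e ∘ σ))
    (hf : ∀ v, 0 ≤ f v ∧ f v ≤ 1)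
    (cod : ∀ e i, InjOff e i → (1/2 + g) * (U.card : ℝ) ≤
      ((U.filter fun v => E (Function.update e i v)).card : ℝ))
    (hu : 2 * (m+1 : ℝ) ≤ θ * U.card) :
    ∃ w, HB E U w (KK m θ g) g ∧ 0 < ∑ e ∈ Fintype.piFinset (fun _ : Fin (m+1) => U), w e ∧
      ∀ c, ∑ e ∈ Fintype.piFinset (fun _ : Fin (m+1) => U), w e * f (e c) ≤
        ((∑ v ∈ U, f v) / U.card + 2 * θ) * ∑ e ∈ Fintype.piFinset (fun _ : Fin (m+1) => U), w e := by
  have hU : (0:ℝ) < U.card := by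
    by_contra h
    have : (0:ℝ) ≤ m := by positivity
    nlinarith
  have hcount := cheap_count hm hg hg1 hθ hθ1 hf cod hu
  set avg := (∑ v ∈ U, f v) / U.card with havg
  set P := Fintype.piFinset (fun _ : Fin (m+1) => U) with hP
  set K := KK m θ g with hK
  have hK1 : 1 ≤ K := by
    rw [hK, KK]
    have : 0 ≤ 1 / (θ * ((θ/2)^m * (g/2))) := by positivity
    linarith
  set Ch : (Fin (m+1) → V) → Prop := fun e => ∑ i, f (e i) ≤ (m+1) * (avg + θ) with hCh
  set w : (Fin (m+1) → V) → ℝ := fun e => if E e then (if Ch e then K else 1) else 0 with hw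
  have hw0 : ∀ e, 0 ≤ w e := by
    intro e; simp only [hw]; split_ifs <;> linarith
  have hHB : HB E U w K g := by
    refine ⟨hE, ?_, ?_, ?_, hK1, hg, by exact_mod_cast hU, cod⟩
    · intro e he; simp [hw, he]
    · intro e he; simp only [hw, he, if_true]; split_ifs <;> linarith
    · intro e; simp only [hw]; split_ifs <;> linarith
  set Pc := P.filter fun e => E e ∧ Ch e with hPc
  have hPcpos : (0:ℝ) < Pc.card := lt_of_lt_of_le (by positivity) hcount
  refine ⟨w, hHB, ?_, ?_⟩
  · obtain ⟨e, he⟩ := Finset.card_pos.1 (by exact_mod_cast hPcpos : 0 < Pc.card)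
    have he' := Finset.mem_filter.1 he
    refine Finset.sum_pos' (fun e _ => hw0 e) ⟨e, he'.1, ?_⟩
    exact lt_of_lt_of_le one_pos (hHB.w1 e he'.2.1)
  · -- symmetric
    have hsymE : ∀ e (σ : Equiv.Perm (Fin (m+1))), E (e ∘ σ) ↔ E e := by
      intro e σ
      refine ⟨fun h => ?_, hsym e σ⟩
      have := hsym _ σ⁻¹ h
      have h2 : (e ∘ σ) ∘ (σ⁻¹ : Equiv.Perm (Fin (m+1))) = e := by
        funext x; simp
      rwa [h2] at this
    have hChs : ∀ e (σ : Equiv.Perm (Fin (m+1))), Ch (e ∘ σ) ↔ Ch e := by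
      intro e σ
      simp only [hCh, Function.comp]
      rw [Equiv.sum_comp σ (fun i => f (e i))]
    have hws : ∀ e (σ : Equiv.Perm (Fin (m+1))), w (e ∘ σ) = w e := by
      intro e σ; simp only [hw, hsymE, hChs]
    have hcc : ∀ c c', ∑ e ∈ P, w e * f (e c) = ∑ e ∈ P, w e * f (e c') := by
      intro c c'
      refine Finset.sum_nbij' (fun e => e ∘ Equiv.swap c c') (fun e => e ∘ Equiv.swap c c') ?_ ?_ ?_ ?_ ?_
      · intro e he
        rw [hP, Fintype.mem_piFinset] at he ⊢
        exact fun i => he _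
      · intro e he
        rw [hP, Fintype.mem_piFinset] at he ⊢
        exact fun i => he _
      · intro e _; funext x; simp
      · intro e _; funext x; simp
      · intro e _; rw [hws]; simp
    intro c
    have hall : (m+1 : ℝ) * ∑ e ∈ P, w e * f (e c) = ∑ e ∈ P, w e * ∑ i, f (e i) := by
      calc (m+1 : ℝ) * ∑ e ∈ P, w e * f (e c) = ∑ i : Fin (m+1), ∑ e ∈ P, w e * f (e i) := by
            rw [Finset.sum_congr rfl fun i _ => hcc i c]; simp
        _ = _ := by
            rw [Finset.sum_comm]
            exact Finset.sum_congr rfl fun e _ => (Finset.mul_sum _ _ _).symm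
    have hmain : ∑ e ∈ P, w e * (∑ i, f (e i) - (m+1) * (avg + 2*θ)) ≤ 0 := by
      have hpt : ∀ e ∈ P, w e * (∑ i, f (e i) - (m+1) * (avg + 2*θ)) ≤
          (m+1) * (1 - (if E e ∧ Ch e then K * θ else 0)) := by
        intro e _
        have hs1 : ∑ i, f (e i) ≤ m + 1 := by
          calc ∑ i, f (e i) ≤ ∑ i : Fin (m+1), (1:ℝ) := Finset.sum_le_sum fun i _ => (hf _).2
            _ = m + 1 := by simp
        have hav : 0 ≤ avg := div_nonneg (Finset.sum_nonneg fun v _ => (hf v).1) hU.le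
        have hm0 : (0:ℝ) ≤ m := by positivity
        by_cases h1 : E e
        · by_cases h2 : Ch e
          · have h3 : ∑ i, f (e i) ≤ (m+1) * (avg + θ) := h2
            simp only [hw, h1, h2, if_true, and_self]
            nlinarith [mul_nonneg hm0 hθ.le]
          · simp only [hw, h1, h2, if_true, if_false, and_false]
            nlinarith [mul_nonneg hm0 hθ.le, mul_nonneg hm0 hav]
        · simp only [hw, h1, if_false, false_and]
          nlinarith
      refine (Finset.sum_le_sum hpt).trans ?_
      rw [← Finset.mul_sum, Finset.sum_sub_distrib, ← Finset.sum_filter]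
      have hPcard : (P.card : ℝ) = (U.card : ℝ)^(m+1) := by
        rw [hP, Fintype.card_piFinset]; simp
      have hle : (P.card : ℝ) ≤ Pc.card * (K * θ) := by
        rw [hPcard]
        have hc0 : (0:ℝ) < (θ/2)^m * (g/2) := by positivity
        have : 1 ≤ ((θ/2)^m * (g/2)) * (K * θ) := by
          rw [hK, KK]
          have : ((θ/2)^m * (g/2)) * ((1 + 1 / (θ * ((θ/2)^m * (g/2)))) * θ) =
              ((θ/2)^m * (g/2)) * θ + 1 := by
            field_simp
          rw [this]
          have : 0 < ((θ/2)^m * (g/2)) * θ := by positivity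
          linarith
        calc (U.card : ℝ)^(m+1) ≤ (((θ/2)^m * (g/2)) * (K * θ)) * (U.card : ℝ)^(m+1) :=
              le_mul_of_one_le_left (by positivity) this
          _ = ((θ/2)^m * (g/2) * (U.card : ℝ)^(m+1)) * (K * θ) := by ring
          _ ≤ _ := mul_le_mul_of_nonneg_right hcount (by positivity)
      rw [Finset.sum_const, Finset.sum_const, nsmul_eq_mul, nsmul_eq_mul, mul_one]
      have hm0 : (0:ℝ) ≤ m + 1 := by positivity
      exact mul_nonpos_of_nonneg_of_nonpos hm0 (sub_nonpos.2 hle)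
    have hexp : ∑ e ∈ P, w e * (∑ i, f (e i) - (m+1) * (avg + 2*θ)) =
        (m+1) * (∑ e ∈ P, w e * f (e c) - (avg + 2*θ) * ∑ e ∈ P, w e) := by
      rw [mul_sub, hall, Finset.mul_sum, Finset.mul_sum, ← Finset.sum_sub_distrib]
      refine Finset.sum_congr rfl fun e _ => ?_
      ring
    rw [hexp] at hmain
    have hm0 : (0:ℝ) < m + 1 := by positivity
    nlinarith [nonpos_of_mul_nonpos_right hmain hm0]

end Cheap
end STC

namespace STC

/-- combinatorial data of an ordered tight tree with `t` edges, written as coloured tuples -/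
structure TD (k Δ t : ℕ) (β : Type) where
  p : ℕ → ℕ
  c : ℕ → Fin k
  τ : ℕ → Fin k → β
  hp : ∀ j, 0 < j → j < t → p j < j
  hτ : ∀ j, 0 < j → j < t → ∀ i, i ≠ c j → τ j i = τ (p j) i
  hnew : ∀ j, 0 < j → j < t → ∀ i, i < j → ∀ a, τ i a ≠ τ j (c j)
  hinj : ∀ j, j < t → Function.Injective (τ j)
  hcol : ∀ j, 0 < j → j < t → 0 < p j → c (p j) ≠ c j
  hdeg : ∀ v, ((range t).filter fun j => ∃ a, τ j a = v).card ≤ Δ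

namespace TD
variable {k Δ t : ℕ} {β V : Type} (T : TD k Δ t β)

/-- the new vertex of node `j` -/
def x (j : ℕ) : β := T.τ j (T.c j)

/-- down-closed sets of nodes -/
structure DC (A : Finset ℕ) : Prop where
  sub : ∀ j ∈ A, j < t
  zero : 0 ∈ A
  par : ∀ j ∈ A, 0 < j → T.p j ∈ A

/-- vertices used by a set of nodes -/
noncomputable def verts (A : Finset ℕ) : Finset β := A.biUnion fun j => univ.image (T.τ j)

variable {T}

lemma mem_verts {A : Finset ℕ} {v : β} : v ∈ T.verts A ↔ ∃ j ∈ A, ∃ a, T.τ j a = v := by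
  simp [verts]

lemma x_mem {A : Finset ℕ} {j : ℕ} (hj : j ∈ A) : T.x j ∈ T.verts A :=
  mem_verts.2 ⟨j, hj, _, rfl⟩

lemma tau_mem {A : Finset ℕ} {j : ℕ} (hj : j ∈ A) (a) : T.τ j a ∈ T.verts A :=
  mem_verts.2 ⟨j, hj, _, rfl⟩

lemma verts_mono {A B : Finset ℕ} (h : A ⊆ B) : T.verts A ⊆ T.verts B := by
  intro v hv
  obtain ⟨j, hj, a, h1⟩ := mem_verts.1 hv
  exact mem_verts.2 ⟨j, h hj, a, h1⟩

lemma x_in_edge {A : Finset ℕ} (hA : T.DC A) {j : ℕ} (h0 : 0 < j) (ht : j < t) :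
    ∀ i ∈ A, ∀ a, T.τ i a = T.x j → j ∈ A ∧ a = T.c j ∧ (i ≠ j → 0 < i ∧ a ≠ T.c i ∧
      T.τ (T.p i) a = T.x j) := by
  intro i
  induction i using Nat.strong_induction_on with
  | _ i ih =>
    intro hi a ha
    rcases lt_trichotomy i j with h | h | h
    · exact absurd ha (T.hnew j h0 ht i h a)
    · subst h
      exact ⟨hi, T.hinj i ht ha, fun h => absurd rfl h⟩
    · have hi0 : 0 < i := by omega
      have hit := hA.sub i hi
      have hac : a ≠ T.c i := by
        rintro rfl
        exact T.hnew i hi0 hit j h (T.c j) ha.symm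
      have h1 := T.hτ i hi0 hit a hac
      rw [h1] at ha
      have := ih (T.p i) (T.hp i hi0 hit) (hA.par i hi hi0) a ha
      exact ⟨this.1, this.2.1, fun _ => ⟨hi0, hac, ha⟩⟩

lemma DC_range (ht : 0 < t) : T.DC (range t) where
  sub := fun j hj => by simpa using hj
  zero := by simpa using ht
  par := fun j hj h0 => by
    have := T.hp j h0 (by simpa using hj)
    simp at hj ⊢; omega

lemma DC.pos {A : Finset ℕ} (hA : T.DC A) : 0 < t := hA.sub 0 hA.zero

lemma x_not_mem {A : Finset ℕ} (hA : T.DC A) {j : ℕ} (h0 : 0 < j) (ht : j < t) (hj : j ∉ A) :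
    T.x j ∉ T.verts A := by
  intro h
  obtain ⟨i, hi, a, h1⟩ := mem_verts.1 h
  exact hj (x_in_edge hA h0 ht i hi a h1).1

lemma x_inj {i j : ℕ} (hi0 : 0 < i) (hi : i < t) (hj0 : 0 < j) (hj : j < t) (h : T.x i = T.x j) :
    i = j := by
  rcases lt_trichotomy i j with h' | h' | h'
  · exact absurd h (T.hnew j hj0 hj i h' _)
  · exact h'
  · exact absurd h.symm (T.hnew i hi0 hi j h' _)

lemma DC.insert {A : Finset ℕ} (hA : T.DC A) {j : ℕ} (ht : j < t) (hj : T.p j ∈ A) :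
    T.DC (insert j A) where
  sub := fun i hi => by
    rcases Finset.mem_insert.1 hi with rfl | h
    · exact ht
    · exact hA.sub i h
  zero := Finset.mem_insert_of_mem hA.zero
  par := fun i hi h0 => by
    rcases Finset.mem_insert.1 hi with rfl | h
    · exact Finset.mem_insert_of_mem hj
    · exact Finset.mem_insert_of_mem (hA.par i h h0)

lemma verts_insert {A : Finset ℕ} {j : ℕ} (h0 : 0 < j) (ht : j < t) (hj : T.p j ∈ A) :
    T.verts (insert j A) = insert (T.x j) (T.verts A) := by
  ext v
  rw [Finset.mem_insert, mem_verts, mem_verts]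
  constructor
  · rintro ⟨i, hi, a, rfl⟩
    rcases Finset.mem_insert.1 hi with rfl | h
    · by_cases ha : a = T.c i
      · left; rw [ha]; rfl
      · right; exact ⟨T.p i, hj, a, (T.hτ i h0 ht a ha).symm⟩
    · right; exact ⟨i, h, a, rfl⟩
  · rintro (rfl | ⟨i, hi, a, rfl⟩)
    · exact ⟨j, Finset.mem_insert_self _ _, _, rfl⟩
    · exact ⟨i, Finset.mem_insert_of_mem hi, a, rfl⟩

lemma card_verts {A : Finset ℕ} (hA : T.DC A) : (T.verts A).card + 1 = k + A.card := by
  have h1 : T.verts A = univ.image (T.τ 0) ∪ (A.erase 0).image T.x := by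
    ext v
    rw [mem_verts, Finset.mem_union]
    constructor
    · rintro ⟨i, hi, a, rfl⟩
      induction i using Nat.strong_induction_on with
      | _ i ih =>
        by_cases hi0 : i = 0
        · subst hi0; left; simp
        · have hi0' : 0 < i := by omega
          by_cases hac : a = T.c i
          · right
            rw [Finset.mem_image]
            exact ⟨i, Finset.mem_erase.2 ⟨hi0, hi⟩, by rw [hac]; rfl⟩
          · rw [T.hτ i hi0' (hA.sub i hi) a hac]
            exact ih _ (T.hp i hi0' (hA.sub i hi)) (hA.par i hi hi0')
    · rintro (h | h)
      · obtain ⟨a, _, rfl⟩ := Finset.mem_image.1 h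
        exact ⟨0, hA.zero, a, rfl⟩
      · obtain ⟨i, hi, rfl⟩ := Finset.mem_image.1 h
        exact ⟨i, (Finset.mem_erase.1 hi).2, _, rfl⟩
  have h2 : Disjoint (univ.image (T.τ 0)) ((A.erase 0).image T.x) := by
    rw [Finset.disjoint_left]
    intro v hv hv'
    obtain ⟨a, _, rfl⟩ := Finset.mem_image.1 hv
    obtain ⟨i, hi, h⟩ := Finset.mem_image.1 hv'
    have hi' := Finset.mem_erase.1 hi
    have h0 : 0 < i := Nat.pos_of_ne_zero hi'.1
    exact T.hnew i h0 (hA.sub i hi'.2) 0 h0 a h.symm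
  rw [h1, Finset.card_union_of_disjoint h2, Finset.card_image_of_injective _ (T.hinj 0 hA.pos),
    Finset.card_image_of_injOn, Finset.card_erase_of_mem hA.zero]
  · have : 0 < A.card := Finset.card_pos.2 ⟨0, hA.zero⟩
    simp; omega
  · intro i hi j hj h
    have hi' := Finset.mem_erase.1 hi
    have hj' := Finset.mem_erase.1 hj
    exact x_inj (Nat.pos_of_ne_zero hi'.1) (hA.sub i hi'.2) (Nat.pos_of_ne_zero hj'.1)
      (hA.sub j hj'.2) h

variable (T) in
/-- embeddings of a set of nodes -/
structure Emb (E : (Fin k → V) → Prop) (A : Finset ℕ) (φ : β → V) : Prop where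
  inj : Set.InjOn φ (T.verts A)
  edge : ∀ j ∈ A, E (φ ∘ T.τ j)

lemma upd_tau {φ : β → V} {j : ℕ} {A : Finset ℕ} (h0 : 0 < j) (ht : j < t) (hA : T.DC A)
    (hp : T.p j ∈ A) (v : V) (hj : j ∉ A) :
    Function.update φ (T.x j) v ∘ T.τ j = Function.update (φ ∘ T.τ (T.p j)) (T.c j) v := by
  funext a
  by_cases ha : a = T.c j
  · subst ha
    simp [x]
  · rw [Function.update_of_ne ha, Function.comp, Function.comp, T.hτ j h0 ht a ha,
      Function.update_of_ne]
    intro h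
    exact x_not_mem hA h0 ht hj (h ▸ tau_mem hp a)

lemma upd_old {φ : β → V} {j i : ℕ} {A : Finset ℕ} (h0 : 0 < j) (ht : j < t) (hA : T.DC A)
    (hi : i ∈ A) (v : V) (hj : j ∉ A) :
    Function.update φ (T.x j) v ∘ T.τ i = φ ∘ T.τ i := by
  funext a
  rw [Function.comp, Function.comp, Function.update_of_ne]
  intro h
  exact x_not_mem hA h0 ht hj (h ▸ tau_mem hi a)

lemma upd_verts {φ : β → V} {j : ℕ} {A : Finset ℕ} (h0 : 0 < j) (ht : j < t) (hA : T.DC A)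
    (hj : j ∉ A) (v : V) {y : β} (hy : y ∈ T.verts A) : Function.update φ (T.x j) v y = φ y := by
  rw [Function.update_of_ne]
  rintro rfl
  exact x_not_mem hA h0 ht hj hy

lemma Emb.extend {E : (Fin k → V) → Prop} {φ : β → V} {j : ℕ} {A : Finset ℕ} (hφ : T.Emb E A φ)
    (h0 : 0 < j) (ht : j < t) (hA : T.DC A)
    (hp : T.p j ∈ A) {v : V} (hj : j ∉ A) (hv : ∀ y ∈ T.verts A, φ y ≠ v)
    (hE : E (Function.update (φ ∘ T.τ (T.p j)) (T.c j) v)) :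
    T.Emb E (insert j A) (Function.update φ (T.x j) v) where
  inj := by
    rw [verts_insert h0 ht hp]
    intro y hy z hz h
    rw [Finset.mem_coe, Finset.mem_insert] at hy hz
    rcases hy with rfl | hy <;> rcases hz with rfl | hz
    · rfl
    · rw [Function.update_self, upd_verts h0 ht hA hj v hz] at h
      exact absurd h.symm (hv _ hz)
    · rw [Function.update_self, upd_verts h0 ht hA hj v hy] at h
      exact absurd h (hv _ hy)
    · rw [upd_verts h0 ht hA hj v hy, upd_verts h0 ht hA hj v hz] at h
      exact hφ.inj hy hz h
  edge := by
    intro i hi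
    rcases Finset.mem_insert.1 hi with rfl | h
    · rw [upd_tau h0 ht hA hp v hj]; exact hE
    · rw [upd_old h0 ht hA h v hj]; exact hφ.edge i h

variable (T) in
/-- admissible orders for adding nodes -/
def Adm : Finset ℕ → List ℕ → Prop
  | _, [] => True
  | A, j :: L => 0 < j ∧ j < t ∧ j ∉ A ∧ T.p j ∈ A ∧ Adm (insert j A) L

lemma exists_adm (P : Finset ℕ) : ∀ (A : Finset ℕ), Disjoint A P → (∀ j ∈ P, 0 < j ∧ j < t ∧
    T.p j ∈ A ∪ P) → ∃ L : List ℕ, L.toFinset = P ∧ L.Nodup ∧ T.Adm A L := by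
  induction P using Finset.strongInduction with
  | _ P ih =>
    intro A hd hP
    rcases P.eq_empty_or_nonempty with rfl | hne
    · exact ⟨[], by simp, by simp, trivial⟩
    · set j := P.min' hne with hj
      have hjP : j ∈ P := P.min'_mem hne
      have hjA : j ∉ A := fun h => Finset.disjoint_left.1 hd h hjP
      obtain ⟨h0, ht, hpj⟩ := hP j hjP
      have hpA : T.p j ∈ A := by
        rcases Finset.mem_union.1 hpj with h | h
        · exact h
        · have := P.min'_le _ h
          have := T.hp j h0 ht
          omega
      obtain ⟨L, hL, hn, ha⟩ := ih (P.erase j) (Finset.erase_ssubset hjP) (insert j A) (by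
        rw [Finset.disjoint_left]
        intro i hi hi'
        have := Finset.mem_erase.1 hi'
        rcases Finset.mem_insert.1 hi with h | h
        · exact this.1 h
        · exact Finset.disjoint_left.1 hd h this.2) (by
        intro i hi
        have := Finset.mem_erase.1 hi
        obtain ⟨h1, h2, h3⟩ := hP i this.2
        refine ⟨h1, h2, ?_⟩
        rcases Finset.mem_union.1 h3 with h | h
        · simp [h]
        · by_cases h' : T.p i = j
          · simp [h']
          · simp [h, h'])
      refine ⟨j :: L, ?_, ?_, h0, ht, hjA, hpA, ha⟩
      · rw [List.toFinset_cons, hL, Finset.insert_erase hjP]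
      · rw [List.nodup_cons]
        refine ⟨?_, hn⟩
        intro h
        have : j ∈ P.erase j := by rw [← hL]; simpa using h
        simp at this

lemma adm_dc {L : List ℕ} : ∀ {A : Finset ℕ}, T.DC A → T.Adm A L → T.DC (A ∪ L.toFinset) := by
  induction L with
  | nil => intro A hA _; simpa using hA
  | cons j L ih =>
    intro A hA h
    obtain ⟨h0, ht, hj, hp, h⟩ := h
    have := ih (hA.insert ht hp) h
    rw [List.toFinset_cons, Finset.union_insert]
    rwa [Finset.insert_union] at this

lemma adm_mem {L : List ℕ} : ∀ {A : Finset ℕ}, T.Adm A L → ∀ j ∈ L, 0 < j ∧ j < t ∧ j ∉ A ∧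
    (T.p j ∈ A ∨ T.p j ∈ L) := by
  induction L with
  | nil => intro A _ j hj; simp at hj
  | cons i L ih =>
    intro A h j hj
    obtain ⟨h0, ht, hi, hp, h⟩ := h
    rcases List.mem_cons.1 hj with rfl | hj
    · exact ⟨h0, ht, hi, Or.inl hp⟩
    · obtain ⟨h1, h2, h3, h4⟩ := ih h j hj
      refine ⟨h1, h2, fun h => h3 (Finset.mem_insert_of_mem h), ?_⟩
      rcases h4 with h | h
      · rcases Finset.mem_insert.1 h with h | h
        · right; rw [h]; simp
        · left; exact h
      · right; exact List.mem_cons_of_mem _ h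

/-- all colours occur among `Δ` consecutive ancestors -/
lemma window {j : ℕ} (h : ∀ i, i < Δ → 0 < T.p^[i] j) (ht : j < t) (a : Fin k) :
    ∃ i, i < Δ ∧ T.c (T.p^[i] j) = a := by
  by_contra hcon
  push Not at hcon
  have hlt : ∀ i, i ≤ Δ → T.p^[i] j < t ∧ T.τ (T.p^[i] j) a = T.τ j a := by
    intro i
    induction i with
    | zero => intro _; exact ⟨ht, rfl⟩
    | succ i ih =>
      intro hi
      obtain ⟨h1, h2⟩ := ih (by omega)
      rw [Function.iterate_succ_apply']
      have hpos := h i (by omega)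
      have := T.hp _ hpos h1
      refine ⟨by omega, ?_⟩
      rw [← T.hτ _ hpos h1 a (hcon i (by omega)).symm, h2]
  have hdec : ∀ i i', i < i' → i' ≤ Δ → T.p^[i'] j < T.p^[i] j := by
    intro i i' hii
    induction i', hii using Nat.le_induction with
    | base =>
      intro hi
      rw [Function.iterate_succ_apply']
      exact T.hp _ (h i (by omega)) (hlt i (by omega)).1
    | succ m hm ih =>
      intro hi
      rw [Function.iterate_succ_apply']
      exact lt_trans (T.hp _ (h m (by omega)) (hlt m (by omega)).1) (ih (by omega))
  have hsub : (range (Δ+1)).image (fun i => T.p^[i] j) ⊆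
      (range t).filter fun i => ∃ b, T.τ i b = T.τ j a := by
    intro y hy
    obtain ⟨i, hi, rfl⟩ := Finset.mem_image.1 hy
    have hi' : i ≤ Δ := by simp at hi; omega
    rw [Finset.mem_filter]
    exact ⟨by simpa using (hlt i hi').1, a, (hlt i hi').2⟩
  have hc := Finset.card_le_card hsub
  rw [Finset.card_image_of_injOn, Finset.card_range] at hc
  · have := T.hdeg (T.τ j a); omega
  · intro i hi i' hi' hh
    simp at hi hi' hh
    rcases lt_trichotomy i i' with h1 | h1 | h1
    · have := hdec i i' h1 (by omega); omega
    · exact h1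
    · have := hdec i' i h1 (by omega); omega

/-- few children -/
lemma children (hk : 2 ≤ k) (i : ℕ) :
    ((range t).filter fun j => 0 < j ∧ T.p j = i).card ≤ k * Δ := by
  have hsub : ((range t).filter fun j => 0 < j ∧ T.p j = i) ⊆
      (univ : Finset (Fin k)).biUnion fun a => (range t).filter fun j => ∃ b, T.τ j b = T.τ i a := by
    intro j hj
    rw [Finset.mem_filter] at hj
    obtain ⟨hj, h0, hp⟩ := hj
    have hjt : j < t := by simpa using hj
    rw [Finset.mem_biUnion]
    have : ∃ a : Fin k, a ≠ T.c j := by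
      haveI : Nontrivial (Fin k) := Fin.nontrivial_iff_two_le.2 hk
      exact exists_ne _
    obtain ⟨a, ha⟩ := this
    refine ⟨a, Finset.mem_univ _, ?_⟩
    rw [Finset.mem_filter]
    exact ⟨hj, a, by rw [T.hτ j h0 hjt a ha, hp]⟩
  calc _ ≤ _ := Finset.card_le_card hsub
    _ ≤ ∑ a : Fin k, _ := Finset.card_biUnion_le
    _ ≤ ∑ a : Fin k, Δ := Finset.sum_le_sum fun a _ => T.hdeg _
    _ = k * Δ := by simp

end TD
end STC

namespace STC

lemma exists_TD {β : Type} [inst : DecidableEq β] {k Δ : ℕ} (hk : 2 ≤ k) {G : Finset (Finset β)}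
    (h : IsTightTree k G) (hd : ∀ v, vdeg G v ≤ Δ) :
    ∃ t, 0 < t ∧ ∃ T : TD k Δ t β, (∀ e ∈ G, ∃ j, j < t ∧ e = univ.image (T.τ j)) ∧
      ∀ j, j < t → univ.image (T.τ j) ∈ G := by
  obtain rfl : inst = fun a b => Classical.propDecidable _ := Subsingleton.elim _ _
  obtain ⟨es, hne, hnd, hes, hcard, hval⟩ := h
  set e : ℕ → Finset β := fun i => es.getD i ∅ with he
  have hemem : ∀ i, i < es.length → e i ∈ es := by
    intro i hi
    simp only [he, List.getD_eq_getElem _ _ hi]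
    exact List.getElem_mem hi
  have hek : ∀ i, i < es.length → (e i).card = k := fun i hi => hcard _ (hemem i hi)
  have hpos : 0 < es.length := List.length_pos_iff.2 hne
  haveI : Nonempty β := by
    have := hek 0 hpos
    have : (e 0).Nonempty := by rw [← Finset.card_pos]; omega
    exact ⟨this.choose⟩
  haveI : Nonempty (Fin k) := ⟨⟨0, by omega⟩⟩
  have hval' : ∀ i, 0 < i → i < es.length → ∃ v : β, ∃ P : ℕ, v ∈ e i ∧ (∀ j, j < i → v ∉ e j) ∧
      P < i ∧ e i \ {v} ⊆ e P ∧ ∀ Q, Q < P → ¬ (e i \ {v} ⊆ e Q) := by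
    intro i h0 hi
    obtain ⟨v, hv, hnew, j, hj, hsub⟩ := hval i h0 hi
    have hex : ∃ j, e i \ {v} ⊆ e j := ⟨j, hsub⟩
    exact ⟨v, Nat.find hex, hv, hnew, lt_of_le_of_lt (Nat.find_min' hex hsub) hj,
      Nat.find_spec hex, fun Q hQ => Nat.find_min hex hQ⟩
  choose! v P hv hnew hP hsub hmin using hval'
  have key : ∀ s, s ≤ es.length → ∃ τ : ℕ → Fin k → β,
      (∀ j, j < s → Function.Injective (τ j) ∧ univ.image (τ j) = e j) ∧
      ∀ j, 0 < j → j < s → ∃ c, τ j = Function.update (τ (P j)) c (v j) := by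
    intro s
    induction s with
    | zero => intro _; exact ⟨fun _ _ => Classical.arbitrary β, by simp, by simp⟩
    | succ s ih =>
      intro hs
      obtain ⟨τ, h1, h2⟩ := ih (by omega)
      by_cases hs0 : s = 0
      · subst hs0
        have hc := hek 0 hpos
        let f := (e 0).equivFinOfCardEq hc
        refine ⟨fun _ a => (f.symm a : β), ?_, by intros; omega⟩
        intro j hj
        obtain rfl : j = 0 := by omega
        constructor
        · exact Subtype.val_injective.comp f.symm.injective
        · ext y
          simp only [Finset.mem_image, Finset.mem_univ, true_and]
          constructor
          · rintro ⟨a, rfl⟩; exact (f.symm a).2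
          · intro hy; exact ⟨f ⟨y, hy⟩, by simp⟩
      · have hs0' : 0 < s := by omega
        have hst : s < es.length := by omega
        obtain ⟨hi, him⟩ := h1 (P s) (hP s hs0' hst)
        have hex : ∃ c, τ (P s) c ∉ e s \ {v s} := by
          by_contra hcon
          push Not at hcon
          have : e (P s) ⊆ e s \ {v s} := by
            rw [← him]
            intro y hy
            obtain ⟨a, _, rfl⟩ := Finset.mem_image.1 hy
            exact hcon a
          have h3 := this.trans (Finset.sdiff_subset)
          have h4 := Finset.eq_of_subset_of_card_le h3 (by
            rw [hek _ hst, hek _ (by have := hP s hs0' hst; omega)])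
          have h5 := hv s hs0' hst
          rw [← h4] at h5
          have := this h5
          simp at this
        obtain ⟨c, hc⟩ := hex
        have hvP : ∀ a, τ (P s) a ≠ v s := by
          intro a ha
          have : v s ∈ e (P s) := by rw [← him, ← ha]; simp
          exact hnew s hs0' hst _ (hP s hs0' hst) this
        have hinj : Function.Injective (Function.update (τ (P s)) c (v s)) := by
          intro a b hab
          by_cases ha : a = c <;> by_cases hb : b = c
          · rw [ha, hb]
          · subst ha
            rw [Function.update_self, Function.update_of_ne hb] at hab
            exact absurd hab.symm (hvP b)
          · subst hb
            rw [Function.update_self, Function.update_of_ne ha] at hab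
            exact absurd hab (hvP a)
          · rw [Function.update_of_ne ha, Function.update_of_ne hb] at hab
            exact hi hab
        have himg : univ.image (Function.update (τ (P s)) c (v s)) = e s := by
          symm
          apply Finset.eq_of_subset_of_card_le
          · intro y hy
            rw [Finset.mem_image]
            by_cases hyv : y = v s
            · exact ⟨c, Finset.mem_univ _, by simp [hyv]⟩
            · have hy' : y ∈ e s \ {v s} := by simp [hy, hyv]
              have hyP := hsub s hs0' hst hy'
              rw [← him] at hyP
              obtain ⟨a, _, rfl⟩ := Finset.mem_image.1 hyP
              refine ⟨a, Finset.mem_univ _, ?_⟩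
              rw [Function.update_of_ne]
              rintro rfl
              exact hc hy'
          · rw [Finset.card_image_of_injective _ hinj, hek s hst]; simp
        refine ⟨Function.update τ s (Function.update (τ (P s)) c (v s)), ?_, ?_⟩
        · intro j hj
          by_cases hjs : j = s
          · subst hjs; rw [Function.update_self]; exact ⟨hinj, himg⟩
          · rw [Function.update_of_ne hjs]; exact h1 j (by omega)
        · intro j h0 hj
          have hPj : P j < j := hP j h0 (by omega)
          rw [Function.update_of_ne (show P j ≠ s by omega)]
          by_cases hjs : j = s
          · subst hjs; rw [Function.update_self]; exact ⟨c, rfl⟩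
          · rw [Function.update_of_ne hjs]; exact h2 j h0 (by omega)
  obtain ⟨τ, h1, h2⟩ := key es.length le_rfl
  choose! c hc using h2
  have hmemτ : ∀ j, j < es.length → ∀ y, y ∈ e j ↔ ∃ a, τ j a = y := by
    intro j hj y
    rw [← (h1 j hj).2]; simp
  have heinj : ∀ i j, i < es.length → j < es.length → e i = e j → i = j := by
    intro i j hi hj hij
    simp only [he, List.getD_eq_getElem _ _ hi, List.getD_eq_getElem _ _ hj] at hij
    exact (hnd.getElem_inj_iff).1 hij
  refine ⟨es.length, hpos, ⟨P, c, τ, hP, ?_, ?_, fun j hj => (h1 j hj).1, ?_, ?_⟩, ?_, ?_⟩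
  · intro j h0 hj i hi
    conv_lhs => rw [hc j h0 hj]
    rw [Function.update_of_ne hi]
  · intro j h0 hj i hi a ha
    have : τ j (c j) = v j := by
      conv_lhs => rw [hc j h0 hj]
      simp
    rw [this] at ha
    exact hnew j h0 hj i hi ((hmemτ i (by omega) _).2 ⟨a, ha⟩)
  · intro j h0 hj hp0 hcc
    have hPj := hP j h0 hj
    have hPt : P j < es.length := by omega
    apply hmin j h0 hj (P (P j)) (hP (P j) hp0 hPt)
    intro y hy
    rw [Finset.mem_sdiff, Finset.mem_singleton] at hy
    obtain ⟨a, ha⟩ := (hmemτ j hj y).1 hy.1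
    have hac : a ≠ c j := by
      rintro rfl
      apply hy.2
      rw [← ha]
      conv_lhs => rw [hc j h0 hj]
      simp
    rw [hc j h0 hj, Function.update_of_ne hac, hc (P j) hp0 hPt, hcc, Function.update_of_ne hac] at ha
    exact (hmemτ _ (by have := hP (P j) hp0 hPt; omega) y).2 ⟨a, ha⟩
  · intro y
    refine le_trans ?_ (hd y)
    unfold vdeg
    rw [← hes]
    apply Finset.card_le_card_of_injOn e
    · intro j hj
      have hj := Finset.mem_filter.1 hj
      have hjt : j < es.length := by simpa using hj.1
      rw [Finset.mem_coe, Finset.mem_filter]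
      refine ⟨by simpa using hemem j hjt, (hmemτ j hjt y).2 hj.2⟩
    · intro i hi j hj hij
      have hi := (Finset.mem_filter.1 hi).1
      have hj := (Finset.mem_filter.1 hj).1
      exact heinj i j (by simpa using hi) (by simpa using hj) hij
  · intro f hf
    rw [← hes] at hf
    have hf' : f ∈ es := by simpa using hf
    obtain ⟨j, hj, rfl⟩ := List.mem_iff_getElem.1 hf'
    refine ⟨j, hj, ?_⟩
    show _ = univ.image (τ j)
    rw [(h1 j hj).2]
    simp only [he, List.getD_eq_getElem _ _ hj]
  · intro j hj
    show univ.image (τ j) ∈ G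
    rw [(h1 j hj).2, ← hes]
    simpa using hemem j hj

end STC

namespace STC
namespace TD
variable {k Δ t : ℕ} {β V : Type} {T : TD k Δ t β}

variable (T) in
/-- expectation of `C` over the random extension of `φ` along `L` -/
noncomputable def Ex (U : Finset V) (w : (Fin k → V) → ℝ) :
    List ℕ → (β → V) → ((β → V) → ℝ) → ℝ
  | [], φ, C => C φ
  | j :: L, φ, C => ∑ v ∈ U, qs U w (φ ∘ T.τ (T.p j)) (T.c j) v *
      Ex U w L (Function.update φ (T.x j) v) C

variable {E : (Fin k → V) → Prop} {U : Finset V} {w : (Fin k → V) → ℝ} {K g : ℝ}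

lemma Ex_irrel (H : HB E U w K g) {C : (β → V) → ℝ} {L : List ℕ}
    (hC : ∀ l ∈ L, ∀ φ v, C (Function.update φ (T.x l) v) = C φ) (φ : β → V) :
    T.Ex U w L φ C = C φ := by
  induction L generalizing φ with
  | nil => rfl
  | cons j L ih =>
    have h1 : ∀ v ∈ U, qs U w (φ ∘ T.τ (T.p j)) (T.c j) v *
      T.Ex U w L (Function.update φ (T.x j) v) C = qs U w (φ ∘ T.τ (T.p j)) (T.c j) v * C φ := by
      intro v _
      rw [ih (fun l hl => hC l (List.mem_cons_of_mem _ hl)), hC j List.mem_cons_self]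
    rw [Ex, Finset.sum_congr rfl h1, ← Finset.sum_mul, H.q_sum, one_mul]

lemma Ex_sum {ι : Type} (S : Finset ι) (C : ι → (β → V) → ℝ) (L : List ℕ) (φ : β → V) :
    T.Ex U w L φ (fun ψ => ∑ s ∈ S, C s ψ) = ∑ s ∈ S, T.Ex U w L φ (C s) := by
  induction L generalizing φ with
  | nil => rfl
  | cons j L ih =>
    simp only [Ex, ih, Finset.mul_sum]
    rw [Finset.sum_comm]

lemma Ex_range (H : HB E U w K g) {C : (β → V) → ℝ} {B : ℝ} (hC : ∀ φ, 0 ≤ C φ ∧ C φ ≤ B)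
    (L : List ℕ) (φ : β → V) : 0 ≤ T.Ex U w L φ C ∧ T.Ex U w L φ C ≤ B := by
  induction L generalizing φ with
  | nil => exact hC φ
  | cons j L ih =>
    rw [Ex]
    constructor
    · exact Finset.sum_nonneg fun v _ => mul_nonneg (H.q_nonneg _ _ _) (ih _).1
    · calc _ ≤ ∑ v ∈ U, qs U w (φ ∘ T.τ (T.p j)) (T.c j) v * B :=
            Finset.sum_le_sum fun v _ => mul_le_mul_of_nonneg_left (ih _).2 (H.q_nonneg _ _ _)
        _ = B := by rw [← Finset.sum_mul, H.q_sum, one_mul]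

lemma Ex_le (H : HB E U w K g) {C : (β → V) → ℝ} {S : ℝ} (L : List ℕ) :
    ∀ (A : Finset ℕ) (φ : β → V), T.DC A → T.Adm A L → (∀ j ∈ A, E (φ ∘ T.τ j)) →
    (∀ ψ, (∀ j ∈ A ∪ L.toFinset, E (ψ ∘ T.τ j)) → C ψ ≤ S) → T.Ex U w L φ C ≤ S := by
  induction L with
  | nil =>
    intro A φ _ _ hv hC
    exact hC φ (by simpa using hv)
  | cons j L ih =>
    intro A φ hA hL hv hC
    obtain ⟨h0, ht, hj, hp, hL⟩ := hL
    rw [Ex]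
    have hio : InjOff (φ ∘ T.τ (T.p j)) (T.c j) := InjOff_of_inj (H.hE _ (hv _ hp)) _
    calc _ ≤ ∑ v ∈ U, qs U w (φ ∘ T.τ (T.p j)) (T.c j) v * S := by
          apply Finset.sum_le_sum
          intro v _
          by_cases hq : qs U w (φ ∘ T.τ (T.p j)) (T.c j) v = 0
          · simp [hq]
          · apply mul_le_mul_of_nonneg_left _ (H.q_nonneg _ _ _)
            apply ih (insert j A) _ (hA.insert ht hp) hL
            · intro i hi
              rcases Finset.mem_insert.1 hi with rfl | h
              · rw [upd_tau h0 ht hA hp v hj]; exact H.q_E hio hq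
              · rw [upd_old h0 ht hA h v hj]; exact hv i h
            · intro ψ hψ
              apply hC ψ
              rwa [List.toFinset_cons, Finset.union_insert, ← Finset.insert_union]
      _ = S := by rw [← Finset.sum_mul, H.q_sum, one_mul]

lemma Ex_pull (H : HB E U w K g) (h : (Fin k → V) → ℝ) {j : ℕ} (L : List ℕ) :
    ∀ (A : Finset ℕ) (φ : β → V), T.DC A → T.Adm A L → j ∈ L →
    T.Ex U w L φ (fun ψ => h (ψ ∘ T.τ j)) =
      T.Ex U w L φ (fun ψ => Qs U w (T.c j) h (ψ ∘ T.τ (T.p j))) := by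
  induction L with
  | nil => intro A φ _ _ hj; simp at hj
  | cons l L ih =>
    intro A φ hA hL hj
    have hL' := hL
    obtain ⟨h0, ht, hl, hp, hL⟩ := hL
    have hA' := hA.insert ht hp
    by_cases hjl : j = l
    · subst hjl
      rw [Ex_irrel H (L := j :: L) (C := fun ψ => Qs U w (T.c j) h (ψ ∘ T.τ (T.p j)))]
      · rw [Ex, Qs]
        apply Finset.sum_congr rfl
        intro v _
        rw [Ex_irrel H, upd_tau h0 ht hA hp v hl]
        intro l' hl' ψ v'
        obtain ⟨h1, h2, h3, _⟩ := adm_mem hL l' hl'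
        rw [upd_old h1 h2 hA' (Finset.mem_insert_self _ _) v' h3]
      · intro l' hl' ψ v'
        obtain ⟨h1, h2, h3, _⟩ := adm_mem hL' l' hl'
        rw [upd_old h1 h2 hA hp v' h3]
    · have hj' : j ∈ L := by
        rcases List.mem_cons.1 hj with h | h
        · exact absurd h hjl
        · exact h
      rw [Ex, Ex]
      apply Finset.sum_congr rfl
      intro v _
      rw [ih (insert l A) _ hA' hL hj']

lemma Ex_pullD (H : HB E U w K g) (h : (Fin k → V) → ℝ) {j : ℕ} {L : List ℕ}
    {A : Finset ℕ} {φ : β → V} (hA : T.DC A) (hL : T.Adm A L) (D : ℕ)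
    (hj : ∀ i, i < D → T.p^[i] j ∈ L) :
    T.Ex U w L φ (fun ψ => h (ψ ∘ T.τ j)) =
      T.Ex U w L φ (fun ψ => QW U w ((List.range D).reverse.map fun i => T.c (T.p^[i] j)) h
        (ψ ∘ T.τ (T.p^[D] j))) := by
  induction D with
  | zero => simp [QW]
  | succ D ih =>
    rw [ih (fun i hi => hj i (by omega)), Ex_pull H _ L A φ hA hL (hj D (by omega)),
      List.range_succ, List.reverse_append, Function.iterate_succ_apply']
    rfl

lemma Ex_pullN (H : HB E U w K g) (h : (Fin k → V) → ℝ) {j : ℕ} {L : List ℕ}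
    {A : Finset ℕ} {φ : β → V} (hA : T.DC A) (hL : T.Adm A L) (N : ℕ)
    (hj : ∀ i, i < Δ * N → T.p^[i] j ∈ L) :
    ∃ Ws : List (List (Fin k)), Ws.length = N ∧ (∀ W ∈ Ws, W.length = Δ ∧ ∀ i, i ∈ W) ∧
    T.Ex U w L φ (fun ψ => h (ψ ∘ T.τ j)) =
      T.Ex U w L φ (fun ψ => QW U w Ws.flatten h (ψ ∘ T.τ (T.p^[Δ * N] j))) := by
  induction N with
  | zero => exact ⟨[], rfl, by simp, by simp [QW]⟩
  | succ N ih =>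
    obtain ⟨Ws, h1, h2, h3⟩ := ih (fun i hi => hj i (by rw [Nat.mul_succ]; omega))
    have hit : ∀ i, T.p^[i] (T.p^[Δ * N] j) = T.p^[Δ * N + i] j := by
      intro i
      rw [← Function.iterate_add_apply, Nat.add_comm]
    have hmem : ∀ i, i < Δ → T.p^[i] (T.p^[Δ * N] j) ∈ L := by
      intro i hi
      rw [hit]
      exact hj _ (by rw [Nat.mul_succ]; omega)
    refine ⟨((List.range Δ).reverse.map fun i => T.c (T.p^[i] (T.p^[Δ * N] j))) :: Ws,
      by simp [h1], ?_, ?_⟩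
    · intro W hW
      rcases List.mem_cons.1 hW with rfl | hW
      · refine ⟨by simp, ?_⟩
        intro a
        by_cases hΔ : Δ = 0
        · exfalso
          have := T.hdeg (T.τ 0 a)
          have this := Finset.card_eq_zero.1 (Nat.le_zero.1 (le_trans this hΔ.le))
          have h0 : 0 ∈ (range t).filter fun i => ∃ b, T.τ i b = T.τ 0 a := by
            simp [hA.pos]
          rw [this] at h0
          simp at h0
        · obtain ⟨i, hi, rfl⟩ := window (T := T) (j := T.p^[Δ * N] j)
            (fun i hi => (adm_mem hL _ (hmem i hi)).1)
            (adm_mem hL _ (hmem 0 (by omega))).2.1 a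
          rw [List.mem_map]
          exact ⟨i, by simpa using hi, rfl⟩
      · exact h2 W hW
    · rw [h3, Ex_pullD H _ hA hL Δ hmem, hit, Nat.mul_succ]
      simp only [List.flatten_cons, QW, List.foldr_append]

lemma derand (H : HB E U w K g) {C : (β → V) → ℝ} {B : ℝ} (hC : ∀ φ, 0 ≤ C φ ∧ C φ ≤ B)
    (m : ℕ) (hm : m * (2 * K / U.card) ≤ 1/2) (L : List ℕ) :
    ∀ (A : Finset ℕ) (φ : β → V), T.DC A → T.Adm A L → T.Emb E A φ →
    (U ∩ (T.verts A).image φ).card + L.length ≤ m →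
    ∃ ψ, T.Emb E (A ∪ L.toFinset) ψ ∧ (∀ y ∈ T.verts A, ψ y = φ y) ∧ (∀ j ∈ L, ψ (T.x j) ∈ U) ∧
      C ψ ≤ T.Ex U w L φ C + L.length * (2 * (m * (2 * K / U.card)) * B) := by
  induction L with
  | nil =>
    intro A φ _ _ hE _
    exact ⟨φ, by simpa using hE, fun _ _ => rfl, by simp, by simp [Ex]⟩
  | cons j L ih =>
    intro A φ hA hL hE hR
    obtain ⟨h0, ht, hj, hp, hL⟩ := hL
    have hio : InjOff (φ ∘ T.τ (T.p j)) (T.c j) := InjOff_of_inj (H.hE _ (hE.edge _ hp)) _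
    set ε := (m * (2 * K / U.card) : ℝ) with hε
    set R := U ∩ (T.verts A).image φ with hRdef
    set F : V → ℝ := fun v => T.Ex U w L (Function.update φ (T.x j) v) C with hF
    set q := qs U w (φ ∘ T.τ (T.p j)) (T.c j) with hq
    have hFr : ∀ v, 0 ≤ F v ∧ F v ≤ B := fun v => Ex_range H hC L _
    have hEx : T.Ex U w (j :: L) φ C = ∑ v ∈ U, q v * F v := rfl
    have hEB := Ex_range (T := T) H hC (j :: L) φ
    have hK : 0 ≤ 2 * K / U.card := by have := H.K1; positivity
    have hε0 : 0 ≤ ε := by positivity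
    have hB : 0 ≤ B := le_trans (hC φ).1 (hC φ).2
    have hRm : (R.card : ℝ) ≤ m := by
      have : R.card ≤ m := by simp at hR; omega
      exact_mod_cast this
    have hqR : ∑ v ∈ R, q v ≤ ε := by
      calc ∑ v ∈ R, q v ≤ ∑ v ∈ R, 2 * K / U.card := Finset.sum_le_sum fun v _ => H.q_le hio v
        _ = R.card * (2 * K / U.card) := by simp
        _ ≤ ε := mul_le_mul_of_nonneg_right hRm hK
    have hsplit : ∑ v ∈ U \ R, q v + ∑ v ∈ R, q v = 1 := by
      rw [Finset.sum_sdiff Finset.inter_subset_left]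
      exact H.q_sum _ _
    have hex : ∃ v ∈ U \ R, q v ≠ 0 ∧ F v ≤ T.Ex U w (j :: L) φ C + 2 * ε * B := by
      by_contra hcon
      push Not at hcon
      have h1 : ∀ v ∈ U \ R, q v * (T.Ex U w (j :: L) φ C + 2 * ε * B) ≤ q v * F v := by
        intro v hv
        by_cases hqv : q v = 0
        · simp [hqv]
        · exact mul_le_mul_of_nonneg_left (hcon v hv hqv).le (H.q_nonneg _ _ _)
      have hpos : 0 < ∑ v ∈ U \ R, q v := by linarith
      obtain ⟨v0, hv0, hv0q⟩ := Finset.exists_ne_zero_of_sum_ne_zero hpos.ne'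
      have h2 : ∑ v ∈ U \ R, q v * (T.Ex U w (j :: L) φ C + 2 * ε * B) < ∑ v ∈ U \ R, q v * F v :=
        Finset.sum_lt_sum h1 ⟨v0, hv0, mul_lt_mul_of_pos_left (hcon v0 hv0 hv0q)
          (lt_of_le_of_ne (H.q_nonneg _ _ _) (Ne.symm hv0q))⟩
      have h3 : ∑ v ∈ U \ R, q v * F v ≤ T.Ex U w (j :: L) φ C := by
        rw [hEx]
        exact Finset.sum_le_sum_of_subset_of_nonneg Finset.sdiff_subset
          fun v _ _ => mul_nonneg (H.q_nonneg _ _ _) (hFr v).1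
      rw [← Finset.sum_mul] at h2
      set s := ∑ v ∈ U \ R, q v
      have hs : 1 - ε ≤ s := by linarith
      set X := T.Ex U w (j :: L) φ C
      have h4 : (1 - ε) * (X + 2 * ε * B) ≤ s * (X + 2 * ε * B) :=
        mul_le_mul_of_nonneg_right hs (by have := hEB.1; positivity)
      have h5 : X ≤ (1 - ε) * (X + 2 * ε * B) := by
        have : 0 ≤ ε * (B - X) := mul_nonneg hε0 (by linarith [hEB.2])
        have : 0 ≤ ε * B * (1 - 2 * ε) := mul_nonneg (mul_nonneg hε0 hB) (by linarith)
        nlinarith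
      linarith
    obtain ⟨v, hvU, hqv, hFv⟩ := hex
    rw [Finset.mem_sdiff] at hvU
    have hvn : ∀ y ∈ T.verts A, φ y ≠ v := by
      intro y hy hyv
      apply hvU.2
      rw [hRdef, Finset.mem_inter]
      exact ⟨hvU.1, Finset.mem_image.2 ⟨y, hy, hyv⟩⟩
    have hE' := hE.extend h0 ht hA hp hj hvn (H.q_E hio hqv)
    have hRR : U ∩ (T.verts (insert j A)).image (Function.update φ (T.x j) v) ⊆ insert v R := by
      intro y hy
      rw [Finset.mem_inter, Finset.mem_image] at hy
      obtain ⟨hyU, z, hz, rfl⟩ := hy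
      rw [verts_insert h0 ht hp, Finset.mem_insert] at hz
      rcases hz with rfl | hz
      · simp
      · rw [upd_verts h0 ht hA hj v hz] at hyU ⊢
        apply Finset.mem_insert_of_mem
        rw [hRdef, Finset.mem_inter]
        exact ⟨hyU, Finset.mem_image_of_mem _ hz⟩
    obtain ⟨ψ, h1, h2, h3, h4⟩ := ih (insert j A) _ (hA.insert ht hp) hL hE' (by
      have := Finset.card_le_card hRR
      have := Finset.card_insert_le v R
      simp at hR; omega)
    refine ⟨ψ, ?_, ?_, ?_, ?_⟩
    · rwa [List.toFinset_cons, Finset.union_insert, ← Finset.insert_union]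
    · intro y hy
      rw [h2 y (verts_mono (Finset.subset_insert _ _) hy), upd_verts h0 ht hA hj v hy]
    · intro i hi
      rcases List.mem_cons.1 hi with rfl | hi
      · rw [h2 _ (x_mem (Finset.mem_insert_self _ _)), Function.update_self]; exact hvU.1
      · exact h3 i hi
    · have : F v = T.Ex U w L (Function.update φ (T.x j) v) C := rfl
      rw [← this] at h4
      rw [List.length_cons]
      push_cast
      linarith

/-- the piece lemma -/
lemma piece [Finite V] (H : HB E U w K g) {f : V → ℝ} (hf : ∀ v, 0 ≤ f v ∧ f v ≤ 1)
    {mean : ℝ} (hmean0 : 0 ≤ mean)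
    (hpos : 0 < ∑ e ∈ Fintype.piFinset (fun _ : Fin k => U), w e)
    (hmean : ∀ c, ∑ e ∈ Fintype.piFinset (fun _ : Fin k => U), w e * f (e c) ≤
      mean * ∑ e ∈ Fintype.piFinset (fun _ : Fin k => U), w e)
    (m : ℕ) (hm : m * (2 * K / U.card) ≤ 1/2) (N : ℕ)
    {A P : Finset ℕ} {φ : β → V} (hA : T.DC A) (hE : T.Emb E A φ) (hd : Disjoint A P)
    (hP : ∀ j ∈ P, 0 < j ∧ j < t ∧ T.p j ∈ A ∪ P) (hPm : P.card ≤ m)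
    (hU : ∀ v ∈ U, ∀ y ∈ T.verts A, φ y ≠ v) :
    T.DC (A ∪ P) ∧ ∃ ψ, T.Emb E (A ∪ P) ψ ∧ (∀ y ∈ T.verts A, ψ y = φ y) ∧
      (∀ j ∈ P, ψ (T.x j) ∈ U) ∧
      ∑ j ∈ P, f (ψ (T.x j)) ≤ m * (mean + (1 - (2 * g / K)^Δ)^N) +
        (P.filter fun j => ¬ ∀ i, i < Δ * N → T.p^[i] j ∈ P).card + 4 * K * m^3 / U.card := by
  obtain ⟨L, hL, hn, hadm⟩ := exists_adm P A hd hP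
  have hlen : L.length = P.card := by rw [← hL, List.toFinset_card_of_nodup hn]
  set C : (β → V) → ℝ := fun ψ => ∑ j ∈ P, f (ψ (T.x j)) with hCdef
  have hC : ∀ ψ, 0 ≤ C ψ ∧ C ψ ≤ m := by
    intro ψ
    constructor
    · exact Finset.sum_nonneg fun j _ => (hf _).1
    · calc C ψ ≤ ∑ j ∈ P, (1:ℝ) := Finset.sum_le_sum fun j _ => (hf _).2
        _ = P.card := by simp
        _ ≤ m := by exact_mod_cast hPm
  have hR : U ∩ (T.verts A).image φ = ∅ := by
    rw [Finset.eq_empty_iff_forall_notMem]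
    intro v hv
    rw [Finset.mem_inter, Finset.mem_image] at hv
    obtain ⟨hv, y, hy, h⟩ := hv
    exact hU v hv y hy h
  obtain ⟨ψ, h1, h2, h3, h4⟩ := derand H hC m hm L A φ hA hadm hE (by rw [hR, hlen]; simpa using hPm)
  have hDC := adm_dc hA hadm
  rw [hL] at h1 hDC
  have hp1 : 2 * g / K ≤ 1 := by
    have hio : InjOff (φ ∘ T.τ 0) (T.c 0) := InjOff_of_inj (H.hE _ (hE.edge 0 hA.zero)) _
    exact H.p_le_one hio
  have hp0 : 0 ≤ 2 * g / K := by have := H.g0; have := H.K1; positivity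
  set δ := (1 - (2 * g / K)^Δ)^N with hδ
  have hδ0 : 0 ≤ δ := pow_nonneg (sub_nonneg.2 (pow_le_one₀ hp0 hp1)) _
  refine ⟨hDC, ψ, h1, h2, fun j hj => h3 j (by rw [← hL] at hj; simpa using hj), ?_⟩
  have hEx : T.Ex U w L φ C ≤ ∑ j ∈ P, ((mean + δ) +
      if ¬ ∀ i, i < Δ * N → T.p^[i] j ∈ P then 1 else 0) := by
    rw [hCdef, Ex_sum]
    apply Finset.sum_le_sum
    intro j hj
    split_ifs with hdeep
    · rw [add_zero]
      obtain ⟨Ws, hW1, hW2, hW3⟩ := Ex_pullN H (fun e => f (e (T.c j))) (φ := φ) (j := j) hA hadm N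
        (fun i hi => by have := hdeep i hi; rw [← hL] at this; simpa using this)
      have : T.Ex U w L φ (fun ψ => f (ψ (T.x j))) =
        T.Ex U w L φ (fun ψ => (fun e : Fin k → V => f (e (T.c j))) (ψ ∘ T.τ j)) := rfl
      rw [this, hW3]
      apply Ex_le H L A φ hA hadm hE.edge
      intro ψ hψ
      have hmix := H.mixed_le (fun e _ => hf (e (T.c j))) Δ Ws hp1 hW2 hpos (hmean (T.c j))
        (ψ ∘ T.τ (T.p^[Δ * N] j)) ?_
      · rwa [hW1] at hmix
      apply hψ
      by_cases hN : Δ * N = 0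
      · rw [hN, hL]
        exact Finset.mem_union_right _ hj
      · have h5 : T.p^[Δ * N - 1] j ∈ P := hdeep _ (by omega)
        have h6 := (hP _ h5).2.2
        rw [← Function.iterate_succ_apply' T.p] at h6
        rw [hL]
        rwa [show (Δ * N - 1).succ = Δ * N by omega] at h6
    · have := (Ex_range (T := T) H (C := fun ψ => f (ψ (T.x j))) (B := 1) (fun ψ => hf _) L φ).2
      linarith
  rw [Finset.sum_add_distrib, Finset.sum_const, nsmul_eq_mul, Finset.sum_boole] at hEx
  have h7 : (P.card : ℝ) * (mean + δ) ≤ m * (mean + δ) :=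
    mul_le_mul_of_nonneg_right (by exact_mod_cast hPm) (by linarith)
  have hu := H.Upos
  have hK1 := H.K1
  have h8 : (L.length : ℝ) * (2 * (m * (2 * K / U.card)) * m) ≤ 4 * K * m^3 / U.card := by
    have : (L.length : ℝ) ≤ m := by rw [hlen]; exact_mod_cast hPm
    calc _ ≤ (m : ℝ) * (2 * (m * (2 * K / U.card)) * m) := mul_le_mul_of_nonneg_right this (by positivity)
      _ = _ := by ring
  linarith

end TD
end STC

namespace STC
namespace TD
variable {k Δ t : ℕ} {β V : Type} {T : TD k Δ t β}

variable (T) in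
/-- `j` is a descendant of `r` -/
inductive Desc (r : ℕ) : ℕ → Prop
  | refl : Desc r r
  | step (j : ℕ) : 0 < j → Desc r (T.p j) → Desc r j

lemma Desc.le {r j : ℕ} (h : T.Desc r j) (hj : j < t) : r ≤ j := by
  induction h with
  | refl => exact le_rfl
  | step j h0 _ ih => have := T.hp j h0 hj; have := ih (by omega); omega

lemma Desc.mem {B : Finset ℕ} (hB : T.DC B) {r j : ℕ} (h : T.Desc r j) (hj : j ∈ B) : r ∈ B := by
  induction h with
  | refl => exact hj
  | step j h0 _ ih => exact ih (hB.par j hj h0)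

lemma Desc.child {r j : ℕ} (h : T.Desc r j) : j = r ∨ ∃ c, 0 < c ∧ T.p c = r ∧ T.Desc c j := by
  induction h with
  | refl => exact Or.inl rfl
  | step j h0 _ ih =>
    rcases ih with h | ⟨c, hc0, hc, hd⟩
    · exact Or.inr ⟨j, h0, h, Desc.refl⟩
    · exact Or.inr ⟨c, hc0, hc, Desc.step j h0 hd⟩

lemma desc_zero {j : ℕ} (hj : j < t) : T.Desc 0 j := by
  induction j using Nat.strong_induction_on with
  | _ j ih =>
    by_cases h : j = 0
    · subst h; exact Desc.refl
    · have := T.hp j (by omega) hj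
      exact Desc.step j (by omega) (ih _ this (by omega))

lemma sub_card (hk : 2 ≤ k) {B : Finset ℕ} (hB : T.DC B) {r M : ℕ}
    (h : ∀ c, 0 < c → c ∈ B → T.p c = r → (B.filter (T.Desc c)).card ≤ M) :
    (B.filter (T.Desc r)).card ≤ 1 + k * Δ * M := by
  set Ch := B.filter fun c => 0 < c ∧ T.p c = r with hCh
  have hsub : B.filter (T.Desc r) ⊆ {r} ∪ Ch.biUnion fun c => B.filter (T.Desc c) := by
    intro j hj
    rw [Finset.mem_filter] at hj
    rw [Finset.mem_union, Finset.mem_singleton, Finset.mem_biUnion]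
    rcases hj.2.child with h | ⟨c, hc0, hc, hd⟩
    · exact Or.inl h
    · exact Or.inr ⟨c, Finset.mem_filter.2 ⟨hd.mem hB hj.1, hc0, hc⟩, Finset.mem_filter.2 ⟨hj.1, hd⟩⟩
  have hChc : Ch.card ≤ k * Δ := by
    refine le_trans (Finset.card_le_card ?_) (children (T := T) hk r)
    intro c hc
    rw [Finset.mem_filter] at hc ⊢
    exact ⟨by simpa using hB.sub c hc.1, hc.2⟩
  calc _ ≤ _ := Finset.card_le_card hsub
    _ ≤ 1 + (Ch.biUnion fun c => B.filter (T.Desc c)).card := by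
        refine le_trans (Finset.card_union_le _ _) ?_
        simp
    _ ≤ 1 + ∑ c ∈ Ch, (B.filter (T.Desc c)).card := by gcongr; exact Finset.card_biUnion_le
    _ ≤ 1 + ∑ c ∈ Ch, M := by
        gcongr with c hc
        rw [hCh, Finset.mem_filter] at hc
        exact h c hc.2.1 hc.1 hc.2.2
    _ = 1 + Ch.card * M := by simp
    _ ≤ _ := by gcongr

variable (T) in
/-- a piece `P` attached to `A` with root `r` -/
structure Piece (A P : Finset ℕ) (r : ℕ) : Prop where
  rP : r ∈ P
  rA : T.p r ∈ A
  par : ∀ j ∈ P, j ≠ r → T.p j ∈ P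
  pos : ∀ j ∈ P, 0 < j ∧ j < t
  disj : Disjoint A P

lemma peel (hk : 2 ≤ k) (hΔ : 1 ≤ Δ) {B : Finset ℕ} (hB : T.DC B) {M : ℕ} (hM : 1 ≤ M)
    (hBM : k * Δ * M < B.card) :
    ∃ r P, P ⊆ B ∧ T.DC (B \ P) ∧ T.Piece (B \ P) P r ∧ M ≤ P.card ∧ P.card ≤ k * Δ * M := by
  have hd : 1 ≤ k * Δ := Nat.mul_pos (by omega) hΔ
  have hdm : 1 + k * Δ * (M - 1) ≤ k * Δ * M := by
    obtain ⟨M', rfl⟩ : ∃ M', M = M' + 1 := ⟨M - 1, by omega⟩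
    rw [Nat.mul_succ]; simp; omega
  set S := B.filter fun r => 0 < r ∧ M ≤ (B.filter (T.Desc r)).card with hS
  have hne : S.Nonempty := by
    by_contra hcon
    rw [Finset.not_nonempty_iff_eq_empty] at hcon
    have h1 := sub_card (T := T) hk hB (r := 0) (M := M - 1) (by
      intro c hc0 hcB _
      by_contra hc
      have : c ∈ S := Finset.mem_filter.2 ⟨hcB, hc0, by omega⟩
      rw [hcon] at this
      simp at this)
    have h2 : B.filter (T.Desc 0) = B := Finset.filter_true_of_mem fun j hj => desc_zero (hB.sub j hj)
    rw [h2] at h1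
    omega
  set r := S.max' hne with hr
  have hrS : r ∈ S := S.max'_mem hne
  have hrS' := Finset.mem_filter.1 hrS
  obtain ⟨hrB, hr0, hrM⟩ := hrS'
  have hrt := hB.sub r hrB
  refine ⟨r, B.filter (T.Desc r), Finset.filter_subset _ _, ?_, ?_, hrM, ?_⟩
  · refine ⟨fun j hj => hB.sub j (Finset.mem_sdiff.1 hj).1, ?_, ?_⟩
    · rw [Finset.mem_sdiff]
      refine ⟨hB.zero, fun h => ?_⟩
      have := (Finset.mem_filter.1 h).2.le hB.pos
      omega
    · intro j hj h0
      rw [Finset.mem_sdiff] at hj ⊢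
      refine ⟨hB.par j hj.1 h0, fun h => hj.2 ?_⟩
      exact Finset.mem_filter.2 ⟨hj.1, Desc.step j h0 (Finset.mem_filter.1 h).2⟩
  · refine ⟨Finset.mem_filter.2 ⟨hrB, Desc.refl⟩, ?_, ?_, ?_, Finset.sdiff_disjoint⟩
    · rw [Finset.mem_sdiff]
      refine ⟨hB.par r hrB hr0, fun h => ?_⟩
      have h1 := T.hp r hr0 hrt
      have := (Finset.mem_filter.1 h).2.le (by omega)
      omega
    · intro j hj hjr
      rw [Finset.mem_filter] at hj ⊢
      rcases hj with ⟨hjB, h⟩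
      cases h with
      | refl => exact absurd rfl hjr
      | step _ h0 h => exact ⟨hB.par j hjB h0, h⟩
    · intro j hj
      rw [Finset.mem_filter] at hj
      have h1 := hB.sub j hj.1
      have := hj.2.le h1
      omega
  · refine le_trans (sub_card (T := T) hk hB (M := M - 1) ?_) hdm
    intro c hc0 hcB hcr
    by_contra hc
    have hcS : c ∈ S := Finset.mem_filter.2 ⟨hcB, hc0, by omega⟩
    have h1 := S.le_max' c hcS
    have h2 := T.hp c hc0 (hB.sub c hcB)
    omega

variable (T) in
/-- chains of pieces -/
inductive Chain (M M' : ℕ) (B : Finset ℕ) : Finset ℕ → ℕ → Prop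
  | refl : Chain M M' B B 0
  | step (A P : Finset ℕ) (r q : ℕ) : Chain M M' B A q → T.Piece A P r → M ≤ P.card → P.card ≤ M' →
      Chain M M' B (A ∪ P) (q + 1)

lemma exists_chain (hk : 2 ≤ k) (hΔ : 1 ≤ Δ) {M m0 : ℕ} (hM : 1 ≤ M) (hm : k * Δ * M ≤ m0)
    (B : Finset ℕ) : T.DC B → m0 ≤ B.card + k * Δ * M →
    ∃ T0 q, T.DC T0 ∧ T.Chain M (k * Δ * M) T0 B q ∧ m0 ≤ T0.card + k * Δ * M ∧ T0.card ≤ m0 := by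
  induction B using Finset.strongInduction with
  | _ B ih =>
    intro hB hBm
    by_cases h : B.card ≤ m0
    · exact ⟨B, 0, hB, Chain.refl, hBm, h⟩
    · obtain ⟨r, P, hPB, hDC, hP, h1, h2⟩ := peel (T := T) hk hΔ hB hM (by omega)
      have hc : (B \ P).card + P.card = B.card := Finset.card_sdiff_add_card_eq_card hPB
      obtain ⟨T0, q, a1, a2, a3, a4⟩ := ih (B \ P) (Finset.sdiff_ssubset hPB ⟨r, hP.rP⟩) hDC (by omega)
      refine ⟨T0, q + 1, a1, ?_, a3, a4⟩
      have := Chain.step _ P r q a2 hP h1 h2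
      rwa [Finset.sdiff_union_of_subset hPB] at this

lemma Piece.dc {A P : Finset ℕ} {r : ℕ} (hA : T.DC A) (hP : T.Piece A P r) : T.DC (A ∪ P) where
  sub := fun j hj => by
    rcases Finset.mem_union.1 hj with h | h
    · exact hA.sub j h
    · exact (hP.pos j h).2
  zero := Finset.mem_union_left _ hA.zero
  par := fun j hj h0 => by
    rcases Finset.mem_union.1 hj with h | h
    · exact Finset.mem_union_left _ (hA.par j h h0)
    · by_cases hr : j = r
      · rw [hr]; exact Finset.mem_union_left _ hP.rA
      · exact Finset.mem_union_right _ (hP.par j h hr)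

lemma Chain.dc {M M' q : ℕ} {T0 A : Finset ℕ} (h0 : T.DC T0) (h : T.Chain M M' T0 A q) : T.DC A := by
  induction h with
  | refl => exact h0
  | step A P r q _ hP _ _ ih => exact hP.dc ih

lemma Chain.sub {M M' q : ℕ} {T0 A : Finset ℕ} (h : T.Chain M M' T0 A q) : T0 ⊆ A := by
  induction h with
  | refl => exact Finset.Subset.refl _
  | step A P r q _ hP _ _ ih => exact ih.trans Finset.subset_union_left

lemma Chain.card {M M' q : ℕ} {T0 A : Finset ℕ} (h : T.Chain M M' T0 A q) : M * q ≤ A.card := by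
  induction h with
  | refl => simp
  | step A P r q _ hP h1 _ ih =>
    rw [Finset.card_union_of_disjoint hP.disj, Nat.mul_succ]; omega

lemma Chain.bdry {M M' q : ℕ} {T0 A : Finset ℕ} (h : T.Chain M M' T0 A q) :
    (A.filter fun z => z ∉ T0 ∧ T.p z ∈ T0).card ≤ q := by
  induction h with
  | refl =>
    rw [Nat.le_zero, Finset.card_eq_zero, Finset.filter_eq_empty_iff]
    intro z hz h
    exact h.1 hz
  | step A P r q hc hP h1 _ ih =>
    have : ((A ∪ P).filter fun z => z ∉ T0 ∧ T.p z ∈ T0) ⊆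
        insert r (A.filter fun z => z ∉ T0 ∧ T.p z ∈ T0) := by
      intro z hz
      rw [Finset.mem_filter, Finset.mem_union] at hz
      rw [Finset.mem_insert, Finset.mem_filter]
      rcases hz with ⟨hz | hz, h2⟩
      · exact Or.inr ⟨hz, h2⟩
      · left
        by_contra hzr
        exact Finset.disjoint_left.1 hP.disj (hc.sub h2.2) (hP.par z hz hzr)
    refine le_trans (Finset.card_le_card this) (le_trans (Finset.card_insert_le _ _) ?_)
    omega

/-- few shallow nodes in a piece -/
lemma Piece.shallow (hk : 2 ≤ k) {A P : Finset ℕ} {r : ℕ} (hP : T.Piece A P r) (D : ℕ) :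
    (P.filter fun j => ¬ ∀ i, i < D → T.p^[i] j ∈ P).card ≤ ∑ i ∈ range D, (k * Δ)^i := by
  have hlev : ∀ i, (P.filter fun j => T.p^[i] j = r ∧ ∀ i', i' ≤ i → T.p^[i'] j ∈ P).card ≤ (k * Δ)^i := by
    intro i
    induction i with
    | zero =>
      rw [pow_zero, Finset.card_le_one]
      intro a ha b hb
      have ha := (Finset.mem_filter.1 ha).2.1
      have hb := (Finset.mem_filter.1 hb).2.1
      simp at ha hb
      rw [ha, hb]
    | succ i ih =>
      have hsub : (P.filter fun j => T.p^[i+1] j = r ∧ ∀ i', i' ≤ i+1 → T.p^[i'] j ∈ P) ⊆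
          (P.filter fun j => T.p^[i] j = r ∧ ∀ i', i' ≤ i → T.p^[i'] j ∈ P).biUnion
          fun a => (range t).filter fun j => 0 < j ∧ T.p j = a := by
        intro j hj
        rw [Finset.mem_filter] at hj
        obtain ⟨hj, h1, h2⟩ := hj
        rw [Finset.mem_biUnion]
        refine ⟨T.p j, ?_, ?_⟩
        · rw [Finset.mem_filter]
          refine ⟨h2 1 (by omega), by rw [← Function.iterate_succ_apply]; exact h1, ?_⟩
          intro i' hi'
          rw [← Function.iterate_succ_apply]
          exact h2 (i'+1) (by omega)
        · rw [Finset.mem_filter]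
          exact ⟨by simpa using (hP.pos j hj).2, (hP.pos j hj).1, rfl⟩
      refine le_trans (Finset.card_le_card hsub) (le_trans Finset.card_biUnion_le ?_)
      refine le_trans (Finset.sum_le_sum fun a _ => children (T := T) hk a) ?_
      rw [Finset.sum_const, smul_eq_mul, pow_succ]
      exact Nat.mul_le_mul_right _ ih
  have hsub : (P.filter fun j => ¬ ∀ i, i < D → T.p^[i] j ∈ P) ⊆ (range D).biUnion fun i =>
      (P.filter fun j => T.p^[i] j = r ∧ ∀ i', i' ≤ i → T.p^[i'] j ∈ P) := by
    intro j hj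
    rw [Finset.mem_filter] at hj
    obtain ⟨hj, h⟩ := hj
    push Not at h
    have hex : ∃ i, T.p^[i] j ∉ P := ⟨h.choose, h.choose_spec.2⟩
    set i := Nat.find hex with hi
    have h1 : T.p^[i] j ∉ P := Nat.find_spec hex
    have h2 : ∀ i', i' < i → T.p^[i'] j ∈ P := fun i' hi' => by
      by_contra hc
      exact Nat.find_min hex hi' hc
    have hi0 : i ≠ 0 := by
      intro h0
      rw [h0] at h1
      exact h1 hj
    have hiD : i < D ∨ i = D ∨ i ≤ D := by
      have := Nat.find_min' hex h.choose_spec.2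
      have := h.choose_spec.1
      left; omega
    have hiD : i ≤ D := by omega
    rw [Finset.mem_biUnion]
    refine ⟨i - 1, by simp; omega, Finset.mem_filter.2 ⟨hj, ?_, fun i' hi' => h2 i' (by omega)⟩⟩
    by_contra hr
    have := hP.par _ (h2 (i-1) (by omega)) hr
    rw [← Function.iterate_succ_apply' T.p, show (i-1).succ = i by omega] at this
    exact h1 this
  refine le_trans (Finset.card_le_card hsub) (le_trans Finset.card_biUnion_le ?_)
  exact Finset.sum_le_sum fun i _ => hlev i

end TD
end STC

namespace STC

/-- relative density -/
noncomputable def rr {V : Type} (N U : Finset V) : ℝ := ((N ∩ U).card : ℝ) / U.card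

/-- exponential potential -/
noncomputable def Pot {ι V : Type} (S : Finset ι) (N : ι → Finset V) (l : ℝ) (U : Finset V) : ℝ :=
  ∑ s ∈ S, Real.exp (-(l * rr (N s) U))

/-- tilted average -/
noncomputable def ff {ι V : Type} (S : Finset ι) (N : ι → Finset V) (l : ℝ) (U : Finset V) (v : V) : ℝ :=
  ∑ s ∈ S, Real.exp (-(l * rr (N s) U)) / Pot S N l U * (if v ∈ N s then 1 else 0)

lemma ff_range {ι V : Type} (S : Finset ι) (N : ι → Finset V) (l : ℝ) (U : Finset V) (v : V) :
    0 ≤ ff S N l U v ∧ ff S N l U v ≤ 1 := by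
  have h0 : 0 ≤ Pot S N l U := Finset.sum_nonneg fun _ _ => (Real.exp_pos _).le
  constructor
  · apply Finset.sum_nonneg
    intro s _
    apply mul_nonneg (div_nonneg (Real.exp_pos _).le h0)
    split_ifs <;> norm_num
  · calc ff S N l U v ≤ ∑ s ∈ S, Real.exp (-(l * rr (N s) U)) / Pot S N l U := by
          apply Finset.sum_le_sum
          intro s _
          have : 0 ≤ Real.exp (-(l * rr (N s) U)) / Pot S N l U := div_nonneg (Real.exp_pos _).le h0
          split_ifs
          · simp
          · simpa using this
      _ = Pot S N l U / Pot S N l U := by rw [← Finset.sum_div]; rfl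
      _ ≤ 1 := div_self_le_one _

lemma ff_sum {ι V : Type} (S : Finset ι) (N : ι → Finset V) (l : ℝ) (U X : Finset V) :
    ∑ v ∈ X, ff S N l U v =
      ∑ s ∈ S, Real.exp (-(l * rr (N s) U)) / Pot S N l U * ((N s ∩ X).card : ℝ) := by
  unfold ff
  rw [Finset.sum_comm]
  apply Finset.sum_congr rfl
  intro s _
  rw [← Finset.mul_sum, Finset.sum_boole, Finset.inter_comm, Finset.filter_mem_eq_inter]

lemma exp_quad {y : ℝ} (h : |y| ≤ 1) : Real.exp y ≤ 1 + y + y^2 := by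
  have := Real.abs_exp_sub_one_sub_id_le h
  have := (abs_le.1 this).2
  linarith

lemma pot_step {ι V : Type} {S : Finset ι} {N : ι → Finset V} {l b err : ℝ} {U X : Finset V}
    {M' : ℕ} (hS : S.Nonempty) (hX : X ⊆ U) (hXM : X.card ≤ M') (hb : 0 < b)
    (hub : b ≤ (U.card : ℝ) - X.card) (hl : 0 ≤ l) (hlb : l * M' / b ≤ 1) (herr : 0 ≤ err)
    (h : ∑ v ∈ X, ff S N l U v ≤ X.card * ((∑ v ∈ U, ff S N l U v) / U.card) + err) :
    Pot S N l (U \ X) ≤ Pot S N l U * Real.exp (l * err / b + (l * M' / b)^2) := by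
  set u : ℝ := (U.card : ℝ) with hu
  set m : ℝ := (X.card : ℝ) with hm
  have hm0 : 0 ≤ m := by positivity
  have hmM : m ≤ M' := by rw [hm]; exact_mod_cast hXM
  have hum : 0 < u - m := by linarith
  have hu0 : 0 < u := by linarith
  have hΦ : 0 < Pot S N l U := Finset.sum_pos (fun _ _ => Real.exp_pos _) hS
  have hcU : ((U \ X).card : ℝ) = u - m := by
    rw [Finset.card_sdiff_of_subset hX, Nat.cast_sub (Finset.card_le_card hX)]
  set y : ι → ℝ := fun s => l * (((N s ∩ X).card : ℝ) - m * rr (N s) U) / (u - m) with hy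
  have hr01 : ∀ s, 0 ≤ rr (N s) U ∧ rr (N s) U ≤ 1 := by
    intro s
    refine ⟨by unfold rr; positivity, ?_⟩
    unfold rr
    rw [div_le_one hu0, hu]
    exact_mod_cast Finset.card_le_card Finset.inter_subset_right
  have hrr : ∀ s, -(l * rr (N s) (U \ X)) = -(l * rr (N s) U) + y s := by
    intro s
    have h1 : ((N s ∩ (U \ X)).card : ℝ) = (N s ∩ U).card - (N s ∩ X).card := by
      have : N s ∩ (U \ X) = (N s ∩ U) \ (N s ∩ X) := by
        ext v; simp only [Finset.mem_inter, Finset.mem_sdiff]; tauto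
      have h2 : N s ∩ X ⊆ N s ∩ U := Finset.inter_subset_inter_left hX
      rw [this, Finset.card_sdiff_of_subset h2, Nat.cast_sub (Finset.card_le_card h2)]
    simp only [hy, rr, hcU, h1]
    rw [← hu]
    field_simp
    ring
  have hyb : ∀ s, |y s| ≤ l * M' / b := by
    intro s
    have h1 : |((N s ∩ X).card : ℝ) - m * rr (N s) U| ≤ m := by
      have h2 : ((N s ∩ X).card : ℝ) ≤ m := by
        rw [hm]; exact_mod_cast Finset.card_le_card Finset.inter_subset_right
      have h3 : (0:ℝ) ≤ (N s ∩ X).card := by positivity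
      have h4 := mul_le_mul_of_nonneg_left (hr01 s).2 hm0
      have h5 := mul_nonneg hm0 (hr01 s).1
      rw [abs_le]
      constructor <;> linarith
    simp only [hy]
    rw [abs_div, abs_mul, abs_of_nonneg hl, abs_of_pos hum]
    apply div_le_div₀ (by positivity) _ hb hub
    exact mul_le_mul_of_nonneg_left (h1.trans hmM) hl
  have h1 : Pot S N l (U \ X) ≤ ∑ s ∈ S, Real.exp (-(l * rr (N s) U)) * (1 + y s + (l * M' / b)^2) := by
    unfold Pot
    apply Finset.sum_le_sum
    intro s _
    rw [hrr, Real.exp_add]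
    apply mul_le_mul_of_nonneg_left _ (Real.exp_pos _).le
    have h2 := exp_quad ((hyb s).trans hlb)
    have h3 : (y s)^2 ≤ (l * M' / b)^2 := by
      rw [← sq_abs]
      exact pow_le_pow_left₀ (abs_nonneg _) (hyb s) 2
    linarith
  have h2 : ∑ s ∈ S, Real.exp (-(l * rr (N s) U)) * (1 + y s + (l * M' / b)^2)
      = Pot S N l U * (1 + (l * M' / b)^2) + ∑ s ∈ S, Real.exp (-(l * rr (N s) U)) * y s := by
    rw [Pot, Finset.sum_mul, ← Finset.sum_add_distrib]
    apply Finset.sum_congr rfl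
    intro s _
    ring
  have h3 : ∑ s ∈ S, Real.exp (-(l * rr (N s) U)) * y s = Pot S N l U * (l / (u - m) *
      (∑ v ∈ X, ff S N l U v - m * ((∑ v ∈ U, ff S N l U v) / u))) := by
    rw [ff_sum, ff_sum, Finset.sum_div, Finset.mul_sum (s := S) (a := m), ← Finset.sum_sub_distrib,
      Finset.mul_sum, Finset.mul_sum]
    apply Finset.sum_congr rfl
    intro s _
    simp only [hy]
    have : rr (N s) U = ((N s ∩ U).card : ℝ) / u := rfl
    rw [this]
    have hΦ' := hΦ.ne'
    have hum' := hum.ne'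
    field_simp
  have h4 : l / (u - m) * (∑ v ∈ X, ff S N l U v - m * ((∑ v ∈ U, ff S N l U v) / u)) ≤ l * err / b := by
    calc _ ≤ l / (u - m) * err := mul_le_mul_of_nonneg_left (by linarith) (by positivity)
      _ = l * err / (u - m) := by ring
      _ ≤ l * err / b := div_le_div_of_nonneg_left (by positivity) hb hub
  have h5 := Real.add_one_le_exp (l * err / b + (l * M' / b)^2)
  calc _ ≤ _ := h1
    _ = Pot S N l U * (1 + (l * M' / b)^2 + l / (u - m) *
      (∑ v ∈ X, ff S N l U v - m * ((∑ v ∈ U, ff S N l U v) / u))) := by rw [h2, h3]; ring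
    _ ≤ _ := mul_le_mul_of_nonneg_left (by linarith) hΦ.le

namespace TD
variable {k Δ t : ℕ} {β V : Type} {T : TD k Δ t β}

lemma verts_union {A P : Finset ℕ} (hP : ∀ j ∈ P, 0 < j ∧ j < t ∧ T.p j ∈ A ∪ P) :
    T.verts (A ∪ P) = T.verts A ∪ P.image T.x := by
  ext y
  constructor
  · intro hy
    obtain ⟨j, hj, a, rfl⟩ := mem_verts.1 hy
    clear hy
    induction j using Nat.strong_induction_on with
    | _ j ih =>
      rcases Finset.mem_union.1 hj with h | h
      · exact Finset.mem_union_left _ (tau_mem h a)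
      · obtain ⟨h0, ht, hp⟩ := hP j h
        by_cases ha : a = T.c j
        · exact Finset.mem_union_right _ (Finset.mem_image.2 ⟨j, h, by rw [ha]; rfl⟩)
        · rw [T.hτ j h0 ht a ha]
          exact ih _ (T.hp j h0 ht) hp
  · intro hy
    rcases Finset.mem_union.1 hy with h | h
    · exact verts_mono Finset.subset_union_left h
    · obtain ⟨j, hj, rfl⟩ := Finset.mem_image.1 h
      exact x_mem (Finset.mem_union_right _ hj)

variable [Fintype V]

variable (T) in
/-- unused vertices -/
noncomputable def un (A : Finset ℕ) (φ : β → V) : Finset V := univ \ (T.verts A).image φ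

lemma mem_un {A : Finset ℕ} {φ : β → V} {v : V} : v ∈ T.un A φ ↔ ∀ y ∈ T.verts A, φ y ≠ v := by
  simp [un]

lemma card_un {E : (Fin k → V) → Prop} {A : Finset ℕ} {φ : β → V} (h : T.Emb E A φ) :
    (T.un A φ).card + (T.verts A).card = Fintype.card V := by
  rw [un, ← Finset.card_image_of_injOn h.inj, Finset.card_sdiff_add_card_eq_card (Finset.subset_univ _),
    Finset.card_univ]

end TD

/-- all tests -/
noncomputable def tests (k : ℕ) (V : Type) [Fintype V] : Finset ((Fin k → V) × Fin k) :=
  univ.filter fun s => InjOff s.1 s.2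

/-- neighbourhood of a test -/
noncomputable def nb {k : ℕ} {V : Type} [Fintype V] (E : (Fin k → V) → Prop)
    (s : (Fin k → V) × Fin k) : Finset V := univ.filter fun v => E (Function.update s.1 s.2 v)

namespace TD
variable {k Δ t : ℕ} {β V : Type} [Fintype V] {T : TD (k+1) Δ t β} {E : (Fin (k+1) → V) → Prop}

lemma stage2_step (hk : 1 ≤ k) {γ l b θ : ℝ} {M' N s0 : ℕ}
    (hE : ∀ e, E e → Function.Injective e)
    (hsym : ∀ e (σ : Equiv.Perm (Fin (k+1))), E e → E (e ∘ σ))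
    (hγ : 0 < γ) (hγ1 : γ ≤ 1) (hl : 0 ≤ l) (hb : 0 < b) (hθ : 0 < θ) (hθ1 : θ ≤ 1/8)
    (hlb : l * M' / b ≤ 1) (hθb : 2 * (k + 1 : ℝ) ≤ θ * b)
    (hKb : M' * (2 * KK k θ (γ/2) / b) ≤ 1/2)
    {A P : Finset ℕ} {φ : β → V} {r : ℕ} (hA : T.DC A) (hφ : T.Emb E A φ)
    (hP : T.Piece A P r) (hPM : P.card ≤ M')
    (hs0 : (P.filter fun j => ¬ ∀ i, i < Δ * N → T.p^[i] j ∈ P).card ≤ s0)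
    (hub : b ≤ ((T.un A φ).card : ℝ) - P.card)
    (hr : ∀ s ∈ tests (k+1) V, 1/2 + γ/2 ≤ rr (nb E s) (T.un A φ)) :
    ∃ ψ, T.Emb E (A ∪ P) ψ ∧ (∀ y ∈ T.verts A, ψ y = φ y) ∧
      b ≤ (T.un (A ∪ P) ψ).card ∧
      Pot (tests (k+1) V) (nb E) l (T.un (A ∪ P) ψ) ≤ Pot (tests (k+1) V) (nb E) l (T.un A φ) *
        Real.exp (l * (M' * (2 * θ + (1 - (2 * (γ/2) / KK k θ (γ/2))^Δ)^N) + s0 +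
          4 * KK k θ (γ/2) * M'^3 / b) / b + (l * M' / b)^2) := by
  set U := T.un A φ with hU
  set f := ff (tests (k+1) V) (nb E) l U with hfdef
  have hPc0 : (0:ℝ) ≤ P.card := by positivity
  have hubU : b ≤ U.card := by linarith
  have hU0 : (0:ℝ) < U.card := by linarith
  have hf := ff_range (tests (k+1) V) (nb E) l U
  have cod : ∀ e i, InjOff e i → (1/2 + γ/2) * (U.card : ℝ) ≤
      ((U.filter fun v => E (Function.update e i v)).card : ℝ) := by
    intro e i hio
    have h1 := hr (e, i) (by simp [tests, hio])
    unfold rr at h1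
    rw [le_div_iff₀ hU0] at h1
    have h2 : (U.filter fun v => E (Function.update e i v)) = nb E (e, i) ∩ U := by
      ext v
      simp [nb, and_comm]
    rw [h2]
    exact h1
  obtain ⟨w, HBw, hpos, hmean⟩ := exists_weight (E := E) (U := U) (f := f) (g := γ/2) (θ := θ) hk
    (by linarith) (by linarith) hθ hθ1 hE hsym hf cod
    (hθb.trans (mul_le_mul_of_nonneg_left hubU hθ.le))
  set K := KK k θ (γ/2) with hK
  have hK1 : 1 ≤ K := HBw.K1
  have hP' : ∀ j ∈ P, 0 < j ∧ j < t ∧ T.p j ∈ A ∪ P := by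
    intro j hj
    refine ⟨(hP.pos j hj).1, (hP.pos j hj).2, ?_⟩
    by_cases h : j = r
    · rw [h]; exact Finset.mem_union_left _ hP.rA
    · exact Finset.mem_union_right _ (hP.par j hj h)
  have hPMr : (P.card : ℝ) ≤ M' := by exact_mod_cast hPM
  have hKU : (P.card : ℝ) * (2 * K / U.card) ≤ 1/2 := by
    refine le_trans ?_ hKb
    apply mul_le_mul hPMr _ (by positivity) (by positivity)
    exact div_le_div_of_nonneg_left (by positivity) hb hubU
  have hmean0 : 0 ≤ (∑ v ∈ U, f v) / U.card + 2 * θ :=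
    add_nonneg (div_nonneg (Finset.sum_nonneg fun v _ => (hf v).1) hU0.le) (by positivity)
  obtain ⟨hDC, ψ, h1, h2, h3, h4⟩ := TD.piece HBw hf hmean0 hpos hmean P.card hKU N hA hφ hP.disj hP'
    le_rfl (fun v hv => mem_un.1 hv)
  set δ := (1 - (2 * (γ/2) / K)^Δ)^N with hδ
  have hδ0 : 0 ≤ δ := by
    have hp1 : 2 * (γ/2) / K ≤ 1 := by
      rw [div_le_one (by linarith)]; linarith
    have hp0 : 0 ≤ 2 * (γ/2) / K := by positivity
    exact pow_nonneg (sub_nonneg.2 (pow_le_one₀ hp0 hp1)) _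
  set X := P.image fun j => ψ (T.x j) with hX
  have hXinj : Set.InjOn (fun j => ψ (T.x j)) P := by
    intro i hi j hj hij
    have := h1.inj (x_mem (Finset.mem_union_right _ hi)) (x_mem (Finset.mem_union_right _ hj)) hij
    exact x_inj (hP.pos i hi).1 (hP.pos i hi).2 (hP.pos j hj).1 (hP.pos j hj).2 this
  have hXc : X.card = P.card := Finset.card_image_of_injOn hXinj
  have hXU : X ⊆ U := by
    intro v hv
    obtain ⟨j, hj, rfl⟩ := Finset.mem_image.1 hv
    exact h3 j hj
  have hUX : T.un (A ∪ P) ψ = U \ X := by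
    ext v
    rw [Finset.mem_sdiff, mem_un, mem_un, verts_union hP']
    constructor
    · intro h
      refine ⟨fun y hy => ?_, fun hv => ?_⟩
      · rw [← h2 y hy]; exact h y (Finset.mem_union_left _ hy)
      · obtain ⟨j, hj, rfl⟩ := Finset.mem_image.1 hv
        exact h (T.x j) (Finset.mem_union_right _ (Finset.mem_image_of_mem _ hj)) rfl
    · rintro ⟨ha, hb⟩ y hy hyv
      rcases Finset.mem_union.1 hy with hy | hy
      · rw [h2 y hy] at hyv; exact ha y hy hyv
      · obtain ⟨j, hj, rfl⟩ := Finset.mem_image.1 hy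
        exact hb (Finset.mem_image.2 ⟨j, hj, hyv⟩)
  refine ⟨ψ, h1, h2, ?_, ?_⟩
  · rw [hUX, Finset.card_sdiff_of_subset hXU, Nat.cast_sub (Finset.card_le_card hXU), hXc]
    exact hub
  · rw [hUX]
    apply pot_step _ hXU (by rw [hXc]; exact hPM) hb (by rw [hXc]; exact hub) hl hlb (by positivity)
    · rw [hXc, hX, Finset.sum_image hXinj]
      have e1 : (P.card : ℝ) * ((∑ v ∈ U, f v) / U.card + 2 * θ + δ) ≤
          P.card * ((∑ v ∈ U, f v) / U.card) + M' * (2 * θ + δ) := by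
        have := mul_le_mul_of_nonneg_right hPMr (show 0 ≤ 2 * θ + δ by positivity)
        linarith
      have e2 : ((P.filter fun j => ¬ ∀ i, i < Δ * N → T.p^[i] j ∈ P).card : ℝ) ≤ s0 := by
        exact_mod_cast hs0
      have e3 : 4 * K * (P.card : ℝ)^3 / U.card ≤ 4 * K * M'^3 / b := by
        apply div_le_div₀ (by positivity) _ hb hubU
        gcongr
      linarith
    · refine ⟨(φ ∘ T.τ 0, T.c 0), ?_⟩
      simp only [tests, Finset.mem_filter, Finset.mem_univ, true_and]
      exact InjOff_of_inj (hE _ (hφ.edge 0 hA.zero)) _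

lemma pot_rr {ι V : Type} {S : Finset ι} {N : ι → Finset V} {l g : ℝ} {U : Finset V} (hl : 0 < l)
    (h : Pot S N l U ≤ Real.exp (-(l * g))) : ∀ s ∈ S, g ≤ rr (N s) U := by
  intro s hs
  have h1 : Real.exp (-(l * rr (N s) U)) ≤ Pot S N l U :=
    Finset.single_le_sum (f := fun s => Real.exp (-(l * rr (N s) U)))
      (fun _ _ => (Real.exp_pos _).le) hs
  have := Real.exp_le_exp.1 (h1.trans h)
  nlinarith

lemma stage2 (hk : 1 ≤ k) {γ l b θ ξ : ℝ} {M M' N s0 Q : ℕ}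
    (hE : ∀ e, E e → Function.Injective e)
    (hsym : ∀ e (σ : Equiv.Perm (Fin (k+1))), E e → E (e ∘ σ))
    (hγ : 0 < γ) (hγ1 : γ ≤ 1) (hl : 0 < l) (hb : 0 < b) (hθ : 0 < θ) (hθ1 : θ ≤ 1/8)
    (hlb : l * M' / b ≤ 1) (hθb : 2 * (k + 1 : ℝ) ≤ θ * b)
    (hKb : M' * (2 * KK k θ (γ/2) / b) ≤ 1/2)
    (hs0 : ∑ i ∈ range (Δ * N), ((k+1) * Δ)^i ≤ s0)
    (hξ : l * (M' * (2 * θ + (1 - (2 * (γ/2) / KK k θ (γ/2))^Δ)^N) + s0 +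
          4 * KK k θ (γ/2) * M'^3 / b) / b + (l * M' / b)^2 ≤ ξ) (hξ0 : 0 ≤ ξ)
    (hQ : ((tests (k+1) V).card : ℝ) * Real.exp (ξ * Q) ≤ Real.exp (l * γ / 4))
    {T0 : Finset ℕ} {φ0 : β → V} (hT0 : T.DC T0) (hφ0 : T.Emb E T0 φ0)
    (hr0 : ∀ s ∈ tests (k+1) V, 1/2 + 3 * γ/4 ≤ rr (nb E s) (T.un T0 φ0))
    (hu0 : b ≤ (T.un T0 φ0).card)
    {A : Finset ℕ} {q : ℕ} (hch : T.Chain M M' T0 A q) (hq : q ≤ Q) :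
    (∃ φ, T.Emb E A φ ∧ (∀ y ∈ T.verts T0, φ y = φ0 y) ∧ b ≤ (T.un A φ).card ∧
      Pot (tests (k+1) V) (nb E) l (T.un A φ) ≤
        (tests (k+1) V).card * Real.exp (-(l * (1/2 + 3 * γ/4))) * Real.exp (ξ * q)) ∨
    (∃ A' φ, T.DC A' ∧ T0 ⊆ A' ∧ T.Emb E A' φ ∧ (∀ y ∈ T.verts T0, φ y = φ0 y) ∧
      ((T.un A' φ).card : ℝ) ≤ b + M') := by
  induction hch with
  | refl =>
    left
    refine ⟨φ0, hφ0, fun _ _ => rfl, hu0, ?_⟩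
    simp only [Nat.cast_zero, mul_zero, Real.exp_zero, mul_one]
    unfold Pot
    calc _ ≤ ∑ s ∈ tests (k+1) V, Real.exp (-(l * (1/2 + 3 * γ/4))) := by
          apply Finset.sum_le_sum
          intro s hs
          apply Real.exp_le_exp.2
          have := mul_le_mul_of_nonneg_left (hr0 s hs) hl.le
          linarith
      _ = _ := by simp
  | step A P r q hch hP h1 h2 ih =>
    rcases ih (by omega) with ⟨φ, ha, hb', hc, hd⟩ | h
    · have hA := hch.dc hT0
      by_cases hub : b ≤ ((T.un A φ).card : ℝ) - P.card
      · left
        have hr : ∀ s ∈ tests (k+1) V, 1/2 + γ/2 ≤ rr (nb E s) (T.un A φ) := by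
          apply pot_rr hl
          refine hd.trans ?_
          have e1 : Real.exp (ξ * q) ≤ Real.exp (ξ * Q) := by
            apply Real.exp_le_exp.2
            apply mul_le_mul_of_nonneg_left _ hξ0
            exact_mod_cast (by omega : q ≤ Q)
          calc _ ≤ (tests (k+1) V).card * Real.exp (-(l * (1/2 + 3 * γ/4))) * Real.exp (ξ * Q) := by
                gcongr
            _ = ((tests (k+1) V).card * Real.exp (ξ * Q)) * Real.exp (-(l * (1/2 + 3 * γ/4))) := by ring
            _ ≤ Real.exp (l * γ / 4) * Real.exp (-(l * (1/2 + 3 * γ/4))) := by gcongr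
            _ = _ := by rw [← Real.exp_add]; congr 1; ring
        obtain ⟨ψ, g1, g2, g3, g4⟩ := stage2_step hk hE hsym hγ hγ1 hl.le hb hθ hθ1 hlb hθb hKb hA ha hP h2
          ((hP.shallow (by omega) _).trans hs0) hub hr
        refine ⟨ψ, g1, ?_, g3, ?_⟩
        · intro y hy
          rw [g2 y (verts_mono hch.sub hy), hb' y hy]
        · refine g4.trans ?_
          calc _ ≤ (tests (k+1) V).card * Real.exp (-(l * (1/2 + 3 * γ/4))) * Real.exp (ξ * q) *
                Real.exp ξ := by
                apply mul_le_mul hd (Real.exp_le_exp.2 hξ) (Real.exp_pos _).le (by positivity)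
            _ = _ := by
                rw [mul_assoc _ _ (Real.exp ξ), ← Real.exp_add]; push_cast; ring_nf
      · right
        refine ⟨A, φ, hA, hch.sub, ha, hb', ?_⟩
        push Not at hub
        have : (P.card : ℝ) ≤ M' := by exact_mod_cast h2
        linarith
    · exact Or.inr h

end TD
end STC

namespace STC
namespace TD
variable {k Δ t : ℕ} {β V : Type} {T : TD k Δ t β} {E : (Fin k → V) → Prop}

variable (T) in
/-- nodes whose edge contains the new vertex of `s` -/
noncomputable def star (s : ℕ) : Finset ℕ := (range t).filter fun j => ∃ a, T.τ j a = T.x s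

variable (T) in
/-- the nodes relevant to the site `s` -/
noncomputable def Zt (s : ℕ) : Finset ℕ := insert (T.p s) (T.star s)

lemma self_mem_star {s : ℕ} (hs : s < t) : s ∈ T.star s :=
  Finset.mem_filter.2 ⟨by simpa using hs, _, rfl⟩

lemma card_Zt (s : ℕ) : (T.Zt s).card ≤ Δ + 1 :=
  (Finset.card_insert_le _ _).trans (Nat.succ_le_succ (T.hdeg _))

variable (T E) in
/-- the site `s` is still good for the test `q` -/
def Alive (A : Finset ℕ) (φ : β → V) (q : V × (Fin k → V) × Fin k) (s : ℕ) : Prop :=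
  (∃ y ∈ T.verts A, φ y = q.1) ∨
  ((∀ j ∈ T.Zt s, j ∈ A → E (Function.update (φ ∘ T.τ j) (T.c s) q.1)) ∧
    (s ∈ A → E (Function.update q.2.1 q.2.2 (φ (T.x s)))))

variable (T E) in
/-- value of a site -/
noncomputable def av (ρ : ℝ) (A : Finset ℕ) (φ : β → V) (q : V × (Fin k → V) × Fin k) (s : ℕ) : ℝ :=
  if T.Alive E A φ q s then ρ ^ (T.Zt s \ A).card else 0

lemma av_range {ρ : ℝ} (h0 : 0 ≤ ρ) (h1 : ρ ≤ 1) (A : Finset ℕ) (φ : β → V)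
    (q : V × (Fin k → V) × Fin k) (s : ℕ) : 0 ≤ T.av E ρ A φ q s ∧ T.av E ρ A φ q s ≤ 1 := by
  unfold av
  split_ifs
  · exact ⟨pow_nonneg h0 _, pow_le_one₀ h0 h1⟩
  · norm_num

/-- survival of aliveness when the new node is irrelevant -/
lemma alive_irrel {A : Finset ℕ} {φ : β → V} {q : V × (Fin k → V) × Fin k} {s j : ℕ} (hst : s < t)
    (hs0 : 0 < s)
    (hA : T.DC A) (h0 : 0 < j) (ht : j < t) (hj : j ∉ A) (hjZ : j ∉ T.Zt s)
    (h : T.Alive E A φ q s) (v : V) :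
    T.Alive E (insert j A) (Function.update φ (T.x j) v) q s := by
  rcases h with ⟨y, hy, hyq⟩ | ⟨h1, h2⟩
  · left
    exact ⟨y, verts_mono (Finset.subset_insert _ _) hy, by rw [upd_verts h0 ht hA hj v hy, hyq]⟩
  · right
    constructor
    · intro i hi hiA
      rcases Finset.mem_insert.1 hiA with rfl | hiA
      · exact absurd hi hjZ
      · rw [upd_old h0 ht hA hiA v hj]; exact h1 i hi hiA
    · intro hsA
      rcases Finset.mem_insert.1 hsA with rfl | hsA
      · exact absurd (Finset.mem_insert_of_mem (self_mem_star ht)) hjZ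
      · rw [upd_verts h0 ht hA hj v (x_mem hsA)]; exact h2 hsA

lemma Z_col {s j : ℕ} (hst : s < t) (hs0 : 0 < s) (hps : 0 < T.p s) (hjs : j ≠ s) (hjZ : j ∈ T.Zt s) :
    T.c j ≠ T.c s := by
  rcases Finset.mem_insert.1 hjZ with rfl | h
  · exact T.hcol s hs0 hst hps
  · obtain ⟨hj, a, ha⟩ := Finset.mem_filter.1 h
    have h1 := x_in_edge (DC_range (T := T) (by omega)) hs0 hst j hj a ha
    rw [← h1.2.1]
    exact (h1.2.2 hjs).2.1.symm

/-- the test deciding survival -/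
noncomputable def nxt (T : TD k Δ t β) (φ : β → V) (q : V × (Fin k → V) × Fin k) (s j : ℕ) :
    (Fin k → V) × Fin k :=
  if j = s then q.2 else (Function.update (φ ∘ T.τ (T.p j)) (T.c s) q.1, T.c j)

lemma alive_rel {A : Finset ℕ} {φ : β → V} {q : V × (Fin k → V) × Fin k} {s j : ℕ} (hst : s < t)
    (hs0 : 0 < s) (hps : 0 < T.p s)
    (hA : T.DC A) (h0 : 0 < j) (ht : j < t) (hj : j ∉ A) (hp : T.p j ∈ A) (hjZ : j ∈ T.Zt s)
    (h : T.Alive E A φ q s) (v : V)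
    (hv : (∃ y ∈ T.verts A, φ y = q.1) ∨
      E (Function.update (nxt T φ q s j).1 (nxt T φ q s j).2 v)) :
    T.Alive E (insert j A) (Function.update φ (T.x j) v) q s := by
  by_cases hused : ∃ y ∈ T.verts A, φ y = q.1
  · obtain ⟨y, hy, hyq⟩ := hused
    left
    exact ⟨y, verts_mono (Finset.subset_insert _ _) hy, by rw [upd_verts h0 ht hA hj v hy, hyq]⟩
  have hv := hv.resolve_left hused
  obtain ⟨h1, h2⟩ := h.resolve_left hused
  right
  constructor
  · intro i hi hiA
    rcases Finset.mem_insert.1 hiA with rfl | hiA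
    · rw [upd_tau h0 ht hA hp v hj]
      by_cases his : i = s
      · subst his
        rw [Function.update_idem]
        have := h1 (T.p i) (Finset.mem_insert_self _ _) hp
        exact this
      · rw [nxt, if_neg his] at hv
        rw [Function.update_comm (Z_col hst hs0 hps his hi)]
        exact hv
    · rw [upd_old h0 ht hA hiA v hj]; exact h1 i hi hiA
  · intro hsA
    rcases Finset.mem_insert.1 hsA with rfl | hsA
    · rw [Function.update_self]
      rw [nxt, if_pos rfl] at hv
      exact hv
    · rw [upd_verts h0 ht hA hj v (x_mem hsA)]; exact h2 hsA

variable [Fintype V]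

/-- candidate set -/
noncomputable def cand (T : TD k Δ t β) (E : (Fin k → V) → Prop) (A : Finset ℕ) (φ : β → V) (j : ℕ) :
    Finset V := nb E (φ ∘ T.τ (T.p j), T.c j) ∩ T.un A φ

lemma cand_inter {γ : ℝ} (cod : ∀ e i, InjOff e i → (1/2 + γ) * (Fintype.card V : ℝ) ≤ (nb E (e, i)).card)
    {A : Finset ℕ} {φ : β → V} {j : ℕ} (hφ : T.Emb E A φ) (hA : ((T.verts A).card : ℝ) ≤ γ * Fintype.card V)
    (hio : InjOff (φ ∘ T.τ (T.p j)) (T.c j)) {e : Fin k → V} {i : Fin k} (he : InjOff e i) :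
    γ * Fintype.card V ≤ ((cand T E A φ j ∩ nb E (e, i)).card : ℝ) := by
  have h1 := cod _ _ hio
  have h2 := cod _ _ he
  set N1 := nb E (φ ∘ T.τ (T.p j), T.c j)
  set N2 := nb E (e, i)
  have h3 : (N1 ∪ N2).card + (N1 ∩ N2).card = N1.card + N2.card := Finset.card_union_add_card_inter _ _
  have h4 : (N1 ∪ N2).card ≤ Fintype.card V := Finset.card_le_univ _
  have h5 : N1 ∩ N2 ⊆ (cand T E A φ j ∩ N2) ∪ (T.verts A).image φ := by
    intro v hv
    rw [Finset.mem_inter] at hv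
    by_cases hvu : v ∈ (T.verts A).image φ
    · exact Finset.mem_union_right _ hvu
    · apply Finset.mem_union_left
      simp only [cand, Finset.mem_inter, un, Finset.mem_sdiff, Finset.mem_univ, true_and]
      exact ⟨⟨hv.1, hvu⟩, hv.2⟩
  have h6 := (Finset.card_le_card h5).trans (Finset.card_union_le _ _)
  have h7 : ((T.verts A).image φ).card ≤ (T.verts A).card := Finset.card_image_le
  have h3' : ((N1 ∪ N2).card : ℝ) + (N1 ∩ N2).card = N1.card + N2.card := by exact_mod_cast h3
  have h4' : ((N1 ∪ N2).card : ℝ) ≤ Fintype.card V := by exact_mod_cast h4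
  have h6' : ((N1 ∩ N2).card : ℝ) ≤ (cand T E A φ j ∩ N2).card + ((T.verts A).image φ).card := by
    exact_mod_cast h6
  have h7' : (((T.verts A).image φ).card : ℝ) ≤ (T.verts A).card := by exact_mod_cast h7
  linarith

/-- admissible tests of stage one -/
noncomputable def tests3 (k : ℕ) (V : Type) [Fintype V] : Finset (V × (Fin k → V) × Fin k) :=
  univ.filter fun q => InjOff q.2.1 q.2.2

variable (T E) in
/-- potential of stage one -/
noncomputable def Psi (ρ : ℝ) (S : Finset ℕ) (A : Finset ℕ) (φ : β → V) : ℝ :=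
  ∑ q ∈ tests3 k V, ∏ s ∈ S, (1 - T.av E ρ A φ q s / 2)

lemma update_inj {e : Fin k → V} (he : Function.Injective e) (a : Fin k) {w : V} (hw : ∀ b, e b ≠ w) :
    Function.Injective (Function.update e a w) := by
  intro b b' hbb
  by_cases hb : b = a <;> by_cases hb' : b' = a
  · rw [hb, hb']
  · subst hb
    rw [Function.update_self, Function.update_of_ne hb'] at hbb
    exact absurd hbb.symm (hw b')
  · subst hb'
    rw [Function.update_self, Function.update_of_ne hb] at hbb
    exact absurd hbb (hw b)
  · rw [Function.update_of_ne hb, Function.update_of_ne hb'] at hbb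
    exact he hbb

/-- conditional expectation of the value of the relevant site -/
lemma av_sum {γ : ℝ} (hγ : 0 < γ) (hγ1 : γ ≤ 1) (hE : ∀ e, E e → Function.Injective e)
    (cod : ∀ e i, InjOff e i → (1/2 + γ) * (Fintype.card V : ℝ) ≤ (nb E (e, i)).card)
    {A : Finset ℕ} {φ : β → V} {q : V × (Fin k → V) × Fin k} {s j : ℕ} (hst : s < t)
    (hs0 : 0 < s) (hps : 0 < T.p s) (hφ : T.Emb E A φ)
    (hAc : ((T.verts A).card : ℝ) ≤ γ * Fintype.card V)
    (hA : T.DC A) (h0 : 0 < j) (ht : j < t) (hj : j ∉ A) (hp : T.p j ∈ A) (hjZ : j ∈ T.Zt s)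
    (hq : q ∈ tests3 k V) :
    (cand T E A φ j).card * T.av E γ A φ q s ≤
      ∑ v ∈ cand T E A φ j, T.av E γ (insert j A) (Function.update φ (T.x j) v) q s := by
  by_cases hal : T.Alive E A φ q s
  swap
  · rw [av, if_neg hal, mul_zero]
    exact Finset.sum_nonneg fun v _ => (av_range hγ.le hγ1 _ _ _ _).1
  have hinj := hE _ (hφ.edge _ hp)
  have hio : InjOff (φ ∘ T.τ (T.p j)) (T.c j) := InjOff_of_inj hinj _
  have hexp : (T.Zt s \ A).card = (T.Zt s \ insert j A).card + 1 := by
    rw [Finset.sdiff_insert]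
    rw [Finset.card_erase_of_mem (Finset.mem_sdiff.2 ⟨hjZ, hj⟩)]
    have : 0 < (T.Zt s \ A).card := Finset.card_pos.2 ⟨j, Finset.mem_sdiff.2 ⟨hjZ, hj⟩⟩
    omega
  set Y := cand T E A φ j with hY
  set W := Y.filter fun v => T.Alive E (insert j A) (Function.update φ (T.x j) v) q s with hW
  have hcount : γ * Y.card ≤ W.card := by
    by_cases hused : ∃ y ∈ T.verts A, φ y = q.1
    · have : W = Y := by
        apply Finset.filter_true_of_mem
        intro v _
        exact alive_rel hst hs0 hps hA h0 ht hj hp hjZ hal v (Or.inl hused)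
      rw [this]
      have : (0:ℝ) ≤ Y.card := by positivity
      nlinarith
    · have hnio : InjOff (nxt T φ q s j).1 (nxt T φ q s j).2 := by
        unfold nxt
        split_ifs
        · exact (Finset.mem_filter.1 hq).2
        · apply InjOff_of_inj
          apply update_inj hinj
          intro b hb
          exact hused ⟨_, tau_mem hp b, hb⟩
      have h1 := cand_inter cod (j := j) hφ hAc hio hnio
      have h2 : Y ∩ nb E ((nxt T φ q s j).1, (nxt T φ q s j).2) ⊆ W := by
        intro v hv
        rw [Finset.mem_inter] at hv
        apply Finset.mem_filter.2 ⟨hv.1, ?_⟩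
        apply alive_rel hst hs0 hps hA h0 ht hj hp hjZ hal v (Or.inr ?_)
        exact (Finset.mem_filter.1 hv.2).2
      have h3 : ((Y ∩ nb E ((nxt T φ q s j).1, (nxt T φ q s j).2)).card : ℝ) ≤ W.card := by
        exact_mod_cast Finset.card_le_card h2
      have h4 : (Y.card : ℝ) ≤ Fintype.card V := by exact_mod_cast Finset.card_le_univ _
      have := mul_le_mul_of_nonneg_left h4 hγ.le
      linarith
  have hsum : ∑ v ∈ Y, T.av E γ (insert j A) (Function.update φ (T.x j) v) q s =
      W.card * γ ^ (T.Zt s \ insert j A).card := by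
    unfold av
    rw [← Finset.sum_filter, Finset.sum_const, nsmul_eq_mul]
  rw [hsum, av, if_pos hal, hexp, pow_succ]
  have : 0 ≤ γ ^ (T.Zt s \ insert j A).card := pow_nonneg hγ.le _
  nlinarith

lemma stage1_step {γ : ℝ} (hγ : 0 < γ) (hγ1 : γ ≤ 1) (hE : ∀ e, E e → Function.Injective e)
    (cod : ∀ e i, InjOff e i → (1/2 + γ) * (Fintype.card V : ℝ) ≤ (nb E (e, i)).card)
    (hV : 0 < Fintype.card V)
    {S : Finset ℕ} (hS : ∀ s ∈ S, 0 < s ∧ s < t ∧ 0 < T.p s)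
    (hdisj : ∀ s ∈ S, ∀ s' ∈ S, s ≠ s' → Disjoint (T.Zt s) (T.Zt s'))
    {A : Finset ℕ} {φ : β → V} {j : ℕ} (hφ : T.Emb E A φ)
    (hAc : ((T.verts A).card : ℝ) ≤ γ * Fintype.card V)
    (hA : T.DC A) (h0 : 0 < j) (ht : j < t) (hj : j ∉ A) (hp : T.p j ∈ A) :
    ∃ v, T.Emb E (insert j A) (Function.update φ (T.x j) v) ∧
      T.Psi E γ S (insert j A) (Function.update φ (T.x j) v) ≤ T.Psi E γ S A φ := by
  have hinj := hE _ (hφ.edge _ hp)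
  have hio : InjOff (φ ∘ T.τ (T.p j)) (T.c j) := InjOff_of_inj hinj _
  set Y := cand T E A φ j with hY
  have hYpos : 0 < Y.card := by
    have h1 := cand_inter cod (j := j) hφ hAc hio hio
    have h2 : (0:ℝ) < γ * Fintype.card V := by positivity
    have h3 : ((Y ∩ nb E (φ ∘ T.τ (T.p j), T.c j)).card : ℝ) ≤ Y.card := by
      exact_mod_cast Finset.card_le_card Finset.inter_subset_left
    exact_mod_cast (by linarith : (0:ℝ) < Y.card)
  have hrange : ∀ A φ q s, 0 ≤ 1 - T.av E γ A φ q s / 2 ∧ 1 - T.av E γ A φ q s / 2 ≤ 1 := by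
    intro A φ q s
    have := av_range (T := T) (E := E) hγ.le hγ1 A φ q s
    constructor <;> linarith [this.1, this.2]
  have hmono : ∀ q, ∀ s ∈ S, j ∉ T.Zt s → ∀ v, 1 - T.av E γ (insert j A) (Function.update φ (T.x j) v) q s / 2
      ≤ 1 - T.av E γ A φ q s / 2 := by
    intro q s hs hjZ v
    have : T.av E γ A φ q s ≤ T.av E γ (insert j A) (Function.update φ (T.x j) v) q s := by
      by_cases hal : T.Alive E A φ q s
      · have hal' := alive_irrel (E := E) (hS s hs).2.1 (hS s hs).1 hA h0 ht hj hjZ hal v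
        rw [av, av, if_pos hal, if_pos hal', Finset.sdiff_insert, Finset.erase_eq_of_notMem]
        intro h
        exact hjZ (Finset.mem_sdiff.1 h).1
      · rw [av, if_neg hal]
        exact (av_range hγ.le hγ1 _ _ _ _).1
    linarith
  have hone : ∀ q ∈ tests3 k V, ∑ v ∈ Y, ∏ s ∈ S,
      (1 - T.av E γ (insert j A) (Function.update φ (T.x j) v) q s / 2) ≤
      ∑ v ∈ Y, ∏ s ∈ S, (1 - T.av E γ A φ q s / 2) := by
    intro q hq
    by_cases hex : ∃ s ∈ S, j ∈ T.Zt s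
    · obtain ⟨s, hs, hjZ⟩ := hex
      have hoth : ∀ s' ∈ S.erase s, j ∉ T.Zt s' := by
        intro s' hs' hjZ'
        have := Finset.mem_erase.1 hs'
        exact Finset.disjoint_left.1 (hdisj s hs s' this.2 this.1.symm) hjZ hjZ'
      have hav := av_sum hγ hγ1 hE cod (hS s hs).2.1 (hS s hs).1 (hS s hs).2.2 hφ hAc hA h0 ht hj hp hjZ hq
      rw [← hY] at hav
      set R := ∏ s' ∈ S.erase s, (1 - T.av E γ A φ q s' / 2) with hR
      have hR0 : 0 ≤ R := Finset.prod_nonneg fun s' _ => (hrange _ _ _ _).1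
      calc _ ≤ ∑ v ∈ Y, (1 - T.av E γ (insert j A) (Function.update φ (T.x j) v) q s / 2) * R := by
            apply Finset.sum_le_sum
            intro v _
            rw [← Finset.mul_prod_erase S _ hs]
            apply mul_le_mul_of_nonneg_left _ (hrange _ _ _ _).1
            apply Finset.prod_le_prod
            · intro s' _; exact (hrange _ _ _ _).1
            · intro s' hs'
              exact hmono q s' (Finset.mem_erase.1 hs').2 (hoth s' hs') v
        _ = (Y.card - (∑ v ∈ Y, T.av E γ (insert j A) (Function.update φ (T.x j) v) q s) / 2) * R := by
            rw [← Finset.sum_mul, Finset.sum_sub_distrib, ← Finset.sum_div]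
            simp
        _ ≤ (Y.card - (Y.card * T.av E γ A φ q s) / 2) * R := by
            apply mul_le_mul_of_nonneg_right _ hR0
            linarith
        _ = _ := by
            rw [Finset.sum_const, nsmul_eq_mul, ← Finset.mul_prod_erase S _ hs]
            ring
    · push Not at hex
      apply Finset.sum_le_sum
      intro v _
      apply Finset.prod_le_prod
      · intro s' _; exact (hrange _ _ _ _).1
      · intro s' hs'
        exact hmono q s' hs' (hex s' hs') v
  have htot : ∑ v ∈ Y, T.Psi E γ S (insert j A) (Function.update φ (T.x j) v) ≤
      ∑ v ∈ Y, T.Psi E γ S A φ := by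
    unfold Psi
    rw [Finset.sum_comm, Finset.sum_comm (s := Y)]
    exact Finset.sum_le_sum hone
  obtain ⟨v, hv, hle⟩ := Finset.exists_le_of_sum_le (Finset.card_pos.1 hYpos) htot
  refine ⟨v, ?_, hle⟩
  rw [hY, cand, Finset.mem_inter] at hv
  exact hφ.extend h0 ht hA hp hj (mem_un.1 hv.2) (Finset.mem_filter.1 hv.1).2

lemma stage1_list {γ : ℝ} (hγ : 0 < γ) (hγ1 : γ ≤ 1) (hE : ∀ e, E e → Function.Injective e)
    (cod : ∀ e i, InjOff e i → (1/2 + γ) * (Fintype.card V : ℝ) ≤ (nb E (e, i)).card)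
    (hV : 0 < Fintype.card V)
    {S : Finset ℕ} (hS : ∀ s ∈ S, 0 < s ∧ s < t ∧ 0 < T.p s)
    (hdisj : ∀ s ∈ S, ∀ s' ∈ S, s ≠ s' → Disjoint (T.Zt s) (T.Zt s')) (L : List ℕ) :
    ∀ (A : Finset ℕ) (φ : β → V), T.Emb E A φ → T.DC A → T.Adm A L →
    ((T.verts (A ∪ L.toFinset)).card : ℝ) ≤ γ * Fintype.card V →
    ∃ ψ : β → V, T.Emb E (A ∪ L.toFinset) ψ ∧ T.Psi E γ S (A ∪ L.toFinset) ψ ≤ T.Psi E γ S A φ := by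
  induction L with
  | nil =>
    intro A φ hφ _ _ _
    refine ⟨φ, by simpa using hφ, by simp⟩
  | cons j L ih =>
    intro A φ hφ hA hL hAc
    obtain ⟨h0, ht, hj, hp, hL⟩ := hL
    have hAc' : ((T.verts A).card : ℝ) ≤ γ * Fintype.card V :=
      le_trans (by exact_mod_cast Finset.card_le_card (verts_mono Finset.subset_union_left)) hAc
    obtain ⟨v, h1, h2⟩ := stage1_step hγ hγ1 hE cod hV hS hdisj hφ hAc' hA h0 ht hj hp
    have heq : A ∪ (j :: L).toFinset = insert j A ∪ L.toFinset := by
      rw [List.toFinset_cons, Finset.union_insert, ← Finset.insert_union]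
    rw [heq] at hAc ⊢
    obtain ⟨ψ, h3, h4⟩ := ih _ _ h1 (hA.insert ht hp) hL hAc
    exact ⟨ψ, h3, h4.trans h2⟩

/-- success of a site for a test -/
def Succ (T : TD k Δ t β) (E : (Fin k → V) → Prop) (φ : β → V) (w : V) (e : Fin k → V) (i : Fin k)
    (s : ℕ) : Prop :=
  E (Function.update e i (φ (T.x s))) ∧ ∀ j ∈ T.star s, E (Function.update (φ ∘ T.τ j) (T.c s) w)

lemma stage1 {γ : ℝ} (hγ : 0 < γ) (hγ1 : γ ≤ 1) (hE : ∀ e, E e → Function.Injective e)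
    (cod : ∀ e i, InjOff e i → (1/2 + γ) * (Fintype.card V : ℝ) ≤ (nb E (e, i)).card)
    (hk : 0 < k) (hkV : k ≤ Fintype.card V)
    {S T0 : Finset ℕ} (hS : ∀ s ∈ S, 0 < s ∧ s < t ∧ 0 < T.p s)
    (hST : ∀ s ∈ S, T.Zt s ⊆ T0)
    (hdisj : ∀ s ∈ S, ∀ s' ∈ S, s ≠ s' → Disjoint (T.Zt s) (T.Zt s'))
    (hT0 : T.DC T0) (hc : ((T.verts T0).card : ℝ) ≤ γ * Fintype.card V) :
    ∃ φ : β → V, T.Emb E T0 φ ∧ ∀ w e i, InjOff e i → w ∈ T.un T0 φ →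
      Real.exp (-((S.filter (T.Succ E φ w e i)).card : ℝ)) ≤
      (tests3 k V).card * Real.exp (-(γ^(Δ+1) * S.card / 2)) := by
  have hV : 0 < Fintype.card V := by omega
  -- the first edge
  obtain ⟨e0, he0⟩ : ∃ e0 : Fin k → V, E e0 := by
    have hne : Nonempty (Fin k ↪ V) := Function.Embedding.nonempty_of_card_le (by simpa using hkV)
    obtain ⟨f⟩ := hne
    have h1 := cod f ⟨0, hk⟩ (InjOff_of_inj f.injective _)
    have h2 : (0:ℝ) < (1/2 + γ) * Fintype.card V := by positivity
    have h3 : 0 < (nb E ((f : Fin k → V), (⟨0, hk⟩ : Fin k))).card := by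
      exact_mod_cast lt_of_lt_of_le h2 h1
    obtain ⟨v, hv⟩ := Finset.card_pos.1 h3
    exact ⟨_, (Finset.mem_filter.1 hv).2⟩
  haveI : Nonempty V := ⟨e0 ⟨0, hk⟩⟩
  have ht0 : 0 < t := hT0.pos
  set φ0 : β → V := Function.extend (T.τ 0) e0 (fun _ => Classical.arbitrary V) with hφ0
  have hφτ : φ0 ∘ T.τ 0 = e0 := by
    funext a
    show Function.extend (T.τ 0) e0 (fun _ => Classical.arbitrary V) (T.τ 0 a) = e0 a
    exact (T.hinj 0 ht0).extend_apply e0 _ a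
  have hDC0 : T.DC {0} := ⟨by simpa using ht0, by simp, by
    intro j hj h0
    simp at hj; omega⟩
  have hEmb0 : T.Emb E {0} φ0 := by
    constructor
    · intro y hy z hz h
      obtain ⟨i, hi, a, rfl⟩ := mem_verts.1 hy
      obtain ⟨i', hi', a', rfl⟩ := mem_verts.1 hz
      rw [Finset.mem_singleton] at hi hi'
      subst hi; subst hi'
      have h1 := congrFun hφτ a
      have h2 := congrFun hφτ a'
      simp only [Function.comp] at h1 h2
      rw [h1, h2] at h
      rw [hE _ he0 h]
    · intro j hj
      rw [Finset.mem_singleton] at hj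
      rw [hj, hφτ]; exact he0
  obtain ⟨L, hL, _, hadm⟩ := exists_adm (T := T) (T0.erase 0) {0} (by simp) (by
    intro j hj
    have hj' := Finset.mem_erase.1 hj
    have h0 : 0 < j := Nat.pos_of_ne_zero hj'.1
    refine ⟨h0, hT0.sub j hj'.2, ?_⟩
    have h1 := hT0.par j hj'.2 h0
    by_cases h2 : T.p j = 0
    · simp [h2]
    · exact Finset.mem_union_right _ (Finset.mem_erase.2 ⟨h2, h1⟩))
  have hun : {0} ∪ L.toFinset = T0 := by
    rw [hL, ← Finset.insert_eq, Finset.insert_erase hT0.zero]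
  obtain ⟨φ, h1, h2⟩ := stage1_list hγ hγ1 hE cod hV hS hdisj L {0} φ0 hEmb0 hDC0 hadm (by rw [hun]; exact hc)
  rw [hun] at h1 h2
  refine ⟨φ, h1, ?_⟩
  intro w e i hio hw
  have hq : (w, e, i) ∈ tests3 k V := by simp [tests3, hio]
  have hrange : ∀ A φ q s, 0 ≤ 1 - T.av E γ A φ q s / 2 ∧ 1 - T.av E γ A φ q s / 2 ≤ 1 := by
    intro A φ q s
    have := av_range (T := T) (E := E) hγ.le hγ1 A φ q s
    constructor <;> linarith [this.1, this.2]
  have hstart : T.Psi E γ S {0} φ0 ≤ (tests3 k V).card * Real.exp (-(γ^(Δ+1) * S.card / 2)) := by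
    unfold Psi
    calc _ ≤ ∑ q ∈ tests3 k V, Real.exp (-(γ^(Δ+1) * S.card / 2)) := by
          apply Finset.sum_le_sum
          intro q _
          calc _ ≤ ∏ s ∈ S, Real.exp (-(γ^(Δ+1) / 2)) := by
                apply Finset.prod_le_prod
                · intro s _; exact (hrange _ _ _ _).1
                · intro s hs
                  have hZ0 : 0 ∉ T.Zt s := by
                    intro h
                    obtain ⟨a1, a2, a3⟩ := hS s hs
                    rcases Finset.mem_insert.1 h with h | h
                    · omega
                    · obtain ⟨_, a, ha⟩ := Finset.mem_filter.1 h
                      exact T.hnew s a1 a2 0 a1 a ha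
                  have hal : T.Alive E {0} φ0 q s := by
                    right
                    constructor
                    · intro j hj hj0
                      rw [Finset.mem_singleton] at hj0
                      subst hj0
                      exact absurd hj hZ0
                    · intro hs0
                      rw [Finset.mem_singleton] at hs0
                      have := (hS s hs).1
                      omega
                  have : γ^(Δ+1) ≤ T.av E γ {0} φ0 q s := by
                    rw [av, if_pos hal]
                    apply pow_le_pow_of_le_one hγ.le hγ1
                    exact (Finset.card_le_card Finset.sdiff_subset).trans (card_Zt s)
                  have := Real.add_one_le_exp (-(γ^(Δ+1) / 2))
                  linarith
            _ = _ := by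
                rw [Finset.prod_const, ← Real.exp_nat_mul]
                congr 1
                ring
      _ = _ := by simp
  refine le_trans ?_ (h2.trans hstart)
  have hterm : ∏ s ∈ S, (1 - T.av E γ T0 φ (w, e, i) s / 2) ≤ T.Psi E γ S T0 φ :=
    Finset.single_le_sum (f := fun q => ∏ s ∈ S, (1 - T.av E γ T0 φ q s / 2))
      (fun q _ => Finset.prod_nonneg fun s _ => (hrange _ _ _ _).1) hq
  refine le_trans ?_ hterm
  have hle : ∏ s ∈ S, (if T.Succ E φ w e i s then Real.exp (-1) else 1) ≤
      ∏ s ∈ S, (1 - T.av E γ T0 φ (w, e, i) s / 2) := by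
    apply Finset.prod_le_prod
    · intro s _
      split_ifs
      · exact (Real.exp_pos _).le
      · exact zero_le_one
    · intro s hs
      have hav := av_range (T := T) (E := E) hγ.le hγ1 T0 φ (w, e, i) s
      split_ifs with hsucc
      · have : Real.exp (-1) ≤ 1/2 := by
          rw [Real.exp_neg, inv_le_comm₀ (Real.exp_pos _) (by norm_num)]
          have := Real.add_one_le_exp (1:ℝ)
          norm_num at this ⊢; linarith
        linarith [hav.2]
      · have hal : ¬ T.Alive E T0 φ (w, e, i) s := by
          rintro (⟨y, hy, hyw⟩ | ⟨b1, b2⟩)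
          · exact mem_un.1 hw y hy hyw
          · apply hsucc
            have hsub := hST s hs
            refine ⟨b2 (hsub (Finset.mem_insert_of_mem (self_mem_star (hS s hs).2.1))), ?_⟩
            intro j hj
            exact b1 j (Finset.mem_insert_of_mem hj) (hsub (Finset.mem_insert_of_mem hj))
        rw [av, if_neg hal]
        norm_num
  refine le_trans (le_of_eq ?_) hle
  rw [Finset.prod_ite, Finset.prod_const, Finset.prod_const_one, mul_one, ← Real.exp_nat_mul]
  congr 1
  ring

end TD
end STC

namespace STC
namespace TD
variable {k Δ t : ℕ} {β V : Type} {T : TD k Δ t β} {E : (Fin k → V) → Prop}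

/-- an edge meets few sites -/
lemma card_sites_edge {C : Finset ℕ} (hC : ∀ s ∈ C, 0 < s ∧ s < t) {X : Finset β}
    (hX : ∀ s ∈ C, T.x s ∈ X) : C.card ≤ X.card := by
  apply Finset.card_le_card_of_injOn T.x hX
  intro s hs s' hs' h
  exact x_inj (hC s hs).1 (hC s hs).2 (hC s' hs').1 (hC s' hs').2 h

lemma exists_sites (hk : 2 ≤ k) {T0 : Finset ℕ} {q : ℕ} (hT0 : T.DC T0)
    (bd : ((range t).filter fun z => z ∉ T0 ∧ T.p z ∈ T0).card ≤ q) :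
    ∃ S : Finset ℕ, (∀ s ∈ S, 0 < s ∧ s < t ∧ 0 < T.p s) ∧ (∀ s ∈ S, T.Zt s ⊆ T0) ∧
      (∀ s ∈ S, ∀ s' ∈ S, s ≠ s' → Disjoint (T.Zt s) (T.Zt s')) ∧
      T0.card ≤ 1 + k * Δ + q * k + S.card * ((Δ + 1) * (k * Δ + k)) := by
  set C := T0.filter fun s => 0 < s ∧ 0 < T.p s ∧ T.star s ⊆ T0 with hCdef
  have hC : ∀ s ∈ C, 0 < s ∧ s < t := by
    intro s hs
    have := Finset.mem_filter.1 hs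
    exact ⟨this.2.1, hT0.sub s this.1⟩
  set bad := T0.filter fun s => 0 < s ∧ ¬ T.star s ⊆ T0 with hbad
  set bdry := (range t).filter fun z => z ∉ T0 ∧ T.p z ∈ T0 with hbdry
  have ht0 : 0 < t := hT0.pos
  have hbadc : bad.card ≤ q * k := by
    have h1 : bad.card ≤ (bdry.biUnion fun z => univ.image (T.τ z)).card := by
      apply card_sites_edge
      · intro s hs
        have := Finset.mem_filter.1 hs
        exact ⟨this.2.1, hT0.sub s this.1⟩
      · intro s hs
        obtain ⟨hsT, hs0, hns⟩ := Finset.mem_filter.1 hs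
        have hst := hT0.sub s hsT
        have hex : ∃ j, j ∈ T.star s ∧ j ∉ T0 := by
          by_contra hcon
          push Not at hcon
          exact hns hcon
        have hj := Nat.find_spec hex
        have hmin := fun i => Nat.find_min (m := i) hex
        set j := Nat.find hex
        obtain ⟨hjt, a, ha⟩ := Finset.mem_filter.1 hj.1
        have hjt' : j < t := by simpa using hjt
        have hjs : j ≠ s := fun h => hj.2 (h ▸ hsT)
        obtain ⟨_, _, h3⟩ := x_in_edge (DC_range (T := T) ht0) hs0 hst j hjt a ha
        obtain ⟨hj0, _, hpa⟩ := h3 hjs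
        have hlt := T.hp j hj0 hjt'
        have hpT : T.p j ∈ T0 := by
          by_contra hcon
          exact hmin _ hlt ⟨Finset.mem_filter.2 ⟨by simp; omega, a, hpa⟩, hcon⟩
        exact Finset.mem_biUnion.2 ⟨j, Finset.mem_filter.2 ⟨hjt, hj.2, hpT⟩,
          Finset.mem_image.2 ⟨a, Finset.mem_univ _, ha⟩⟩
    refine h1.trans ((Finset.card_biUnion_le_card_mul _ _ k ?_).trans (Nat.mul_le_mul_right _ bd))
    intro z _
    exact Finset.card_image_le.trans (by simp)
  have hcover : T0 ⊆ ({0} ∪ ((range t).filter fun j => 0 < j ∧ T.p j = 0)) ∪ bad ∪ C := by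
    intro s hs
    have hst := hT0.sub s hs
    simp only [Finset.mem_union, Finset.mem_singleton, Finset.mem_filter, Finset.mem_range, hbad, hCdef]
    by_cases h0 : s = 0
    · simp [h0]
    · by_cases h1 : T.p s = 0
      · left; left; right; exact ⟨hst, Nat.pos_of_ne_zero h0, h1⟩
      · by_cases h2 : T.star s ⊆ T0
        · right; exact ⟨hs, Nat.pos_of_ne_zero h0, Nat.pos_of_ne_zero h1, h2⟩
        · left; right; exact ⟨hs, Nat.pos_of_ne_zero h0, h2⟩
  have hT0c : T0.card ≤ 1 + k * Δ + q * k + C.card := by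
    have h1 := Finset.card_le_card hcover
    have h2 := Finset.card_union_le ({0} ∪ ((range t).filter fun j => 0 < j ∧ T.p j = 0) ∪ bad) C
    have h3 := Finset.card_union_le ({0} ∪ ((range t).filter fun j => 0 < j ∧ T.p j = 0)) bad
    have h4 := Finset.card_union_le {0} ((range t).filter fun j => 0 < j ∧ T.p j = 0)
    have h5 := children (T := T) hk 0
    rw [Finset.card_singleton] at h4
    omega
  obtain ⟨PD, hPD⟩ : ∃ PD : Finset ℕ → Prop, ∀ S, PD S ↔
      ∀ s ∈ S, ∀ s' ∈ S, s ≠ s' → Disjoint (T.Zt s) (T.Zt s') := ⟨_, fun S => Iff.rfl⟩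
  set P := C.powerset.filter PD with hP
  obtain ⟨S, hSP, hmax⟩ := Finset.exists_max_image P Finset.card
    ⟨∅, by simp [hP, hPD]⟩
  obtain ⟨hSC, hSd⟩ := Finset.mem_filter.1 hSP
  rw [Finset.mem_powerset] at hSC
  rw [hPD] at hSd
  refine ⟨S, ?_, ?_, hSd, ?_⟩
  · intro s hs
    have := Finset.mem_filter.1 (hSC hs)
    exact ⟨this.2.1, hT0.sub s this.1, this.2.2.1⟩
  · intro s hs
    have := Finset.mem_filter.1 (hSC hs)
    intro j hj
    rcases Finset.mem_insert.1 hj with rfl | hj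
    · exact hT0.par s this.1 this.2.1
    · exact this.2.2.2 hj
  · refine hT0c.trans (Nat.add_le_add_left ?_ _)
    have hsub : C ⊆ S.biUnion fun s => (T.Zt s).biUnion fun j => C.filter fun s' => j ∈ T.Zt s' := by
      intro s hs
      rw [Finset.mem_biUnion]
      by_contra hcon
      push Not at hcon
      have hnS : s ∉ S := by
        intro hsS
        apply hcon s hsS
        rw [Finset.mem_biUnion]
        exact ⟨T.p s, Finset.mem_insert_self _ _, Finset.mem_filter.2 ⟨hs, Finset.mem_insert_self _ _⟩⟩
      have hd : ∀ s' ∈ S, Disjoint (T.Zt s') (T.Zt s) := by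
        intro s' hs'
        rw [Finset.disjoint_left]
        intro j hj hj'
        apply hcon s' hs'
        rw [Finset.mem_biUnion]
        exact ⟨j, hj, Finset.mem_filter.2 ⟨hs, hj'⟩⟩
      have hins : insert s S ∈ P := by
        rw [hP, Finset.mem_filter, Finset.mem_powerset, hPD]
        refine ⟨Finset.insert_subset hs hSC, ?_⟩
        intro a ha b hb hab
        rcases Finset.mem_insert.1 ha with ha | ha <;> rcases Finset.mem_insert.1 hb with hb | hb
        · exact absurd (ha.trans hb.symm) hab
        · rw [ha]; exact (hd b hb).symm
        · rw [hb]; exact hd a ha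
        · exact hSd a ha b hb hab
      have := hmax _ hins
      rw [Finset.card_insert_of_notMem hnS] at this
      omega
    refine (Finset.card_le_card hsub).trans (Finset.card_biUnion_le_card_mul _ _ _ ?_)
    intro s _
    refine le_trans (Finset.card_biUnion_le_card_mul _ _ (k * Δ + k) ?_)
      (Nat.mul_le_mul_right _ (card_Zt s))
    intro j _
    have hs2 : (C.filter fun s' => j ∈ T.Zt s') ⊆
        ((range t).filter fun i => 0 < i ∧ T.p i = j) ∪ C.filter fun s' => T.x s' ∈ univ.image (T.τ j) := by
      intro s' hs'
      obtain ⟨h1, h2⟩ := Finset.mem_filter.1 hs'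
      rcases Finset.mem_insert.1 h2 with h2 | h2
      · exact Finset.mem_union_left _ (Finset.mem_filter.2 ⟨by simpa using (hC s' h1).2, (hC s' h1).1, h2.symm⟩)
      · obtain ⟨_, a, ha⟩ := Finset.mem_filter.1 h2
        exact Finset.mem_union_right _ (Finset.mem_filter.2 ⟨h1, Finset.mem_image.2 ⟨a, Finset.mem_univ _, ha⟩⟩)
    refine (Finset.card_le_card hs2).trans ((Finset.card_union_le _ _).trans (Nat.add_le_add (children hk j) ?_))
    refine (card_sites_edge (T := T) (X := univ.image (T.τ j)) (fun s hs => hC s (Finset.mem_filter.1 hs).1)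
      (fun s hs => (Finset.mem_filter.1 hs).2)).trans ?_
    exact Finset.card_image_le.trans (by simp)

variable [Fintype V]

lemma finish_step (hE : ∀ e, E e → Function.Injective e)
    {S T0 : Finset ℕ} (hS : ∀ s ∈ S, 0 < s ∧ s < t ∧ 0 < T.p s)
    (hST : ∀ s ∈ S, T.Zt s ⊆ T0)
    (hdisj : ∀ s ∈ S, ∀ s' ∈ S, s ≠ s' → Disjoint (T.Zt s) (T.Zt s'))
    {φ0 : β → V} {R : ℕ} (hV : k + t ≤ Fintype.card V + 1)
    (hsucc : ∀ w e i, InjOff e i → w ∈ T.un T0 φ0 → R ≤ (S.filter (T.Succ E φ0 w e i)).card)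
    (m : ℕ) : ∀ (A : Finset ℕ) (φ : β → V) (S' : Finset ℕ), T.DC A → T0 ⊆ A → T.Emb E A φ → S' ⊆ S →
      A.card + m = t → m + (S \ S').card ≤ R →
      (∀ s ∈ S', ∀ i ∈ T.star s, φ ∘ T.τ i = φ0 ∘ T.τ i) →
      (∀ y ∈ T.verts T0, ∃ y' ∈ T.verts A, φ y' = φ0 y) →
      ∃ φ', T.Emb E (range t) φ' := by
  induction m with
  | zero =>
    intro A φ S' hA _ hφ _ hc _ _ _
    refine ⟨φ, ?_⟩
    have : A = range t := Finset.eq_of_subset_of_card_le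
      (fun j hj => by simpa using hA.sub j hj) (by simp; omega)
    rwa [← this]
  | succ m ih =>
    intro A φ S' hA hTA hφ hS' hc hR hstar hcov
    have hex : ∃ j, j < t ∧ j ∉ A := by
      by_contra hcon
      push Not at hcon
      have : range t ⊆ A := fun j hj => hcon j (by simpa using hj)
      have := Finset.card_le_card this
      simp at this; omega
    have hj := Nat.find_spec hex
    have hmin := fun i => Nat.find_min (m := i) hex
    set j := Nat.find hex
    obtain ⟨hjt, hjA⟩ := hj
    have h0 : 0 < j := Nat.pos_of_ne_zero fun h => hjA (h ▸ hA.zero)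
    have hp : T.p j ∈ A := by
      by_contra hcon
      have := T.hp j h0 hjt
      exact hmin _ this ⟨by omega, hcon⟩
    have hune : (T.un A φ).Nonempty := by
      rw [← Finset.card_pos]
      have h1 := card_un hφ
      have h2 := card_verts hA
      omega
    obtain ⟨w, hw⟩ := hune
    have hwA := mem_un.1 hw
    have hw0 : w ∈ T.un T0 φ0 := by
      rw [mem_un]
      intro y hy h
      obtain ⟨y', hy', h'⟩ := hcov y hy
      exact hwA y' hy' (h'.trans h)
    have hcard := hsucc w (φ ∘ T.τ (T.p j)) (T.c j) (InjOff_of_inj (hE _ (hφ.edge _ hp)) _) hw0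
    obtain ⟨s, hs, hsS'⟩ : ∃ s ∈ S.filter (T.Succ E φ0 w (φ ∘ T.τ (T.p j)) (T.c j)), s ∈ S' := by
      by_contra hcon
      push Not at hcon
      have : S.filter (T.Succ E φ0 w (φ ∘ T.τ (T.p j)) (T.c j)) ⊆ S \ S' := fun s hs =>
        Finset.mem_sdiff.2 ⟨(Finset.mem_filter.1 hs).1, hcon s hs⟩
      have := Finset.card_le_card this
      omega
    obtain ⟨hsS, hs1, hs2⟩ := Finset.mem_filter.1 hs
    obtain ⟨hs0, hst, hps⟩ := hS s hsS
    have hstA : ∀ i ∈ T.star s, i ∈ A := fun i hi => hTA (hST s hsS (Finset.mem_insert_of_mem hi))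
    have hsA : s ∈ A := hstA s (self_mem_star hst)
    have hxs : φ (T.x s) = φ0 (T.x s) := congrFun (hstar s hsS' s (self_mem_star hst)) (T.c s)
    set ψ := Function.update φ (T.x s) w with hψ
    have hψ1 : ∀ y, y ≠ T.x s → ψ y = φ y := fun y hy => Function.update_of_ne hy _ _
    have hψ2 : ψ (T.x s) = w := Function.update_self _ _ _
    have hψτ : ∀ i, i < t → i ∉ T.star s → ψ ∘ T.τ i = φ ∘ T.τ i := by
      intro i hi his
      funext a
      exact hψ1 _ fun h => his (Finset.mem_filter.2 ⟨by simpa using hi, a, h⟩)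
    have hψE : T.Emb E A ψ := by
      constructor
      · intro y hy z hz h
        by_cases h1 : y = T.x s <;> by_cases h2 : z = T.x s
        · rw [h1, h2]
        · rw [h1, hψ2, hψ1 z h2] at h
          exact absurd h.symm (hwA z hz)
        · rw [h2, hψ2, hψ1 y h1] at h
          exact absurd h (hwA y hy)
        · rw [hψ1 z h2, hψ1 y h1] at h
          exact hφ.inj hy hz h
      · intro i hi
        by_cases his : i ∈ T.star s
        · have h1 := hs2 i his
          rw [← hstar s hsS' i his] at h1
          convert h1 using 1
          obtain ⟨hit, a, ha⟩ := Finset.mem_filter.1 his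
          have hac := (x_in_edge (DC_range (T := T) hA.pos) hs0 hst i hit a ha).2.1
          funext a'
          by_cases haa : a' = T.c s
          · rw [haa, Function.update_self]
            rw [hac] at ha
            simp only [Function.comp, ha, hψ2]
          · rw [Function.update_of_ne haa]
            apply hψ1
            intro h
            exact haa (x_in_edge (DC_range (T := T) hA.pos) hs0 hst i hit a' h).2.1
        · rw [hψτ i (hA.sub i hi) his]
          exact hφ.edge i hi
    have hjs : j ∉ T.star s := fun h => hjA (hstA j h)
    have hnew : ∀ y ∈ T.verts A, ψ y ≠ φ (T.x s) := by
      intro y hy h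
      by_cases h1 : y = T.x s
      · rw [h1, hψ2] at h
        exact hwA _ (x_mem hsA) h.symm
      · rw [hψ1 y h1] at h
        exact h1 (hφ.inj hy (x_mem hsA) h)
    have hEn : E (Function.update (ψ ∘ T.τ (T.p j)) (T.c j) (φ (T.x s))) := by
      rw [hxs]
      convert hs1 using 1
      funext a
      by_cases haa : a = T.c j
      · rw [haa, Function.update_self, Function.update_self]
      · rw [Function.update_of_ne haa, Function.update_of_ne haa]
        apply hψ1
        intro h
        rw [← T.hτ j h0 hjt a haa] at h
        exact hjs (Finset.mem_filter.2 ⟨by simpa using hjt, a, h⟩)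
    have hext := hψE.extend h0 hjt hA hp hjA hnew hEn
    refine ih (insert j A) _ (S'.erase s) (hA.insert hjt hp) (hTA.trans (Finset.subset_insert _ _)) hext
      ((Finset.erase_subset _ _).trans hS') ?_ ?_ ?_ ?_
    · rw [Finset.card_insert_of_notMem hjA]; omega
    · have : S \ S'.erase s ⊆ insert s (S \ S') := by
        intro a ha
        simp only [Finset.mem_sdiff, Finset.mem_erase, Finset.mem_insert] at ha ⊢
        tauto
      have := (Finset.card_le_card this).trans (Finset.card_insert_le _ _)
      omega
    · intro s' hs' i hi
      obtain ⟨hss, hs'S⟩ := Finset.mem_erase.1 hs'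
      have hiA : i ∈ A := hTA (hST s' (hS' hs'S) (Finset.mem_insert_of_mem hi))
      rw [upd_old h0 hjt hA hiA _ hjA, hψτ i (hA.sub i hiA), hstar s' hs'S i hi]
      intro his
      exact Finset.disjoint_left.1 (hdisj s' (hS' hs'S) s hsS hss) (Finset.mem_insert_of_mem hi)
        (Finset.mem_insert_of_mem his)
    · intro y hy
      obtain ⟨y', hy', h'⟩ := hcov y hy
      by_cases h1 : y' = T.x s
      · refine ⟨T.x j, x_mem (Finset.mem_insert_self _ _), ?_⟩
        rw [Function.update_self, ← h1, h']
      · refine ⟨y', verts_mono (Finset.subset_insert _ _) hy', ?_⟩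
        rw [upd_verts h0 hjt hA hjA _ hy', hψ1 y' h1, h']
end TD
end STC

namespace STC
section Num
open Filter

lemma ev_nat (C : ℝ) : ∀ᶠ n : ℕ in atTop, C ≤ (n : ℝ) :=
  tendsto_natCast_atTop_atTop.eventually_ge_atTop C

lemma ev_sqrt (C : ℝ) : ∀ᶠ n : ℕ in atTop, C ≤ Real.sqrt n :=
  (Real.tendsto_sqrt_atTop.comp tendsto_natCast_atTop_atTop).eventually_ge_atTop C

lemma ev_exp (a c : ℝ) (ha : 0 < a) (hc : 0 < c) (m : ℕ) :
    ∀ᶠ n : ℕ in atTop, a * (n : ℝ)^m ≤ Real.exp (c * Real.sqrt n) := by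
  have h := (isLittleO_pow_exp_pos_mul_atTop (2 * m) hc).def (show 0 < 1 / a by positivity)
  have h2 := (Real.tendsto_sqrt_atTop.comp tendsto_natCast_atTop_atTop).eventually h
  filter_upwards [h2] with n hn
  have hs : Real.sqrt n ^ (2 * m) = (n : ℝ)^m := by
    rw [pow_mul, Real.sq_sqrt (Nat.cast_nonneg n)]
  simp only [Function.comp] at hn
  rw [hs, Real.norm_of_nonneg (by positivity), Real.norm_of_nonneg (Real.exp_pos _).le] at hn
  calc a * (n:ℝ)^m ≤ a * (1 / a * Real.exp (c * Real.sqrt n)) := mul_le_mul_of_nonneg_left hn ha.le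
    _ = _ := by field_simp

/-- the numerical requirements -/
structure Nums (k Δ : ℕ) (γ : ℝ) (M N s0 : ℕ) (θ al : ℝ) (n : ℕ) : Prop where
  n1 : 1 ≤ n
  m1 : (k+1) * Δ * M ≤ ⌊γ * n / 8⌋₊
  m2 : ⌊γ * n / 8⌋₊ + k ≤ n
  m3 : ((k + 1 + ⌊γ * n / 8⌋₊ : ℕ) : ℝ) ≤ γ * n / 4
  lb : Real.sqrt n * (((k+1) * Δ * M : ℕ) : ℝ) / (al * n) ≤ 1
  θb : 2 * (k + 1 : ℝ) ≤ θ * (al * n)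
  Kb : (((k+1) * Δ * M : ℕ) : ℝ) * (2 * KK k θ (γ/2) / (al * n)) ≤ 1/2
  Q : ((k + 1 : ℕ) : ℝ) * (n : ℝ)^(k+1) * Real.exp ((Real.sqrt n * ((((k+1) * Δ * M : ℕ) : ℝ) *
        (2 * θ + (1 - (2 * (γ/2) / KK k θ (γ/2))^Δ)^N) + s0 +
          4 * KK k θ (γ/2) * (((k+1) * Δ * M : ℕ) : ℝ)^3 / (al * n)) / (al * n) +
          (Real.sqrt n * (((k+1) * Δ * M : ℕ) : ℝ) / (al * n))^2) * ((n / M : ℕ) : ℝ))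
        ≤ Real.exp (Real.sqrt n * γ / 4)
  R : ∀ sc : ℕ, ⌊γ * n / 8⌋₊ ≤ 1 + (k+1) * Δ + (k+1) * Δ * M + (n / M) * (k+1) +
        sc * ((Δ + 1) * ((k+1) * Δ + (k+1))) →
      ((k + 1 : ℕ) : ℝ) * (n : ℝ)^(k+2) * Real.exp (-(γ^(Δ+1) * sc / 2)) ≤
        Real.exp (-(al * n + (((k+1) * Δ * M : ℕ) : ℝ)))

lemma KK_ge {m : ℕ} {θ g : ℝ} (hθ : 0 < θ) (hg : 0 < g) : 1 ≤ KK m θ g := by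
  unfold KK
  have : 0 ≤ 1 / (θ * ((θ/2)^m * (g/2))) := by positivity
  linarith

set_option maxHeartbeats 1000000 in
lemma nums_of {k Δ : ℕ} {γ : ℝ} (hγ : 0 < γ) (hγ1 : γ ≤ 1/2) {M N s0 D1 d P n : ℕ} {θ al K δ : ℝ}
    (hD1 : D1 = (Δ + 1) * ((k+1) * Δ + (k+1))) (hD1p : (1:ℝ) ≤ D1) (hd : d = (k+1) * Δ) (hdp : (1:ℝ) ≤ d)
    (hal : al = γ^(Δ+1) * γ / (128 * D1)) (halp : 0 < al) (hθp : 0 < θ)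
    (hθ2 : d * (2 * θ) ≤ al * γ / 64) (hK : K = KK k θ (γ/2)) (hK1 : 1 ≤ K)
    (hδ : δ = (1 - (2 * (γ/2) / K)^Δ)^N) (hδ0 : 0 ≤ δ) (hδ2 : d * δ ≤ al * γ / 64)
    (hMp : (1:ℝ) ≤ M) (hM2 : 32 * (k+1) ≤ γ * M) (hM3 : 64 * s0 ≤ al * γ * M)
    (hP : P = (k+1) * Δ * M) (hPd : (P:ℝ) = d * M) (hPp : (1:ℝ) ≤ P)
    (h1 : 1 ≤ (n:ℝ)) (h2 : 8 * (P + 1) / γ ≤ n) (h3 : 2 * k ≤ (n:ℝ)) (h4 : 8 * (k+1) / γ ≤ n)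
    (h5 : P / al ≤ Real.sqrt n) (h6 : 2 * (k+1) / (θ * al) ≤ n) (h7 : 4 * P * K / al ≤ n)
    (h8 : (k+1) * (n:ℝ)^(k+1) ≤ Real.exp (γ/8 * Real.sqrt n))
    (h9 : (k+1) * (n:ℝ)^(k+2) ≤ Real.exp (al * Real.sqrt n))
    (h10 : 32 * (2 + d + P) / γ ≤ n) (h11 : P / al ≤ n)
    (h12 : 256 * K * P^3 / (al^2 * γ) ≤ n) (h13 : 64 * P^2 / (al^2 * γ) ≤ Real.sqrt n) :
    Nums k Δ γ M N s0 θ al n := by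
  have hnp : (0:ℝ) < n := by linarith
  have hsq : Real.sqrt n * Real.sqrt n = n := Real.mul_self_sqrt hnp.le
  have hs1 : 1 ≤ Real.sqrt n := Real.one_le_sqrt.2 h1
  have hsle : Real.sqrt n ≤ n := by nlinarith
  have hfl : (⌊γ * n / 8⌋₊ : ℝ) ≤ γ * n / 8 := Nat.floor_le (by positivity)
  have hfl2 : γ * n / 8 < ⌊γ * n / 8⌋₊ + 1 := Nat.lt_floor_add_one _
  have hQle : ((n / M : ℕ) : ℝ) ≤ n / M := Nat.cast_div_le
  rw [div_le_iff₀ (by positivity)] at h2 h4 h5 h6 h7 h10 h11 h12 h13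
  refine ⟨by exact_mod_cast h1, ?_, ?_, ?_, ?_, ?_, ?_, ?_, ?_⟩
  · rw [← hP]
    have : (P:ℝ) < ⌊γ * n / 8⌋₊ + 1 := by linarith
    have : P < ⌊γ * n / 8⌋₊ + 1 := by exact_mod_cast this
    omega
  · have : (⌊γ * n / 8⌋₊ : ℝ) + k ≤ n := by nlinarith
    exact_mod_cast this
  · push_cast
    linarith
  · rw [← hP, div_le_one (by positivity)]
    nlinarith
  · linarith
  · rw [← hP, ← hK, ← mul_div_assoc, div_le_iff₀ (by positivity)]
    linarith
  · rw [← hP, ← hK, ← hδ]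
    set l := Real.sqrt n
    have hξ : (l * (P * (2 * θ + δ) + s0 + 4 * K * P^3 / (al * n)) / (al * n) +
        (l * P / (al * n))^2) * ((n / M : ℕ) : ℝ) ≤ l * γ / 8 := by
      have h0 : 0 ≤ (l * (P * (2 * θ + δ) + s0 + 4 * K * P^3 / (al * n)) / (al * n) +
        (l * P / (al * n))^2) := by positivity
      refine (mul_le_mul_of_nonneg_left hQle h0).trans ?_
      have e1 : l * (P * (2 * θ + δ)) / (al * n) * (n / M) = l * (d * (2 * θ) + d * δ) / al := by
        rw [hPd]; field_simp
      have e2 : l * s0 / (al * n) * (n / M) = l * (s0 / (al * M)) := by field_simp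
      have e3 : l * (4 * K * P^3 / (al * n)) / (al * n) * (n / M) = l * (4 * K * P^3 / (al^2 * n) / M) := by
        field_simp
      have e4 : (l * P / (al * n))^2 * (n / M) = P^2 / al^2 / M := by
        have : l^2 = n := by rw [sq]; exact hsq
        rw [div_pow, mul_pow, this]; field_simp
      have e5 : (l * (P * (2 * θ + δ) + s0 + 4 * K * P^3 / (al * n)) / (al * n) +
        (l * P / (al * n))^2) * (n / M) = l * (d * (2 * θ) + d * δ) / al + l * (s0 / (al * M)) +
          l * (4 * K * P^3 / (al^2 * n) / M) + P^2 / al^2 / M := by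
        rw [← e1, ← e2, ← e3, ← e4]; ring
      rw [e5]
      have b1 : l * (d * (2 * θ) + d * δ) / al ≤ l * (γ / 32) := by
        rw [div_le_iff₀ halp]
        nlinarith
      have b2 : l * (s0 / (al * M)) ≤ l * (γ / 64) := by
        apply mul_le_mul_of_nonneg_left _ (by linarith)
        rw [div_le_iff₀ (by positivity)]; linarith
      have b3 : l * (4 * K * P^3 / (al^2 * n) / M) ≤ l * (γ / 64) := by
        apply mul_le_mul_of_nonneg_left _ (by linarith)
        refine (div_le_self (by positivity) hMp).trans ?_
        rw [div_le_iff₀ (by positivity)]; linarith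
      have b4 : P^2 / al^2 / M ≤ l * (γ / 64) := by
        refine (div_le_self (by positivity) hMp).trans ?_
        rw [div_le_iff₀ (by positivity)]; linarith
      have hlγ : 0 < l * γ := by positivity
      linarith
    calc _ ≤ Real.exp (γ / 8 * l) * Real.exp (l * γ / 8) := by
          apply mul_le_mul _ (Real.exp_le_exp.2 hξ) (Real.exp_pos _).le (Real.exp_pos _).le
          push_cast; exact h8
      _ = _ := by rw [← Real.exp_add]; congr 1; ring
  · intro sc hsc
    rw [← hD1, ← hP, ← hd] at hsc
    rw [← hP]
    have hsc' : (⌊γ * n / 8⌋₊ : ℝ) ≤ 1 + d + P + ((n / M : ℕ) : ℝ) * (k+1) + sc * D1 := by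
      exact_mod_cast hsc
    have hq : ((n / M : ℕ) : ℝ) * (k+1) ≤ γ * n / 32 := by
      refine (mul_le_mul_of_nonneg_right hQle (by positivity)).trans ?_
      rw [div_mul_eq_mul_div, div_le_iff₀ (by positivity)]
      nlinarith
    have hsD : γ * n / 16 ≤ sc * D1 := by linarith
    have h4al : 4 * (al * n) ≤ γ^(Δ+1) * sc / 2 := by
      have : 4 * (al * n) = γ^(Δ+1) / 2 * (γ * n / 16 / D1) := by
        rw [hal]; field_simp; ring
      rw [this]
      have h : γ * n / 16 / D1 ≤ sc := by
        rw [div_le_iff₀ (by positivity)]; exact hsD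
      have := mul_le_mul_of_nonneg_left h (show 0 ≤ γ^(Δ+1) / 2 by positivity)
      linarith
    calc _ ≤ Real.exp (al * Real.sqrt n) * Real.exp (-(γ^(Δ+1) * sc / 2)) := by
          apply mul_le_mul_of_nonneg_right _ (Real.exp_pos _).le
          push_cast; exact h9
      _ = Real.exp (al * Real.sqrt n + -(γ^(Δ+1) * sc / 2)) := by rw [← Real.exp_add]
      _ ≤ _ := by
          apply Real.exp_le_exp.2
          have := mul_le_mul_of_nonneg_left hsle halp.le
          linarith

lemma exists_nums (k Δ : ℕ) (hΔ : 2 ≤ Δ) (γ : ℝ) (hγ : 0 < γ) (hγ1 : γ ≤ 1/2) :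
    ∃ (M N s0 : ℕ) (θ al : ℝ), 1 ≤ M ∧ 0 < θ ∧ θ ≤ 1/8 ∧ 0 < al ∧ al ≤ 1/2 ∧
      ∑ i ∈ range (Δ * N), ((k+1) * Δ)^i ≤ s0 ∧
      ∀ᶠ n : ℕ in atTop, Nums k Δ γ M N s0 θ al n := by
  obtain ⟨D1, hD1⟩ : ∃ D1 : ℕ, D1 = (Δ + 1) * ((k+1) * Δ + (k+1)) := ⟨_, rfl⟩
  have hD1p : (1:ℝ) ≤ D1 := by
    have : 1 ≤ D1 := by rw [hD1]; exact Nat.mul_pos (by omega) (by omega)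
    exact_mod_cast this
  obtain ⟨d, hd⟩ : ∃ d : ℕ, d = (k+1) * Δ := ⟨_, rfl⟩
  have hdp : (1:ℝ) ≤ d := by
    have : 1 ≤ d := by rw [hd]; exact Nat.mul_pos (by omega) (by omega)
    exact_mod_cast this
  obtain ⟨al, hal⟩ : ∃ al : ℝ, al = γ^(Δ+1) * γ / (128 * D1) := ⟨_, rfl⟩
  have halp : 0 < al := by rw [hal]; positivity
  have hal1 : al ≤ 1/2 := by
    rw [hal, div_le_iff₀ (by positivity)]
    have : γ^(Δ+1) ≤ 1 := pow_le_one₀ hγ.le (by linarith)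
    nlinarith [pow_pos hγ (Δ+1)]
  obtain ⟨θ, hθ⟩ : ∃ θ : ℝ, θ = min (1/8) (al * γ / (128 * d)) := ⟨_, rfl⟩
  have hθp : 0 < θ := by rw [hθ]; apply lt_min <;> positivity
  have hθ8 : θ ≤ 1/8 := by rw [hθ]; exact min_le_left _ _
  have hθ2 : d * (2 * θ) ≤ al * γ / 64 := by
    have : θ ≤ al * γ / (128 * d) := by rw [hθ]; exact min_le_right _ _
    rw [le_div_iff₀ (by positivity)] at this
    linarith
  obtain ⟨K, hK⟩ : ∃ K : ℝ, K = KK k θ (γ/2) := ⟨_, rfl⟩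
  have hK1 : 1 ≤ K := by rw [hK]; exact KK_ge hθp (by positivity)
  have ha0 : 0 < (2 * (γ/2) / K)^Δ := by positivity
  have ha1 : (2 * (γ/2) / K)^Δ ≤ 1 := by
    apply pow_le_one₀ (by positivity)
    rw [div_le_one (by positivity)]; linarith
  obtain ⟨N, hN⟩ := exists_pow_lt_of_lt_one (show 0 < al * γ / (64 * d) by positivity)
    (show 1 - (2 * (γ/2) / K)^Δ < 1 by linarith)
  obtain ⟨δ, hδ⟩ : ∃ δ : ℝ, δ = (1 - (2 * (γ/2) / K)^Δ)^N := ⟨_, rfl⟩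
  have hδ0 : 0 ≤ δ := by rw [hδ]; exact pow_nonneg (by linarith) _
  have hδ2 : d * δ ≤ al * γ / 64 := by
    rw [← hδ, lt_div_iff₀ (by positivity)] at hN
    linarith
  obtain ⟨s0, hs0⟩ : ∃ s0 : ℕ, s0 = ∑ i ∈ range (Δ * N), ((k+1) * Δ)^i := ⟨_, rfl⟩
  obtain ⟨M, hM⟩ : ∃ M : ℕ, M = max 1 (max ⌈32 * (k+1) / γ⌉₊ ⌈64 * s0 / (al * γ)⌉₊) := ⟨_, rfl⟩
  have hM1 : 1 ≤ M := by rw [hM]; exact le_max_left _ _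
  have hMp : (1:ℝ) ≤ M := by exact_mod_cast hM1
  have hM2 : 32 * (k+1) ≤ γ * M := by
    have : (32 * (k+1) / γ : ℝ) ≤ M := (Nat.le_ceil _).trans (by
      rw [hM]; exact_mod_cast (le_max_left _ _).trans (le_max_right _ _))
    rw [div_le_iff₀ hγ] at this
    linarith
  have hM3 : 64 * s0 ≤ al * γ * M := by
    have : (64 * s0 / (al * γ) : ℝ) ≤ M := (Nat.le_ceil _).trans (by
      rw [hM]; exact_mod_cast (le_max_right _ _).trans (le_max_right _ _))
    rw [div_le_iff₀ (by positivity)] at this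
    linarith
  refine ⟨M, N, s0, θ, al, hM1, hθp, hθ8, halp, hal1, hs0.ge, ?_⟩
  obtain ⟨P, hP⟩ : ∃ P : ℕ, P = (k+1) * Δ * M := ⟨_, rfl⟩
  have hPd : (P:ℝ) = d * M := by rw [hP, hd]; push_cast; ring
  have hPp : (1:ℝ) ≤ P := by rw [hPd]; nlinarith
  filter_upwards [ev_nat 1, ev_nat (8 * (P + 1) / γ), ev_nat (2 * k), ev_nat (8 * (k+1) / γ),
    ev_sqrt (P / al), ev_nat (2 * (k+1) / (θ * al)), ev_nat (4 * P * K / al),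
    ev_exp (k+1) (γ/8) (by positivity) (by positivity) (k+1),
    ev_exp (k+1) al (by positivity) halp (k+2), ev_nat (32 * (2 + d + P) / γ), ev_nat (P / al),
    ev_nat (256 * K * P^3 / (al^2 * γ)), ev_sqrt (64 * P^2 / (al^2 * γ))] with
    n h1 h2 h3 h4 h5 h6 h7 h8 h9 h10 h11 h12 h13
  exact nums_of hγ hγ1 hD1 hD1p hd hdp hal halp hθp hθ2 hK hK1 hδ hδ0 hδ2 hMp hM2 hM3 hP hPd hPp
    h1 h2 h3 h4 h5 h6 h7 h8 h9 h10 h11 h12 h13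
end Num
end STC

namespace STC
namespace TD
variable {k Δ t : ℕ} {β V : Type} [Fintype V] {T : TD (k+1) Δ t β} {E : (Fin (k+1) → V) → Prop}

lemma card_tests (m : ℕ) : (tests m V).card ≤ m * Fintype.card V ^ m := by
  refine (Finset.card_filter_le _ _).trans ?_
  rw [Finset.card_univ, Fintype.card_prod, Fintype.card_fun, Fintype.card_fin, mul_comm]

lemma card_tests3 (m : ℕ) : (tests3 m V).card ≤ m * Fintype.card V ^ (m+1) := by
  refine (Finset.card_filter_le _ _).trans ?_
  rw [Finset.card_univ, Fintype.card_prod, Fintype.card_prod, Fintype.card_fun, Fintype.card_fin]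
  apply le_of_eq
  ring

lemma assemble (hk : 1 ≤ k) (hΔ : 2 ≤ Δ) {γ θ al : ℝ} {M N s0 n : ℕ} (hγ : 0 < γ) (hγ1 : γ ≤ 1/2)
    (hM : 1 ≤ M) (hθ : 0 < θ) (hθ8 : θ ≤ 1/8) (hal : 0 < al) (hal1 : al ≤ 1/2)
    (hs0 : ∑ i ∈ range (Δ * N), ((k+1) * Δ)^i ≤ s0)
    (hn : Nums k Δ γ M N s0 θ al n) (hV : Fintype.card V = n)
    (hE : ∀ e, E e → Function.Injective e)
    (hsym : ∀ e (σ : Equiv.Perm (Fin (k+1))), E e → E (e ∘ σ))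
    (cod : ∀ e i, InjOff e i → (1/2 + γ) * (n : ℝ) ≤ (nb E (e, i)).card)
    (ht0 : 0 < t) (ht : k + t = n) : ∃ φ : β → V, T.Emb E (range t) φ := by
  have hnp : (1:ℝ) ≤ n := by exact_mod_cast hn.n1
  have hDCt := DC_range (T := T) ht0
  have hm2 := hn.m2
  obtain ⟨T0, q, hT0, hch, hm, hm'⟩ := exists_chain (T := T) (by omega) (by omega) hM hn.m1 (range t) hDCt
    (by rw [Finset.card_range]; omega)
  have hq : q ≤ n / M := by
    rw [Nat.le_div_iff_mul_le (by omega)]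
    have := hch.card
    rw [Finset.card_range, mul_comm] at this
    omega
  obtain ⟨S, hS, hST, hdisj, hSc⟩ := exists_sites (T := T) (by omega) hT0 (hch.bdry.trans hq)
  have hvc := card_verts hT0
  have hverts : ((T.verts T0).card : ℝ) ≤ γ * n / 4 := by
    refine le_trans ?_ hn.m3
    exact_mod_cast (by omega)
  obtain ⟨φ0, hφ0, hsuc⟩ := stage1 (T := T) (E := E) (γ := γ) (S := S) (T0 := T0) hγ (by linarith) hE
    (by rw [hV]; exact cod) (by omega) (by omega) hS hST hdisj hT0
    (by rw [hV]; nlinarith)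
  set P : ℕ := (k+1) * Δ * M with hP
  -- many successes
  have hR : ∀ w e i, InjOff e i → w ∈ T.un T0 φ0 →
      ⌈al * n + (P:ℝ)⌉₊ ≤ (S.filter (T.Succ E φ0 w e i)).card := by
    intro w e i hio hw
    rw [Nat.ceil_le]
    have h1 := hsuc w e i hio hw
    have h2 := hn.R S.card (by omega)
    have h3 : ((tests3 (k+1) V).card : ℝ) ≤ ((k + 1 : ℕ) : ℝ) * (n : ℝ)^(k+2) := by
      have := card_tests3 (V := V) (k+1)
      rw [hV] at this
      exact_mod_cast this
    have h4 := h1.trans ((mul_le_mul_of_nonneg_right h3 (Real.exp_pos _).le).trans h2)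
    rw [Real.exp_le_exp] at h4
    linarith
  have hcu := card_un hφ0
  rw [hV] at hcu
  have hcuR : ((T.un T0 φ0).card : ℝ) + (T.verts T0).card = n := by exact_mod_cast hcu
  have hupos : (0:ℝ) < (T.un T0 φ0).card := by nlinarith
  have hr0 : ∀ s ∈ tests (k+1) V, 1/2 + 3 * γ/4 ≤ rr (nb E s) (T.un T0 φ0) := by
    intro s hs
    have hc := cod s.1 s.2 (Finset.mem_filter.1 hs).2
    unfold rr
    rw [le_div_iff₀ hupos]
    have h1 : (nb E (s.1, s.2)).card ≤ (nb E s ∩ T.un T0 φ0).card + (T.verts T0).card := by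
      have hsub : nb E (s.1, s.2) ⊆ (nb E s ∩ T.un T0 φ0) ∪ (T.verts T0).image φ0 := by
        intro v hv
        by_cases h : v ∈ (T.verts T0).image φ0
        · exact Finset.mem_union_right _ h
        · exact Finset.mem_union_left _ (Finset.mem_inter.2 ⟨hv, Finset.mem_sdiff.2 ⟨Finset.mem_univ _, h⟩⟩)
      exact (Finset.card_le_card hsub).trans ((Finset.card_union_le _ _).trans
        (Nat.add_le_add_left Finset.card_image_le _))
    have h1' : ((nb E (s.1, s.2)).card : ℝ) ≤ (nb E s ∩ T.un T0 φ0).card + (T.verts T0).card := by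
      exact_mod_cast h1
    have h2 : (1/2 + 3 * γ/4) * ((T.un T0 φ0).card : ℝ) ≤ (1/2 + 3 * γ/4) * n := by
      apply mul_le_mul_of_nonneg_left _ (by positivity)
      have : (0:ℝ) ≤ (T.verts T0).card := by positivity
      linarith
    linarith
  have hsqrt : 0 < Real.sqrt n := Real.sqrt_pos.2 (by linarith)
  have hst2 := stage2 (T := T) (E := E) hk (γ := γ) (l := Real.sqrt n) (b := al * n) (θ := θ)
    (ξ := _) (M := M) (M' := P) (N := N) (s0 := s0) (Q := n / M) hE hsym hγ (by linarith) hsqrt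
    (by positivity) hθ hθ8 hn.lb hn.θb hn.Kb hs0 le_rfl (by
      have hK := KK_ge (m := k) hθ (show 0 < γ/2 by positivity)
      have ha1 : (2 * (γ/2) / KK k θ (γ/2))^Δ ≤ 1 := by
        apply pow_le_one₀ (by positivity)
        rw [div_le_one (by positivity)]; linarith
      have hδ0 : 0 ≤ (1 - (2 * (γ/2) / KK k θ (γ/2))^Δ)^N := pow_nonneg (by linarith) _
      positivity) (by
      refine le_trans (mul_le_mul_of_nonneg_right ?_ (Real.exp_pos _).le) hn.Q
      have := card_tests (V := V) (k+1)
      rw [hV] at this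
      exact_mod_cast this) hT0 hφ0 hr0 (by nlinarith) hch hq
  rcases hst2 with ⟨φ, hφ, _, hu, _⟩ | ⟨A, φ, hA, hTA, hφ, hag, hu⟩
  · exact ⟨φ, hφ⟩
  · have hvA := card_verts hA
    have huA := card_un hφ
    rw [hV] at huA
    have hm : (T.un A φ).card ≤ ⌈al * n + (P:ℝ)⌉₊ := by
      have := hu.trans (Nat.le_ceil _)
      exact_mod_cast this
    refine finish_step (T := T) hE hS hST hdisj (φ0 := φ0) (by omega) hR (T.un A φ).card A φ S hA hTA hφ
      (Finset.Subset.refl _) (by omega) (by simpa using hm) ?_ ?_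
    · intro s hs i hi
      funext a
      exact hag _ (tau_mem (hST s hs (Finset.mem_insert_of_mem hi)) a)
    · intro y hy
      exact ⟨y, verts_mono hTA hy, hag y hy⟩
end TD

lemma mem_nb {k : ℕ} {V : Type} [Fintype V] {E : (Fin k → V) → Prop} {e : Fin k → V} {i : Fin k} {v : V} :
    v ∈ nb E (e, i) ↔ E (Function.update e i v) := by
  simp [nb]

lemma cod_nb {k n : ℕ} {γ : ℝ} {H : Finset (Finset (Fin n))} (hH : ∀ e ∈ H, e.card = k + 1)
    (hc : ∀ S : Finset (Fin n), S.card = k →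
        (1 / 2 + γ) * (n : ℝ) ≤ ((H.filter fun e => S ⊆ e).card : ℝ))
    (e : Fin (k+1) → Fin n) (i : Fin (k+1)) (he : InjOff e i) :
    (1/2 + γ) * (n : ℝ) ≤ (nb (fun e : Fin (k+1) → Fin n => univ.image e ∈ H) (e, i)).card := by
  set S := (univ.erase i).image e with hS
  have hSc : S.card = k := by
    rw [hS, Finset.card_image_of_injOn]
    · simp
    · intro a ha b hb h
      exact he (by simpa using ha) (by simpa using hb) h
  refine (hc S hSc).trans ?_
  have himg : ∀ v, univ.image (Function.update e i v) = insert v S := by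
    intro v
    rw [← Finset.insert_erase (Finset.mem_univ i), Finset.image_insert, Function.update_self]
    congr 1
    apply Finset.image_congr
    intro a ha
    have : a ≠ i := by
      have := Finset.mem_coe.1 ha
      rw [Finset.mem_erase] at this
      exact this.1
    exact Function.update_of_ne this _ _
  have hsub : (H.filter fun e => S ⊆ e) ⊆
      (nb (fun e : Fin (k+1) → Fin n => univ.image e ∈ H) (e, i)).image fun v => insert v S := by
    intro f hf
    obtain ⟨hfH, hSf⟩ := Finset.mem_filter.1 hf
    have hcard : (f \ S).card = 1 := by
      rw [Finset.card_sdiff_of_subset hSf, hH f hfH, hSc]; omega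
    obtain ⟨v, hv⟩ := Finset.card_eq_one.1 hcard
    have hins : insert v S = f := by
      rw [Finset.insert_eq, ← hv, Finset.sdiff_union_of_subset hSf]
    refine Finset.mem_image.2 ⟨v, ?_, hins⟩
    rw [mem_nb]
    show univ.image (Function.update e i v) ∈ H
    rw [himg, hins]
    exact hfH
  exact_mod_cast (Finset.card_le_card hsub).trans Finset.card_image_le

lemma main_aux (k Δ : ℕ) (hk : 2 ≤ k) (hΔ : 2 ≤ Δ) (γ : ℝ) (hγ : 0 < γ) :
    ∃ n₀ : ℕ, ∀ n : ℕ, n₀ ≤ n →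
      ∀ H : Finset (Finset (Fin n)), (∀ e ∈ H, e.card = k) →
      (∀ S : Finset (Fin n), S.card = k - 1 →
        (1 / 2 + γ) * (n : ℝ) ≤ ((H.filter fun e => S ⊆ e).card : ℝ)) →
      ∀ T : Finset (Finset (Fin n)), IsTightTree k T → (hverts T).card = n →
      (∀ v, vdeg T v ≤ Δ) →
      Contains H T := by
  obtain ⟨k, rfl⟩ : ∃ k', k = k' + 1 := ⟨k - 1, by omega⟩
  set g := min γ (1/2) with hg
  have hg0 : 0 < g := lt_min hγ (by norm_num)
  obtain ⟨M, N, s0, θ, al, hM, hθ, hθ8, hal, hal1, hs0, hev⟩ :=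
    exists_nums k Δ hΔ g hg0 (min_le_right _ _)
  obtain ⟨n0, hn0⟩ := Filter.eventually_atTop.1 hev
  refine ⟨n0, fun n hn H hH hcod G hG hGn hGd => ?_⟩
  obtain ⟨t, ht0, T, hT1, hT2⟩ := exists_TD hk hG hGd
  have hvT : T.verts (range t) = hverts G := by
    ext v
    rw [TD.mem_verts, hverts, Finset.mem_sup]
    constructor
    · rintro ⟨j, hj, a, rfl⟩
      exact ⟨_, hT2 j (by simpa using hj), Finset.mem_image.2 ⟨a, Finset.mem_univ _, rfl⟩⟩
    · rintro ⟨e, he, hv⟩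
      obtain ⟨j, hj, rfl⟩ := hT1 e he
      obtain ⟨a, _, ha⟩ := Finset.mem_image.1 hv
      exact ⟨j, by simpa using hj, a, ha⟩
  have hcv := TD.card_verts (TD.DC_range (T := T) ht0)
  rw [hvT, hGn, Finset.card_range] at hcv
  have huniv : T.verts (range t) = univ := by
    apply Finset.eq_univ_of_card
    rw [hvT, hGn, Fintype.card_fin]
  obtain ⟨φ, hφ⟩ := TD.assemble (T := T) (E := fun e : Fin (k+1) → Fin n => univ.image e ∈ H)
    (by omega) hΔ hg0 (min_le_right _ _) hM hθ hθ8 hal hal1 hs0 (hn0 n hn) (Fintype.card_fin n)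
    (by
      intro e he
      have := hH _ he
      have h2 : (univ.image e).card = (univ : Finset (Fin (k+1))).card := by rw [this]; simp
      have h3 := Finset.card_image_iff.1 h2
      intro a b h
      exact h3 (by simp) (by simp) h)
    (by
      intro e σ he
      have : univ.image (e ∘ σ) = univ.image e := by
        ext v
        simp only [Finset.mem_image, Finset.mem_univ, true_and, Function.comp]
        exact ⟨fun ⟨a, ha⟩ => ⟨σ a, ha⟩, fun ⟨a, ha⟩ => ⟨σ.symm a, by simpa using ha⟩⟩
      show univ.image (e ∘ σ) ∈ H
      rw [this]; exact he)
    (by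
      apply cod_nb hH
      intro S hS
      refine le_trans ?_ (hcod S hS)
      apply mul_le_mul_of_nonneg_right _ (Nat.cast_nonneg n)
      have := min_le_left γ (1/2)
      linarith)
    ht0 (by omega)
  refine ⟨φ, ?_, ?_⟩
  · intro a b hab
    apply hφ.inj _ _ hab <;> rw [huniv] <;> simp
  · intro e he
    obtain ⟨j, hj, rfl⟩ := hT1 e he
    have := hφ.edge j (by simpa using hj)
    rw [Finset.image_image]
    exact this
end STC

/-- For all integers `k, Δ ≥ 2` and every real `γ > 0` there exists `n₀` such
that every `k`-graph `H` on `n ≥ n₀` vertices with minimum codegree at least `(1/2 + γ)n`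
contains every tight `k`-tree `T` on `n` vertices with maximum 1-degree at most `Δ`. -/
theorem spanning_trees_from_codegree :
    ∀ k Δ : ℕ, 2 ≤ k → 2 ≤ Δ → ∀ γ : ℝ, 0 < γ →
    ∃ n₀ : ℕ, ∀ n : ℕ, n₀ ≤ n →
      ∀ H : Finset (Finset (Fin n)), (∀ e ∈ H, e.card = k) →
      (∀ S : Finset (Fin n), S.card = k - 1 →
        (1 / 2 + γ) * (n : ℝ) ≤ ((H.filter fun e => S ⊆ e).card : ℝ)) →
      ∀ T : Finset (Finset (Fin n)), IsTightTree k T → (hverts T).card = n →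
      (∀ v, vdeg T v ≤ Δ) →
      Contains H T := by
  intro k Δ hk hΔ γ hγ
  exact STC.main_aux k Δ hk hΔ γ hγ
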